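/- Let L be a relational first-order language and let T be a complete monomorphic L-theory having infinite models. Then I(T,ω), the number of isomorphism classes of countably infinite models of T, is either 1 or 2^ℵ₀ (the cardinality of the continuum). -/

import Mathlib

open FirstOrder

universe u v w

/-- The substructure of an `L`-structure induced on a subset of its domain
(for a relational language every subset is the domain of an induced substructure). -/
def inducedStructure (L : FirstOrder.Language.{u, v}) [L.IsRelational] {M : Type w}
    [L.Structure M] (s : Set M) : L.Structure s where
  funMap f := isEmptyElim f
  RelMap R v := FirstOrder.Language.Structure.RelMap R (fun i => (v i : M))

/-- A structure `M` is monomorphic if for every (positive) natural number `n`, any two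
`n`-element subsets of its domain carry isomorphic induced substructures. -/
def IsMonomorphic (L : FirstOrder.Language.{u, v}) [L.IsRelational] (M : Type w)
    [L.Structure M] : Prop :=
  ∀ s t : Set M, s.Finite → t.Finite → s.ncard = t.ncard →
    Nonempty (@FirstOrder.Language.Equiv L s t (inducedStructure L s) (inducedStructure L t))

/-- A linear order on `A`, regarded as a structure for the language with a single binary
relation symbol, the symbol being interpreted as the strict order `<`. -/
def ltStructure {A : Type w} (lo : LinearOrder A) : FirstOrder.Language.order.Structure A where
  funMap f := isEmptyElim f
  RelMap {n} r v := match n, r with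
    | 2, .le => lo.lt (v 0) (v 1)

/-- A linear order on the domain of an `L`-structure `M` chains `M` (equivalently, `M` is
simply definable in the linear order) if every relation of `M` is defined by a
quantifier-free formula of the language of one binary relation symbol, realized in the
linear order. -/
def Chains (L : FirstOrder.Language.{u, v}) {M : Type w} [L.Structure M]
    (lo : LinearOrder M) : Prop :=
  ∀ (m : ℕ) (R : L.Relations m), ∃ φ : FirstOrder.Language.order.Formula (Fin m),
    φ.IsQF ∧ ∀ v : Fin m → M,
      FirstOrder.Language.Structure.RelMap R v ↔
        @FirstOrder.Language.Formula.Realize _ _ (ltStructure lo) _ φ v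

/-- The isomorphism classes of models of `T` with domain `ℕ`. -/
def CountableModelClasses (L : FirstOrder.Language.{u, v}) (T : L.Theory) : Type (max u v) :=
  Quot (fun S₁ S₂ : {S : L.Structure ℕ // @FirstOrder.Language.Theory.Model L ℕ S T} =>
    Nonempty (@FirstOrder.Language.Equiv L ℕ ℕ S₁.1 S₂.1))

/-- `I(T,ω)`: the number of isomorphism classes of models of `T` with domain `ℕ`
(equivalently, of countably infinite models of `T`, when `T` has only infinite models). -/
noncomputable def numCountableModels (L : FirstOrder.Language.{u, v}) (T : L.Theory) :
    Cardinal.{max u v} :=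
  Cardinal.mk (CountableModelClasses L T)

/-- A theory is monomorphic if every model of it is a monomorphic structure. -/
def IsMonomorphicTheory (L : FirstOrder.Language.{u, v}) [L.IsRelational] (T : L.Theory) : Prop :=
  ∀ (M : Type w) [L.Structure M], M ⊨ T → IsMonomorphic L M

open Set Filter FirstOrder.Language

/-- The finite set of possible `n`-types of subsets of linear orders. -/
def OrdTyp : ℕ → Type
  | 0 => Unit
  | n + 1 => Set (OrdTyp n × OrdTyp n)

namespace OrdTyp

instance finite : ∀ n, Finite (OrdTyp n)
  | 0 => inferInstanceAs (Finite Unit)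
  | n + 1 => by
    have := finite n
    exact inferInstanceAs (Finite (Set (OrdTyp n × OrdTyp n)))

/-- The `n`-type determined by an `(n+1)`-type. -/
def trunc : ∀ {n : ℕ}, OrdTyp (n + 1) → OrdTyp n
  | 0, _ => ()
  | n + 1, S => ((fun p : OrdTyp (n + 1) × OrdTyp (n + 1) => (trunc p.1, trunc p.2)) ''
      (S : Set (OrdTyp (n + 1) × OrdTyp (n + 1))) : Set (OrdTyp n × OrdTyp n))

/-- The `n`-type of a sum of two orders. -/
def add : ∀ {n : ℕ}, OrdTyp n → OrdTyp n → OrdTyp n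
  | 0, _, _ => ()
  | n + 1, S, T =>
    ((fun p : OrdTyp n × OrdTyp n => (p.1, add p.2 (trunc T))) '' (S : Set (OrdTyp n × OrdTyp n)) ∪
      (fun p : OrdTyp n × OrdTyp n => (add (trunc S) p.1, p.2)) '' (T : Set (OrdTyp n × OrdTyp n)) :
      Set (OrdTyp n × OrdTyp n))

/-- The `n`-type of the empty order. -/
def zero : ∀ n : ℕ, OrdTyp n
  | 0 => ()
  | n + 1 => (∅ : Set (OrdTyp n × OrdTyp n))

instance (n : ℕ) : Add (OrdTyp n) := ⟨add⟩
instance (n : ℕ) : Zero (OrdTyp n) := ⟨zero n⟩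

/-- Membership of a pair of `n`-types in an `(n+1)`-type. -/
def Mem {n : ℕ} (p : OrdTyp n × OrdTyp n) (S : OrdTyp (n + 1)) : Prop :=
  @Membership.mem (OrdTyp n × OrdTyp n) (Set (OrdTyp n × OrdTyp n)) _ S p

theorem ext_mem {n : ℕ} {S T : OrdTyp (n + 1)} (h : ∀ a b, Mem (a, b) S ↔ Mem (a, b) T) : S = T :=
  Set.ext fun p => h p.1 p.2

theorem mem_trunc {n : ℕ} {S : OrdTyp (n + 2)} {a b : OrdTyp n} :
    Mem (a, b) (trunc S) ↔ ∃ c d, Mem (c, d) S ∧ trunc c = a ∧ trunc d = b := by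
  constructor
  · rintro ⟨⟨c, d⟩, h, e⟩
    exact ⟨c, d, h, (Prod.ext_iff.1 e).1, (Prod.ext_iff.1 e).2⟩
  · rintro ⟨c, d, h, rfl, rfl⟩
    exact ⟨⟨c, d⟩, h, rfl⟩

theorem mem_add {n : ℕ} {S T : OrdTyp (n + 1)} {a b : OrdTyp n} :
    Mem (a, b) (S + T) ↔ (∃ c, Mem (a, c) S ∧ c + trunc T = b) ∨
      (∃ c, Mem (c, b) T ∧ trunc S + c = a) := by
  constructor
  · rintro (⟨⟨c, d⟩, h, e⟩ | ⟨⟨c, d⟩, h, e⟩)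
    · obtain ⟨rfl, rfl⟩ := Prod.ext_iff.1 e
      exact Or.inl ⟨d, h, rfl⟩
    · obtain ⟨rfl, rfl⟩ := Prod.ext_iff.1 e
      exact Or.inr ⟨c, h, rfl⟩
  · rintro (⟨c, h, rfl⟩ | ⟨c, h, rfl⟩)
    · exact Or.inl ⟨_, h, rfl⟩
    · exact Or.inr ⟨_, h, rfl⟩

theorem not_mem_zero {n : ℕ} {p : OrdTyp n × OrdTyp n} : ¬ Mem p 0 := fun h => h

theorem trunc_add : ∀ {n : ℕ} (S T : OrdTyp (n + 1)), trunc (S + T) = trunc S + trunc T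
  | 0, _, _ => rfl
  | n + 1, S, T => by
    apply ext_mem
    intro a b
    simp only [mem_trunc, mem_add]
    constructor
    · rintro ⟨c, d, (⟨x, h, rfl⟩ | ⟨x, h, rfl⟩), rfl, rfl⟩
      · exact Or.inl ⟨_, ⟨_, _, h, rfl, rfl⟩, (trunc_add _ _).symm⟩
      · exact Or.inr ⟨_, ⟨_, _, h, rfl, rfl⟩, (trunc_add _ _).symm⟩
    · rintro (⟨x, ⟨c, d, h, rfl, rfl⟩, rfl⟩ | ⟨x, ⟨c, d, h, rfl, rfl⟩, rfl⟩)
      · exact ⟨_, _, Or.inl ⟨_, h, rfl⟩, rfl, trunc_add _ _⟩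
      · exact ⟨_, _, Or.inr ⟨_, h, rfl⟩, trunc_add _ _, rfl⟩

theorem trunc_zero : ∀ {n : ℕ}, trunc (0 : OrdTyp (n + 1)) = 0
  | 0 => rfl
  | n + 1 => by
    apply ext_mem
    intro a b
    simp [mem_trunc, not_mem_zero]

theorem add_assoc' : ∀ {n : ℕ} (S T U : OrdTyp n), S + T + U = S + (T + U)
  | 0, _, _, _ => rfl
  | n + 1, S, T, U => by
    apply ext_mem
    intro a b
    simp only [mem_add, trunc_add]
    constructor
    · rintro (⟨c, (⟨d, h, rfl⟩ | ⟨d, h, rfl⟩), rfl⟩ | ⟨c, h, rfl⟩)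
      · exact Or.inl ⟨d, h, (add_assoc' _ _ _).symm⟩
      · exact Or.inr ⟨d, Or.inl ⟨c, h, rfl⟩, rfl⟩
      · exact Or.inr ⟨_, Or.inr ⟨c, h, rfl⟩, (add_assoc' _ _ _).symm⟩
    · rintro (⟨c, h, rfl⟩ | ⟨c, (⟨d, h, rfl⟩ | ⟨d, h, rfl⟩), rfl⟩)
      · exact Or.inl ⟨_, Or.inl ⟨c, h, rfl⟩, add_assoc' _ _ _⟩
      · exact Or.inl ⟨d, Or.inr ⟨c, h, rfl⟩, rfl⟩
      · exact Or.inr ⟨d, h, add_assoc' _ _ _⟩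

theorem zero_add' : ∀ {n : ℕ} (S : OrdTyp n), 0 + S = S
  | 0, _ => rfl
  | n + 1, S => by
    have ih : ∀ S : OrdTyp n, 0 + S = S := zero_add'
    apply ext_mem
    intro a b
    simp [mem_add, trunc_zero, not_mem_zero, ih]

theorem add_zero' : ∀ {n : ℕ} (S : OrdTyp n), S + 0 = S
  | 0, _ => rfl
  | n + 1, S => by
    have ih : ∀ S : OrdTyp n, S + 0 = S := add_zero'
    apply ext_mem
    intro a b
    simp [mem_add, trunc_zero, not_mem_zero, ih]

instance (n : ℕ) : AddMonoid (OrdTyp n) where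
  add_assoc := add_assoc'
  zero_add := zero_add'
  add_zero := add_zero'
  nsmul := nsmulRec

end OrdTyp

open OrdTyp

section Types

variable {α β γ : Type*} [LinearOrder α] [LinearOrder β] [LinearOrder γ]

/-- The `n`-type of a subset of a linear order. -/
def tp : ∀ (n : ℕ), Set α → OrdTyp n
  | 0, _ => ()
  | n + 1, s => ((fun a => (tp n (s ∩ Iio a), tp n (s ∩ Ioi a))) '' s : Set (OrdTyp n × OrdTyp n))

theorem mem_tp {n : ℕ} {s : Set α} {p q : OrdTyp n} :
    Mem (p, q) (tp (n + 1) s) ↔ ∃ a ∈ s, tp n (s ∩ Iio a) = p ∧ tp n (s ∩ Ioi a) = q := by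
  constructor
  · rintro ⟨a, ha, e⟩
    exact ⟨a, ha, (Prod.ext_iff.1 e).1, (Prod.ext_iff.1 e).2⟩
  · rintro ⟨a, ha, rfl, rfl⟩
    exact ⟨a, ha, rfl⟩

theorem trunc_tp : ∀ (n : ℕ) (s : Set α), trunc (tp (n + 1) s) = tp n s
  | 0, _ => rfl
  | n + 1, s => by
    apply ext_mem
    intro a b
    simp only [mem_trunc, mem_tp]
    constructor
    · rintro ⟨c, d, ⟨x, hx, rfl, rfl⟩, rfl, rfl⟩
      exact ⟨x, hx, (trunc_tp _ _).symm, (trunc_tp _ _).symm⟩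
    · rintro ⟨x, hx, rfl, rfl⟩
      exact ⟨_, _, ⟨x, hx, rfl, rfl⟩, trunc_tp _ _, trunc_tp _ _⟩

theorem tp_eq_of_succ {n : ℕ} {s : Set α} {t : Set β} (h : tp (n + 1) s = tp (n + 1) t) :
    tp n s = tp n t := by
  rw [← trunc_tp, h, trunc_tp]

theorem tp_eq_of_le {m n : ℕ} (hmn : m ≤ n) {s : Set α} {t : Set β} (h : tp n s = tp n t) :
    tp m s = tp m t := by
  induction n, hmn using Nat.le_induction with
  | base => exact h
  | succ n _ ih => exact ih (tp_eq_of_succ h)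

@[simp] theorem tp_empty : ∀ n : ℕ, tp n (∅ : Set α) = 0
  | 0 => rfl
  | n + 1 => by
    apply ext_mem
    intro a b
    simp [mem_tp, not_mem_zero]

theorem tp_succ_eq_iff {n : ℕ} {s : Set α} {t : Set β} :
    tp (n + 1) s = tp (n + 1) t ↔
      (∀ a ∈ s, ∃ b ∈ t, tp n (s ∩ Iio a) = tp n (t ∩ Iio b) ∧
        tp n (s ∩ Ioi a) = tp n (t ∩ Ioi b)) ∧
      ∀ b ∈ t, ∃ a ∈ s, tp n (s ∩ Iio a) = tp n (t ∩ Iio b) ∧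
        tp n (s ∩ Ioi a) = tp n (t ∩ Ioi b) := by
  constructor
  · intro h
    constructor
    · intro a ha
      have : Mem (tp n (s ∩ Iio a), tp n (s ∩ Ioi a)) (tp (n + 1) t) :=
        h ▸ mem_tp.2 ⟨a, ha, rfl, rfl⟩
      obtain ⟨b, hb, h1, h2⟩ := mem_tp.1 this
      exact ⟨b, hb, h1.symm, h2.symm⟩
    · intro b hb
      have : Mem (tp n (t ∩ Iio b), tp n (t ∩ Ioi b)) (tp (n + 1) s) :=
        h ▸ mem_tp.2 ⟨b, hb, rfl, rfl⟩
      exact mem_tp.1 this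
  · rintro ⟨h1, h2⟩
    apply ext_mem
    intro p q
    simp only [mem_tp]
    constructor
    · rintro ⟨a, ha, rfl, rfl⟩
      obtain ⟨b, hb, e1, e2⟩ := h1 a ha
      exact ⟨b, hb, e1.symm, e2.symm⟩
    · rintro ⟨b, hb, rfl, rfl⟩
      exact h2 b hb

theorem tp_image {f : α → β} : ∀ (n : ℕ) {s : Set α}, StrictMonoOn f s → tp n (f '' s) = tp n s
  | 0, _, _ => rfl
  | n + 1, s, hf => by
    have e1 : ∀ a ∈ s, f '' s ∩ Iio (f a) = f '' (s ∩ Iio a) := by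
      intro a ha
      ext y
      constructor
      · rintro ⟨⟨x, hx, rfl⟩, hy⟩
        exact ⟨x, ⟨hx, (hf.lt_iff_lt hx ha).1 hy⟩, rfl⟩
      · rintro ⟨x, ⟨hx, hxa⟩, rfl⟩
        exact ⟨⟨x, hx, rfl⟩, hf hx ha hxa⟩
    have e2 : ∀ a ∈ s, f '' s ∩ Ioi (f a) = f '' (s ∩ Ioi a) := by
      intro a ha
      ext y
      constructor
      · rintro ⟨⟨x, hx, rfl⟩, hy⟩
        exact ⟨x, ⟨hx, (hf.lt_iff_lt ha hx).1 hy⟩, rfl⟩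
      · rintro ⟨x, ⟨hx, hxa⟩, rfl⟩
        exact ⟨⟨x, hx, rfl⟩, hf ha hx hxa⟩
    have key : ∀ a ∈ s, tp n (f '' s ∩ Iio (f a)) = tp n (s ∩ Iio a) ∧
        tp n (f '' s ∩ Ioi (f a)) = tp n (s ∩ Ioi a) := by
      intro a ha
      rw [e1 a ha, e2 a ha]
      exact ⟨tp_image n (hf.mono inter_subset_left), tp_image n (hf.mono inter_subset_left)⟩
    rw [tp_succ_eq_iff]
    constructor
    · rintro _ ⟨a, ha, rfl⟩
      exact ⟨a, ha, key a ha⟩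
    · intro a ha
      exact ⟨f a, ⟨a, ha, rfl⟩, key a ha⟩

theorem tp_union : ∀ (n : ℕ) {s t : Set α}, (∀ x ∈ s, ∀ y ∈ t, x < y) →
    tp n (s ∪ t) = tp n s + tp n t
  | 0, _, _, _ => rfl
  | n + 1, s, t, h => by
    have e1 : ∀ a ∈ s, (s ∪ t) ∩ Iio a = s ∩ Iio a := by
      intro a ha
      ext x
      simp only [mem_inter_iff, mem_union, mem_Iio]
      exact ⟨fun hx => ⟨hx.1.resolve_right fun hxt => (h a ha x hxt).not_gt hx.2, hx.2⟩,
        fun hx => ⟨Or.inl hx.1, hx.2⟩⟩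
    have e2 : ∀ a ∈ s, (s ∪ t) ∩ Ioi a = (s ∩ Ioi a) ∪ t := by
      intro a ha
      ext x
      simp only [mem_inter_iff, mem_union, mem_Ioi]
      exact ⟨fun hx => hx.1.imp_left fun h => ⟨h, hx.2⟩,
        fun hx => hx.elim (fun h => ⟨Or.inl h.1, h.2⟩) fun hxt => ⟨Or.inr hxt, h a ha x hxt⟩⟩
    have e3 : ∀ a ∈ t, (s ∪ t) ∩ Ioi a = t ∩ Ioi a := by
      intro a ha
      ext x
      simp only [mem_inter_iff, mem_union, mem_Ioi]
      exact ⟨fun hx => ⟨hx.1.resolve_left fun hxt => (h x hxt a ha).not_gt hx.2, hx.2⟩,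
        fun hx => ⟨Or.inr hx.1, hx.2⟩⟩
    have e4 : ∀ a ∈ t, (s ∪ t) ∩ Iio a = s ∪ (t ∩ Iio a) := by
      intro a ha
      ext x
      simp only [mem_inter_iff, mem_union, mem_Iio]
      exact ⟨fun hx => hx.1.imp_right fun h => ⟨h, hx.2⟩,
        fun hx => hx.elim (fun hxt => ⟨Or.inl hxt, h x hxt a ha⟩) fun h => ⟨Or.inr h.1, h.2⟩⟩
    apply ext_mem
    intro p q
    rw [mem_add, trunc_tp, trunc_tp]
    simp only [mem_tp]
    constructor
    · rintro ⟨a, ha | ha, rfl, rfl⟩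
      · left
        refine ⟨_, ⟨a, ha, ?_, rfl⟩, ?_⟩
        · rw [e1 a ha]
        · rw [e2 a ha, tp_union n fun x hx y hy => h x hx.1 y hy]
      · right
        refine ⟨_, ⟨a, ha, rfl, ?_⟩, ?_⟩
        · rw [e3 a ha]
        · rw [e4 a ha, tp_union n fun x hx y hy => h x hx y hy.1]
    · rintro (⟨c, ⟨a, ha, rfl, rfl⟩, rfl⟩ | ⟨c, ⟨a, ha, rfl, rfl⟩, rfl⟩)
      · refine ⟨a, Or.inl ha, ?_, ?_⟩
        · rw [e1 a ha]
        · rw [e2 a ha, tp_union n fun x hx y hy => h x hx.1 y hy]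
      · refine ⟨a, Or.inr ha, ?_, ?_⟩
        · rw [e4 a ha, tp_union n fun x hx y hy => h x hx y hy.1]
        · rw [e3 a ha]

/-- The sequence of all `n`-types of a subset of a linear order. -/
def Th (s : Set α) : ∀ n, OrdTyp n := fun n => tp n s

theorem Th_eq_iff {s : Set α} {t : Set β} : Th s = Th t ↔ ∀ n, tp n s = tp n t :=
  funext_iff

theorem Th_union {s t : Set α} (h : ∀ x ∈ s, ∀ y ∈ t, x < y) : Th (s ∪ t) = Th s + Th t :=
  funext fun n => tp_union n h

theorem Th_image {f : α → β} {s : Set α} (hf : StrictMonoOn f s) : Th (f '' s) = Th s :=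
  funext fun n => tp_image n hf

end Types

section Additive

variable {α β γ : Type*} [LinearOrder α] [LinearOrder β] [LinearOrder γ]

/-- The open intervals of a set `s` with endpoints in `s` (possibly unbounded). -/
inductive Piece (s : Set α) : Set α → Prop
  | self : Piece s s
  | inter_Iio {p : Set α} {a : α} : Piece s p → a ∈ p → Piece s (p ∩ Iio a)
  | inter_Ioi {p : Set α} {a : α} : Piece s p → a ∈ p → Piece s (p ∩ Ioi a)

theorem Piece.subset {s p : Set α} (h : Piece s p) : p ⊆ s := by
  induction h with
  | self => exact subset_rfl
  | inter_Iio _ _ ih => exact inter_subset_left.trans ih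
  | inter_Ioi _ _ ih => exact inter_subset_left.trans ih

theorem Piece.trans {s p q : Set α} (h : Piece s p) (h' : Piece p q) : Piece s q := by
  induction h' with
  | self => exact h
  | inter_Iio _ ha ih => exact ih.inter_Iio ha
  | inter_Ioi _ ha ih => exact ih.inter_Ioi ha

theorem Piece.cases_endpoints {s p : Set α} (h : Piece s p) :
    p = s ∨ (∃ a ∈ s, p = s ∩ Iio a) ∨ (∃ a ∈ s, p = s ∩ Ioi a) ∨
      ∃ a ∈ s, ∃ b ∈ s, a < b ∧ p = s ∩ Ioi a ∩ Iio b := by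
  induction h with
  | self => exact Or.inl rfl
  | @inter_Iio p c _ hc ih =>
    rcases ih with rfl | ⟨a, ha, rfl⟩ | ⟨a, ha, rfl⟩ | ⟨a, ha, b, hb, hab, rfl⟩
    · exact Or.inr (Or.inl ⟨c, hc, rfl⟩)
    · refine Or.inr (Or.inl ⟨c, hc.1, ?_⟩)
      rw [inter_assoc, Iio_inter_Iio, min_eq_right hc.2.le]
    · exact Or.inr (Or.inr (Or.inr ⟨a, ha, c, hc.1, hc.2, rfl⟩))
    · refine Or.inr (Or.inr (Or.inr ⟨a, ha, c, hc.1.1, hc.1.2, ?_⟩))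
      rw [inter_assoc _ (Iio b), Iio_inter_Iio, min_eq_right hc.2.le]
  | @inter_Ioi p c _ hc ih =>
    rcases ih with rfl | ⟨a, ha, rfl⟩ | ⟨a, ha, rfl⟩ | ⟨a, ha, b, hb, hab, rfl⟩
    · exact Or.inr (Or.inr (Or.inl ⟨c, hc, rfl⟩))
    · exact Or.inr (Or.inr (Or.inr ⟨c, hc.1, a, ha, hc.2, inter_right_comm _ _ _⟩))
    · refine Or.inr (Or.inr (Or.inl ⟨c, hc.1, ?_⟩))
      rw [inter_assoc, Ioi_inter_Ioi, max_eq_right (le_of_lt hc.2)]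
    · refine Or.inr (Or.inr (Or.inr ⟨c, hc.1.1, b, hb, hc.2, ?_⟩))
      rw [inter_right_comm, inter_assoc s, Ioi_inter_Ioi, max_eq_right (le_of_lt hc.1.2)]

/-- A set all of whose pieces have their theory determined by their `n`-type. -/
def SepAt (n : ℕ) (s : Set α) : Prop :=
  ∀ p q, Piece s p → Piece s q → tp n p = tp n q → Th p = Th q

/-- A set whose pieces realise only finitely many theories. -/
def FinTh (s : Set α) : Prop := ∃ n, SepAt n s

theorem FinTh.finite {s : Set α} (h : FinTh s) : (Th '' {p | Piece s p}).Finite := by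
  obtain ⟨n, hn⟩ := h
  apply Set.Finite.of_finite_image (f := fun θ : ∀ n, OrdTyp n => θ n) (Set.toFinite _)
  rintro _ ⟨p, hp, rfl⟩ _ ⟨q, hq, rfl⟩ h
  exact hn p q hp hq h

theorem FinTh.of_finite {s : Set α} (h : (Th '' {p | Piece s p}).Finite) : FinTh s := by
  classical
  have hex : ∀ θ θ' : ∀ n, OrdTyp n, ∃ n, θ n = θ' n → θ = θ' := by
    intro θ θ'
    by_contra! hc
    exact (hc 0).2 (funext fun n => (hc n).1)
  choose N hN using hex
  obtain ⟨F, hF⟩ : ∃ F : Finset (∀ n, OrdTyp n), ∀ θ, θ ∈ F ↔ θ ∈ Th '' {p | Piece s p} :=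
    ⟨h.toFinset, fun θ => h.mem_toFinset⟩
  refine ⟨(F ×ˢ F).sup fun e => N e.1 e.2, fun p q hp hq hpq => hN _ _ ?_⟩
  have hle : N (Th p) (Th q) ≤ (F ×ˢ F).sup fun e => N e.1 e.2 :=
    Finset.le_sup (f := fun e : (∀ n, OrdTyp n) × (∀ n, OrdTyp n) => N e.1 e.2)
      (b := (Th p, Th q))
      (Finset.mem_product.2 ⟨(hF _).2 ⟨p, hp, rfl⟩, (hF _).2 ⟨q, hq, rfl⟩⟩)
  exact tp_eq_of_le hle hpq

theorem tp_halves_of_succ {n : ℕ} {s : Set α} {t : Set β} (h : tp (n + 1) s = tp (n + 1) t)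
    {a : α} (ha : a ∈ s) : ∃ b ∈ t, tp n (s ∩ Iio a) = tp n (t ∩ Iio b) ∧
      tp n (s ∩ Ioi a) = tp n (t ∩ Ioi b) :=
  (tp_succ_eq_iff.1 h).1 a ha

theorem exists_piece_tp_eq {n : ℕ} {s : Set α} {t : Set β} (h : tp (n + 2) s = tp (n + 2) t)
    {p : Set α} (hp : Piece s p) : ∃ q, Piece t q ∧ tp n p = tp n q := by
  rcases hp.cases_endpoints with rfl | ⟨a, ha, rfl⟩ | ⟨a, ha, rfl⟩ | ⟨a, ha, b, hb, hab, rfl⟩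
  · exact ⟨t, .self, tp_eq_of_le (by omega) h⟩
  · obtain ⟨b, hb, h1, -⟩ := tp_halves_of_succ h ha
    exact ⟨_, .inter_Iio .self hb, tp_eq_of_succ h1⟩
  · obtain ⟨b, hb, -, h1⟩ := tp_halves_of_succ h ha
    exact ⟨_, .inter_Ioi .self hb, tp_eq_of_succ h1⟩
  · obtain ⟨c, hc, -, h1⟩ := tp_halves_of_succ h ha
    obtain ⟨d, hd, h2, -⟩ := tp_halves_of_succ h1 (a := b) ⟨hb, hab⟩
    exact ⟨_, .inter_Iio (.inter_Ioi .self hc) hd, h2⟩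

theorem SepAt.Th_eq {n : ℕ} {s : Set α} (hs : SepAt n s) {t : Set β}
    (h : tp (n + 3) t = tp (n + 3) s) {p : Set α} {q : Set β} (hp : Piece s p) (hq : Piece t q)
    (hpq : tp n p = tp n q) : Th p = Th q := by
  rw [Th_eq_iff]
  intro k
  induction k generalizing p q with
  | zero => rfl
  | succ k ih =>
    obtain ⟨p', hp', e⟩ := exists_piece_tp_eq (n := n + 1) h hq
    have e' : Th p = Th p' := hs _ _ hp hp' (hpq.trans (tp_eq_of_succ e))
    have e' : tp (n + 1) p = tp (n + 1) q := (congrFun e' (n + 1)).trans e.symm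
    rw [tp_succ_eq_iff]
    constructor
    · intro a ha
      obtain ⟨b, hb, h1, h2⟩ := (tp_succ_eq_iff.1 e').1 a ha
      exact ⟨b, hb, ih (hp.inter_Iio ha) (hq.inter_Iio hb) h1,
        ih (hp.inter_Ioi ha) (hq.inter_Ioi hb) h2⟩
    · intro b hb
      obtain ⟨a, ha, h1, h2⟩ := (tp_succ_eq_iff.1 e').2 b hb
      exact ⟨a, ha, ih (hp.inter_Iio ha) (hq.inter_Iio hb) h1,
        ih (hp.inter_Ioi ha) (hq.inter_Ioi hb) h2⟩

theorem SepAt.of_tp_eq {n : ℕ} {s : Set α} (hs : SepAt n s) {t : Set β}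
    (h : tp (n + 3) t = tp (n + 3) s) : SepAt n t := by
  intro q q' hq hq' e
  obtain ⟨p, hp, e1⟩ := exists_piece_tp_eq (n := n + 1) h hq
  rw [← hs.Th_eq h hp hq (tp_eq_of_succ e1.symm),
    ← hs.Th_eq h hp hq' ((tp_eq_of_succ e1.symm).trans e)]

theorem FinTh.of_Th_eq {s : Set α} (hs : FinTh s) {t : Set β} (h : Th t = Th s) : FinTh t :=
  let ⟨n, hn⟩ := hs
  ⟨n, hn.of_tp_eq (congrFun h (n + 3))⟩

theorem Piece.union {s t r : Set α} (hst : ∀ x ∈ s, ∀ y ∈ t, x < y) (h : Piece (s ∪ t) r) :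
    ∃ p q, r = p ∪ q ∧ (Piece s p ∨ p = ∅) ∧ (Piece t q ∨ q = ∅) := by
  have sub : ∀ {u p : Set α}, Piece u p ∨ p = ∅ → p ⊆ u := by
    rintro u p (h | rfl)
    · exact h.subset
    · exact empty_subset _
  have pc : ∀ {u p : Set α} {a : α}, Piece u p ∨ p = ∅ → a ∈ p →
      (Piece u (p ∩ Iio a) ∨ p ∩ Iio a = ∅) ∧ (Piece u (p ∩ Ioi a) ∨ p ∩ Ioi a = ∅) := by
    rintro u p a (h | rfl) ha
    · exact ⟨Or.inl (h.inter_Iio ha), Or.inl (h.inter_Ioi ha)⟩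
    · exact ha.elim
  induction h with
  | self => exact ⟨s, t, rfl, Or.inl .self, Or.inl .self⟩
  | @inter_Iio r a _ ha ih =>
    obtain ⟨p, q, rfl, hp, hq⟩ := ih
    rcases ha with ha | ha
    · refine ⟨p ∩ Iio a, ∅, ?_, (pc hp ha).1, Or.inr rfl⟩
      rw [union_inter_distrib_right]
      congr 1
      exact eq_empty_of_forall_notMem fun x hx => (hst a (sub hp ha) x (sub hq hx.1)).not_gt hx.2
    · refine ⟨p, q ∩ Iio a, ?_, hp, (pc hq ha).1⟩
      rw [union_inter_distrib_right, inter_eq_left.2]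
      exact fun x hx => hst x (sub hp hx) a (sub hq ha)
  | @inter_Ioi r a _ ha ih =>
    obtain ⟨p, q, rfl, hp, hq⟩ := ih
    rcases ha with ha | ha
    · refine ⟨p ∩ Ioi a, q, ?_, (pc hp ha).2, hq⟩
      rw [union_inter_distrib_right, inter_eq_left (s := q).2]
      exact fun x hx => hst a (sub hp ha) x (sub hq hx)
    · refine ⟨∅, q ∩ Ioi a, ?_, Or.inr rfl, (pc hq ha).2⟩
      rw [union_inter_distrib_right]
      congr 1
      exact eq_empty_of_forall_notMem fun x hx => (hst x (sub hp hx.1) a (sub hq ha)).not_gt hx.2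

theorem FinTh.union {s t : Set α} (hst : ∀ x ∈ s, ∀ y ∈ t, x < y) (hs : FinTh s) (ht : FinTh t) :
    FinTh (s ∪ t) := by
  apply FinTh.of_finite
  apply ((hs.finite.insert (Th (∅ : Set α))).add (ht.finite.insert (Th (∅ : Set α)))).subset
  rintro _ ⟨r, hr, rfl⟩
  obtain ⟨p, q, rfl, hp, hq⟩ := Piece.union hst hr
  have sub : ∀ {u p : Set α}, Piece u p ∨ p = ∅ → p ⊆ u := by
    rintro u p (h | rfl)
    · exact h.subset
    · exact empty_subset _
  rw [Th_union fun x hx y hy => hst x (sub hp hx) y (sub hq hy)]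
  apply Set.add_mem_add
  · rcases hp with hp | rfl
    · exact Or.inr ⟨p, hp, rfl⟩
    · exact Or.inl rfl
  · rcases hq with hq | rfl
    · exact Or.inr ⟨q, hq, rfl⟩
    · exact Or.inl rfl

theorem FinTh.empty : FinTh (∅ : Set α) := by
  refine ⟨0, fun p q hp hq _ => ?_⟩
  rw [subset_empty_iff.1 hp.subset, subset_empty_iff.1 hq.subset]

theorem FinTh.of_fibers {I : Type*} [LinearOrder I] {f : α → I} {s : Set α}
    (hf : MonotoneOn f s) (hfin : (f '' s).Finite) (h : ∀ i, FinTh (s ∩ f ⁻¹' {i})) : FinTh s := by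
  classical
  have key : ∀ F : Finset I, FinTh (s ∩ f ⁻¹' F) := by
    intro F
    induction F using Finset.induction_on_max with
    | empty => simpa using FinTh.empty
    | insert a F ha ih =>
      have : s ∩ f ⁻¹' (↑(insert a F) : Set I) = (s ∩ f ⁻¹' F) ∪ (s ∩ f ⁻¹' {a}) := by
        rw [Finset.coe_insert, insert_eq, union_comm, preimage_union, inter_union_distrib_left]
      rw [this]
      refine FinTh.union ?_ ih (h a)
      rintro x ⟨hx, hxF⟩ y ⟨hy, rfl⟩
      by_contra hxy
      exact (hf hy hx (not_lt.1 hxy)).not_gt (ha _ hxF)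
  have := key hfin.toFinset
  rwa [hfin.coe_toFinset, inter_eq_left.2 (subset_preimage_image f s)] at this

/-- Closing a countable set under countably many finitary operations keeps it countable. -/
theorem exists_countable_closed {M : Type*} (W : List M → Set M) (hW : ∀ l, (W l).Countable)
    {C : Set M} (hC : C.Countable) :
    ∃ D : Set M, D.Countable ∧ C ⊆ D ∧ ∀ l : List M, (∀ x ∈ l, x ∈ D) → W l ⊆ D := by
  let step : Set M → Set M := fun D =>
    D ∪ ⋃ l ∈ range (List.map (Subtype.val : ↥D → M)), W l
  let E : ℕ → Set M := fun k => step^[k] C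
  have hE : ∀ k, E (k + 1) = E k ∪ ⋃ l ∈ range (List.map (Subtype.val : ↥(E k) → M)), W l :=
    fun k => Function.iterate_succ_apply' step k C
  have hc : ∀ k, (E k).Countable := by
    intro k
    induction k with
    | zero => exact hC
    | succ k ih =>
      rw [hE]
      have : Countable ↥(E k) := ih.to_subtype
      have hr : (range (List.map (Subtype.val : ↥(E k) → M))).Countable := countable_range _
      exact ih.union (hr.biUnion fun l _ => hW l)
  have hmono : Monotone E := monotone_nat_of_le_succ fun k => by
    rw [hE]
    exact subset_union_left
  refine ⟨⋃ k, E k, countable_iUnion hc, subset_iUnion E 0, fun l hl => ?_⟩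
  have : ∃ k, ∀ x ∈ l, x ∈ E k := by
    induction l with
    | nil => exact ⟨0, by simp⟩
    | cons a l ih =>
      obtain ⟨k, hk⟩ := ih fun x hx => hl x (List.mem_cons_of_mem _ hx)
      obtain ⟨j, hj⟩ := mem_iUnion.1 (hl a List.mem_cons_self)
      refine ⟨max j k, fun x hx => ?_⟩
      rcases List.mem_cons.1 hx with rfl | hx
      · exact hmono (le_max_left _ _) hj
      · exact hmono (le_max_right _ _) (hk x hx)
  obtain ⟨k, hk⟩ := this
  refine subset_trans ?_ (subset_iUnion E (k + 1))
  rw [hE]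
  refine subset_union_of_subset_right ?_ _
  refine subset_biUnion_of_mem (u := fun l => W l) ⟨l.attach.map fun x => ⟨x.1, hk x.1 x.2⟩, ?_⟩
  simp

/-- The set cut out of `K` by finitely many upper (`true`) and lower (`false`) bounds. -/
def cut (K : Set α) : List (Bool × α) → Set α
  | [] => K
  | (true, a) :: l => cut K l ∩ Iio a
  | (false, a) :: l => cut K l ∩ Ioi a

/-- A Löwenheim–Skolem theorem for linear orders with countably many distinguished subsets. -/
theorem exists_countable_tp_eq (𝒦 : Set (Set α)) (h𝒦 : 𝒦.Countable) (W : List α → Set α)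
    (hW : ∀ l, (W l).Countable) {C : Set α} (hC : C.Countable) :
    ∃ D : Set α, D.Countable ∧ C ⊆ D ∧ (∀ l : List α, (∀ x ∈ l, x ∈ D) → W l ⊆ D) ∧
      ∀ n, ∀ K ∈ 𝒦, ∀ l : List (Bool × α), (∀ e ∈ l, e.2 ∈ D) →
        tp n (cut K l ∩ D) = tp n (cut K l) := by
  have hex : ∀ (n : ℕ) (p : Set α) (S : OrdTyp n × OrdTyp n), ∃ V : Set α, V.Countable ∧
      (Mem S (tp (n + 1) p) → ∃ a ∈ p ∩ V, (tp n (p ∩ Iio a), tp n (p ∩ Ioi a)) = S) := by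
    intro n p S
    by_cases h : Mem S (tp (n + 1) p)
    · obtain ⟨a, ha, e1, e2⟩ := mem_tp.1 h
      exact ⟨{a}, countable_singleton a, fun _ => ⟨a, ⟨ha, rfl⟩, by rw [e1, e2]⟩⟩
    · exact ⟨∅, countable_empty, fun h' => (h h').elim⟩
  choose V hVc hV using hex
  let W' : List α → Set α := fun l => W l ∪ ⋃ K ∈ 𝒦, ⋃ bs : List Bool, ⋃ n : ℕ,
    ⋃ S : OrdTyp n × OrdTyp n, V n (cut K (bs.zip l)) S
  have hW' : ∀ l, (W' l).Countable := fun l => (hW l).union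
    (h𝒦.biUnion fun K _ => countable_iUnion fun bs => countable_iUnion fun n =>
      countable_iUnion fun S => hVc _ _ _)
  obtain ⟨D, hD, hCD, hDW⟩ := exists_countable_closed W' hW' hC
  refine ⟨D, hD, hCD, fun l hl => subset_union_left.trans (hDW l hl), ?_⟩
  have hwit : ∀ n, ∀ K ∈ 𝒦, ∀ l : List (Bool × α), (∀ e ∈ l, e.2 ∈ D) → ∀ S,
      V n (cut K l) S ⊆ D := by
    intro n K hK l hl S
    have h1 : ∀ x ∈ l.unzip.2, x ∈ D := by
      intro x hx
      simp only [List.unzip_eq_map, List.mem_map] at hx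
      obtain ⟨e, he, rfl⟩ := hx
      exact hl e he
    refine subset_trans ?_ ((subset_union_right).trans (hDW _ h1))
    intro x hx
    simp only [mem_iUnion]
    refine ⟨K, hK, l.unzip.1, n, S, ?_⟩
    rwa [List.zip_unzip]
  intro n
  induction n with
  | zero => intros; rfl
  | succ n ih =>
    intro K hK l hl
    have key : ∀ a ∈ D, tp n (cut K l ∩ D ∩ Iio a) = tp n (cut K l ∩ Iio a) ∧
        tp n (cut K l ∩ D ∩ Ioi a) = tp n (cut K l ∩ Ioi a) := by
      intro a ha
      rw [inter_right_comm, inter_right_comm _ _ (Ioi a)]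
      have hl' : ∀ b : Bool, ∀ e ∈ (b, a) :: l, e.2 ∈ D := by
        intro b e he
        rcases List.mem_cons.1 he with rfl | he
        · exact ha
        · exact hl e he
      exact ⟨ih K hK ((true, a) :: l) (hl' _), ih K hK ((false, a) :: l) (hl' _)⟩
    rw [tp_succ_eq_iff]
    constructor
    · rintro a ⟨ha, haD⟩
      exact ⟨a, ha, key a haD⟩
    · intro b hb
      obtain ⟨a, ⟨ha, haV⟩, e⟩ := hV n (cut K l) (tp n (cut K l ∩ Iio b), tp n (cut K l ∩ Ioi b))
        (mem_tp.2 ⟨b, hb, rfl, rfl⟩)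
      have haD : a ∈ D := hwit n K hK l hl _ haV
      refine ⟨a, ⟨ha, haD⟩, ?_⟩
      rw [(key a haD).1, (key a haD).2]
      exact ⟨(Prod.ext_iff.1 e).1, (Prod.ext_iff.1 e).2⟩

end Additive

theorem Ultrafilter.exists_eventually_eq {ι F : Type*} [Finite F] (U : Ultrafilter ι) (f : ι → F) :
    ∃ c, ∀ᶠ i in U, f i = c := by
  have h : ∀ᶠ i in U, ∃ c ∈ (univ : Set F), f i = c := Eventually.of_forall fun i => ⟨f i, trivial, rfl⟩
  obtain ⟨c, -, hc⟩ := (Ultrafilter.eventually_exists_mem_iff finite_univ).1 h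
  exact ⟨c, hc⟩

section Germ

variable {ι A : Type*} [LinearOrder A] {U : Ultrafilter ι}

/-- The internal subset of an ultrapower given by a family of sets. -/
def internalSet (U : Ultrafilter ι) (s : ι → Set A) : Set (Germ (U : Filter ι) A) :=
  {x | ∃ f : ι → A, (f : Germ (U : Filter ι) A) = x ∧ ∀ᶠ k in U, f k ∈ s k}

theorem coe_mem_internalSet {A : Type*} {s : ι → Set A} {f : ι → A} :
    (f : Germ (U : Filter ι) A) ∈ internalSet U s ↔ ∀ᶠ k in U, f k ∈ s k := by
  constructor
  · rintro ⟨g, hg, h⟩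
    filter_upwards [Germ.coe_eq.1 hg, h] with k h1 h2
    rwa [← h1]
  · exact fun h => ⟨f, rfl, h⟩

theorem internalSet_inter_Iio (s : ι → Set A) (f : ι → A) :
    internalSet U s ∩ Iio (f : Germ (U : Filter ι) A) = internalSet U fun k => s k ∩ Iio (f k) := by
  ext x
  induction x using Germ.inductionOn with | _ g
  rw [mem_inter_iff, coe_mem_internalSet, coe_mem_internalSet, mem_Iio, Germ.coe_lt,
    ← Filter.eventually_and]
  rfl

theorem internalSet_inter_Ioi (s : ι → Set A) (f : ι → A) :
    internalSet U s ∩ Ioi (f : Germ (U : Filter ι) A) = internalSet U fun k => s k ∩ Ioi (f k) := by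
  ext x
  induction x using Germ.inductionOn with | _ g
  rw [mem_inter_iff, coe_mem_internalSet, coe_mem_internalSet, mem_Ioi, Germ.coe_lt,
    ← Filter.eventually_and]
  rfl

theorem internalSet_univ {A : Type*} : internalSet U (fun _ => (univ : Set A)) = univ :=
  eq_univ_of_forall fun x => by
    induction x using Germ.inductionOn with | _ g
    exact coe_mem_internalSet.2 (Eventually.of_forall fun _ => trivial)

/-- The ultraproduct theorem for `n`-types of internal sets. -/
theorem eventually_tp_eq_internalSet : ∀ (n : ℕ) (s : ι → Set A),
    ∀ᶠ k in U, tp n (s k) = tp n (internalSet U s)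
  | 0, _ => Eventually.of_forall fun _ => rfl
  | n + 1, s => by
    have key : ∀ p : OrdTyp n × OrdTyp n, ∀ᶠ k in U,
        (Mem p (tp (n + 1) (s k)) ↔ Mem p (tp (n + 1) (internalSet U s))) := by
      rintro ⟨p, q⟩
      have fwd : ∀ f : ι → A, ∀ᶠ k in U,
          tp n (s k ∩ Iio (f k)) = tp n (internalSet U s ∩ Iio (f : Germ (U : Filter ι) A)) ∧
          tp n (s k ∩ Ioi (f k)) = tp n (internalSet U s ∩ Ioi (f : Germ (U : Filter ι) A)) := by
        intro f
        rw [internalSet_inter_Iio, internalSet_inter_Ioi]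
        exact (eventually_tp_eq_internalSet n _).and (eventually_tp_eq_internalSet n _)
      by_cases h : Mem (p, q) (tp (n + 1) (internalSet U s))
      · obtain ⟨x, ⟨f, rfl, hf⟩, h1, h2⟩ := mem_tp.1 h
        filter_upwards [fwd f, hf] with k hk hfk
        exact iff_of_true (mem_tp.2 ⟨f k, hfk, hk.1.trans h1, hk.2.trans h2⟩) h
      · have : ¬ ∀ᶠ k in U, Mem (p, q) (tp (n + 1) (s k)) := by
          intro h'
          apply h
          have hch : ∀ k, ∃ a, Mem (p, q) (tp (n + 1) (s k)) →
              a ∈ s k ∧ tp n (s k ∩ Iio a) = p ∧ tp n (s k ∩ Ioi a) = q := by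
            obtain ⟨k₀, hk₀⟩ := h'.exists
            obtain ⟨a₀, -⟩ := mem_tp.1 hk₀
            intro k
            by_cases hk : Mem (p, q) (tp (n + 1) (s k))
            · obtain ⟨a, ha⟩ := mem_tp.1 hk
              exact ⟨a, fun _ => ha⟩
            · exact ⟨a₀, fun h => (hk h).elim⟩
          choose f hf using hch
          have hf' := h'.mono hf
          obtain ⟨k, hk, hk'⟩ := ((fwd f).and hf').exists
          exact mem_tp.2 ⟨f, coe_mem_internalSet.2 (hf'.mono fun k h => h.1),
            hk.1.symm.trans hk'.2.1, hk.2.symm.trans hk'.2.2⟩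
        filter_upwards [Ultrafilter.eventually_not.2 this] with k hk
        exact iff_of_false hk h
    have := (eventually_all.2 key)
    filter_upwards [this] with k hk
    exact ext_mem fun a b => hk (a, b)

theorem tp_univ_germ (n : ℕ) : tp n (univ : Set (Germ (U : Filter ι) A)) = tp n (univ : Set A) := by
  obtain ⟨k, hk⟩ := (eventually_tp_eq_internalSet (U := U) n fun _ => (univ : Set A)).exists
  rw [← internalSet_univ, hk]

end Germ

/-- The level-`n` information about the position of `x` relative to the parameter `a`. -/
def profile {M : Type*} [LinearOrder M] (n : ℕ) (a x : M) :
    (OrdTyp n × OrdTyp n) × (OrdTyp n × OrdTyp n) × (Prop × Prop) :=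
  ((tp n (Iio x), tp n (Ioi x)), (tp n (Ioo a x), tp n (Ioo x a)), (a < x, x < a))

/-- Every sequence of elements has, over every parameter, an ultralimit. -/
def LimitClosed (M : Type*) [LinearOrder M] : Prop :=
  ∀ (a : M) (z : ℕ → M), ∃ y, ∀ n, ∀ᶠ i in (hyperfilter ℕ : Filter ℕ),
    profile n a y = profile n a (z i)

theorem exists_diagonal {A : Type*} [Nonempty A] (φ : ℕ → ℕ → A → Prop)
    (h : ∀ n, ∀ᶠ k in (hyperfilter ℕ : Filter ℕ), ∃ z, ∀ m ≤ n, φ m k z) :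
    ∃ y : ℕ → A, ∀ m, ∀ᶠ k in (hyperfilter ℕ : Filter ℕ), φ m k (y k) := by
  classical
  have hy : ∀ k, ∃ y, ∀ n ≤ k, (∃ z, ∀ m ≤ n, φ m k z) → φ n k y := by
    intro k
    by_cases hk : ∃ n ≤ k, ∃ z, ∀ m ≤ n, φ m k z
    · obtain ⟨n₀, hn₀, hz₀⟩ := hk
      obtain ⟨z, hz⟩ := Nat.findGreatest_spec (P := fun n => ∃ z, ∀ m ≤ n, φ m k z) hn₀ hz₀
      exact ⟨z, fun n hn hex =>
        hz n (Nat.le_findGreatest (P := fun n => ∃ z, ∀ m ≤ n, φ m k z) hn hex)⟩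
    · push Not at hk
      obtain ⟨y⟩ := ‹Nonempty A›
      refine ⟨y, fun n hn ⟨z, hz⟩ => ?_⟩
      obtain ⟨m, hm, hm'⟩ := hk n hn z
      exact (hm' (hz m hm)).elim
  choose y hy using hy
  refine ⟨y, fun m => ?_⟩
  have hlarge : ∀ᶠ k in (hyperfilter ℕ : Filter ℕ), m ≤ k :=
    Nat.hyperfilter_le_atTop (eventually_ge_atTop m)
  filter_upwards [h m, hlarge] with k h1 h2
  exact hy k m h2 h1

theorem limitClosed_germ (A : Type*) [LinearOrder A] :
    LimitClosed (Germ (hyperfilter ℕ : Filter ℕ) A) := by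
  intro a z
  have los : ∀ (n : ℕ) (f g : ℕ → A), ∀ᶠ k in (hyperfilter ℕ : Filter ℕ),
      profile n (f k) (g k) = profile n (f : Germ (hyperfilter ℕ : Filter ℕ) A) g := by
    intro n f g
    have h1 := eventually_tp_eq_internalSet (U := hyperfilter ℕ) n fun k => (univ ∩ Iio (g k) : Set A)
    have h2 := eventually_tp_eq_internalSet (U := hyperfilter ℕ) n fun k => (univ ∩ Ioi (g k) : Set A)
    have h3 := eventually_tp_eq_internalSet (U := hyperfilter ℕ) n
      fun k => (univ ∩ Ioi (f k) ∩ Iio (g k) : Set A)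
    have h4 := eventually_tp_eq_internalSet (U := hyperfilter ℕ) n
      fun k => (univ ∩ Ioi (g k) ∩ Iio (f k) : Set A)
    rw [← internalSet_inter_Iio, internalSet_univ] at h1
    rw [← internalSet_inter_Ioi, internalSet_univ] at h2
    rw [← internalSet_inter_Iio, ← internalSet_inter_Ioi, internalSet_univ] at h3 h4
    simp only [univ_inter, Ioi_inter_Iio] at h1 h2 h3 h4
    have h5 : ∀ f g : ℕ → A, ∀ᶠ k in (hyperfilter ℕ : Filter ℕ),
        (f k < g k) = ((f : Germ (hyperfilter ℕ : Filter ℕ) A) < g) := by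
      intro f g
      by_cases h : (f : Germ (hyperfilter ℕ : Filter ℕ) A) < g
      · filter_upwards [Germ.coe_lt.1 h] with k hk
        exact propext (iff_of_true hk h)
      · filter_upwards [Ultrafilter.eventually_not.2 fun h' => h (Germ.coe_lt.2 h')] with k hk
        exact propext (iff_of_false hk h)
    filter_upwards [h1, h2, h3, h4, h5 f g, h5 g f] with k e1 e2 e3 e4 e5 e6
    simp only [profile, e1, e2, e3, e4, e5, e6]
  induction a using Germ.inductionOn with | _ a
  choose z' hz' using fun i => Quotient.exists_rep (z i)
  have hz' : ∀ i, ((z' i : ℕ → A) : Germ (hyperfilter ℕ : Filter ℕ) A) = z i := hz'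
  choose c hc using fun n => (hyperfilter ℕ).exists_eventually_eq
    fun i => profile n (a : Germ (hyperfilter ℕ : Filter ℕ) A) (z i)
  have : Nonempty A := ⟨a 0⟩
  obtain ⟨y, hy⟩ := exists_diagonal (fun n k x => profile n (a k) x = c n) (by
    intro n
    have : ∀ᶠ i in (hyperfilter ℕ : Filter ℕ), ∀ m ∈ Finset.range (n + 1),
        profile m (a : Germ (hyperfilter ℕ : Filter ℕ) A) (z i) = c m :=
      (Finset.eventually_all _).2 fun m _ => hc m
    obtain ⟨i, hi⟩ := this.exists
    have : ∀ᶠ k in (hyperfilter ℕ : Filter ℕ), ∀ m ∈ Finset.range (n + 1),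
        profile m (a k) (z' i k) = profile m (a : Germ (hyperfilter ℕ : Filter ℕ) A) (z' i) :=
      (Finset.eventually_all _).2 fun m _ => los m a (z' i)
    filter_upwards [this] with k hk
    refine ⟨z' i k, fun m hm => ?_⟩
    have hm' := Finset.mem_range.2 (Nat.lt_succ_of_le hm)
    rw [hk m hm', hz' i, hi m hm'])
  refine ⟨y, fun n => ?_⟩
  obtain ⟨k, h1, h2⟩ := ((hy n).and (los n a y)).exists
  filter_upwards [hc n] with i hi
  rw [hi, ← h1, h2]

section Classes

variable {M : Type*} [LinearOrder M]

/-- The level-`n` type of an element. -/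
def elTp (n : ℕ) (x : M) : OrdTyp n × OrdTyp n := (tp n (Iio x), tp n (Ioi x))

/-- The complete type of an element. -/
def elTh (x : M) : (∀ n, OrdTyp n) × (∀ n, OrdTyp n) := (Th (Iio x), Th (Ioi x))

theorem elTh_eq_iff {x y : M} : elTh x = elTh y ↔ ∀ n, elTp n x = elTp n y := by
  simp only [elTh, elTp, Prod.ext_iff, Th_eq_iff, forall_and]

theorem elTp_eq_of_succ {n : ℕ} {x y : M} (h : elTp (n + 1) x = elTp (n + 1) y) :
    elTp n x = elTp n y :=
  Prod.ext (tp_eq_of_succ (Prod.ext_iff.1 h).1) (tp_eq_of_succ (Prod.ext_iff.1 h).2)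

/-- The level-`n` types realised at or above an element. -/
def upTypes (x : M) (n : ℕ) : Set (OrdTyp n × OrdTyp n) := {θ | ∃ u, x ≤ u ∧ elTp n u = θ}

theorem upTypes_anti {x y : M} (h : x ≤ y) (n : ℕ) : upTypes y n ⊆ upTypes x n := by
  rintro _ ⟨u, hu, rfl⟩
  exact ⟨u, h.trans hu, rfl⟩

theorem tp_Iio_of_lt {a b : M} (h : a < b) (n : ℕ) :
    tp n (Iio b) = tp n (Iio a) + tp n ({()} : Set Unit) + tp n (Ioo a b) := by
  have h1 : Iio b = Iio a ∪ (fun _ : Unit => a) '' {()} ∪ Ioo a b := by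
    ext x
    simp only [mem_Iio, image_singleton, mem_union, mem_singleton_iff, mem_Ioo]
    constructor
    · intro hx
      rcases lt_trichotomy x a with h | h | h
      · exact Or.inl (Or.inl h)
      · exact Or.inl (Or.inr h)
      · exact Or.inr ⟨h, hx⟩
    · rintro ((h' | rfl) | h')
      · exact h'.trans h
      · exact h
      · exact h'.2
  rw [h1, tp_union, tp_union, tp_image]
  · intro x _ y _ hxy
    exact (hxy.ne (Subsingleton.elim _ _)).elim
  · rintro x hx _ ⟨_, _, rfl⟩
    exact hx
  · rintro x (hx | ⟨_, _, rfl⟩) y hy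
    · exact lt_trans hx hy.1
    · exact hy.1

theorem tp_Ioi_of_lt {a b : M} (h : a < b) (n : ℕ) :
    tp n (Ioi a) = tp n (Ioo a b) + tp n ({()} : Set Unit) + tp n (Ioi b) := by
  have h1 : Ioi a = Ioo a b ∪ (fun _ : Unit => b) '' {()} ∪ Ioi b := by
    ext x
    simp only [mem_Ioi, image_singleton, mem_union, mem_singleton_iff, mem_Ioo]
    constructor
    · intro hx
      rcases lt_trichotomy x b with h | h | h
      · exact Or.inl (Or.inl ⟨hx, h⟩)
      · exact Or.inl (Or.inr h)
      · exact Or.inr h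
    · rintro ((h' | rfl) | h')
      · exact h'.1
      · exact h
      · exact h.trans h'
  rw [h1, tp_union, tp_union, tp_image]
  · intro x _ y _ hxy
    exact (hxy.ne (Subsingleton.elim _ _)).elim
  · rintro x hx _ ⟨_, _, rfl⟩
    exact hx.2
  · rintro x (hx | ⟨_, _, rfl⟩) y hy
    · exact lt_trans hx.2 hy
    · exact hy

theorem upTypes_eq_of_elTp {n : ℕ} {x y : M} (h : elTp (n + 1) x = elTp (n + 1) y) :
    upTypes x n = upTypes y n := by
  have key : ∀ {x y : M}, elTp (n + 1) x = elTp (n + 1) y → upTypes x n ⊆ upTypes y n := by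
    rintro x y h _ ⟨u, hu, rfl⟩
    rcases hu.eq_or_lt with rfl | hu
    · exact ⟨y, le_rfl, (elTp_eq_of_succ h).symm⟩
    · obtain ⟨h1, h2⟩ := Prod.ext_iff.1 h
      obtain ⟨v, hv, e1, e2⟩ := tp_halves_of_succ h2 (a := u) hu
      rw [Ioi_inter_Iio, Ioi_inter_Iio] at e1
      simp only [Ioi_inter_Ioi, max_eq_right hu.le, max_eq_right (le_of_lt hv)] at e2
      refine ⟨v, le_of_lt hv, Prod.ext ?_ e2.symm⟩
      change tp n (Iio v) = tp n (Iio u)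
      rw [tp_Iio_of_lt hv, tp_Iio_of_lt hu, e1, tp_eq_of_succ h1]
  exact (key h).antisymm (key h.symm)

/-- The convex class of `a`: the elements above which the same types are realised. -/
def upClass (a : M) : Set M := {x | upTypes x = upTypes a}

theorem mem_upClass_self (a : M) : a ∈ upClass a := rfl

theorem mem_upClass_of_elTh {x y : M} (h : elTh x = elTh y) : x ∈ upClass y :=
  funext fun n => upTypes_eq_of_elTp (elTh_eq_iff.1 h (n + 1))

theorem upClass_eq {x a : M} (h : x ∈ upClass a) : upClass x = upClass a := by
  ext y
  have h : upTypes x = upTypes a := h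
  simp only [upClass, mem_ofPred_eq, h]

instance upClass_ordConnected (a : M) : OrdConnected (upClass a) := by
  refine ⟨fun x hx y hy z hz => funext fun n => ?_⟩
  have hx : upTypes x = upTypes a := hx
  have hy : upTypes y = upTypes a := hy
  apply Subset.antisymm
  · rw [← congrFun hx n]
    exact upTypes_anti hz.1 n
  · rw [← congrFun hy n]
    exact upTypes_anti hz.2 n

theorem exists_ne_elTh_eq {u v : M} (h : FinTh (Ioo u v)) {z : ℕ → M} {J : Set ℕ}
    (hJ : J.Infinite) (hz : ∀ j ∈ J, z j ∈ Ioo u v) :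
    ∃ i j, i ≠ j ∧ elTh (z i) = elTh (z j) := by
  have hfin := h.finite
  let g : ℕ → (∀ n, OrdTyp n) × (∀ n, OrdTyp n) :=
    fun j => (Th (Ioo u v ∩ Iio (z j)), Th (Ioo u v ∩ Ioi (z j)))
  obtain ⟨i, hi, j, hj, hij, e⟩ := hJ.exists_ne_map_eq_of_mapsTo
    (f := g) (t := (Th '' {p | Piece (Ioo u v) p}) ×ˢ (Th '' {p | Piece (Ioo u v) p}))
    (fun j hj => ⟨⟨_, .inter_Iio .self (hz j hj), rfl⟩, ⟨_, .inter_Ioi .self (hz j hj), rfl⟩⟩)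
    (hfin.prod hfin)
  refine ⟨i, j, hij, elTh_eq_iff.2 fun n => ?_⟩
  have e1 : ∀ k ∈ J, Ioo u v ∩ Iio (z k) = Ioo u (z k) := by
    intro k hk
    rw [Ioo_inter_Iio, min_eq_right (hz k hk).2.le]
  have e2 : ∀ k ∈ J, Ioo u v ∩ Ioi (z k) = Ioo (z k) v := by
    intro k hk
    rw [Ioo_inter_Ioi, max_eq_right (hz k hk).1.le]
  have h1 := congrFun (Prod.ext_iff.1 e).1 n
  have h2 := congrFun (Prod.ext_iff.1 e).2 n
  simp only [g, Th, e1 i hi, e1 j hj, e2 i hi, e2 j hj] at h1 h2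
  simp only [elTp]
  rw [tp_Iio_of_lt (hz i hi).1, tp_Iio_of_lt (hz j hj).1, tp_Ioi_of_lt (hz i hi).2,
    tp_Ioi_of_lt (hz j hj).2, h1, h2]

theorem Piece.Ioo_of_ordConnected {X : Set M} [hX : OrdConnected X] {a b : M} (ha : a ∈ X)
    (hb : b ∈ X) (hab : a < b) : Piece X (Ioo a b) := by
  have : Ioo a b = X ∩ Ioi a ∩ Iio b := by
    rw [inter_assoc, Ioi_inter_Iio, inter_eq_right.2]
    exact Ioo_subset_Icc_self.trans (hX.out ha hb)
  rw [this]
  exact .inter_Iio (.inter_Ioi .self ha) ⟨hb, hab⟩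

/-- In a limit-closed order which does not realise only finitely many theories of intervals,
some class does not either. -/
theorem exists_not_finTh_upClass (hM : LimitClosed M) (h : ¬ FinTh (univ : Set M)) :
    ∃ a : M, ¬ FinTh (upClass a) := by
  by_contra! hall
  let S : Setoid M := Setoid.ker (upTypes : M → _)
  let r : M → M := fun x => (Quotient.mk S x).out
  have hr : ∀ x, upTypes (r x) = upTypes x := fun x => Quotient.mk_out (s := S) x
  have hr' : ∀ x y, upTypes x = upTypes y → r x = r y := by
    intro x y hxy
    have : Quotient.mk S x = Quotient.mk S y := Quotient.sound (s := S) hxy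
    simp only [r, this]
  have hmono : Monotone r := by
    intro x y hxy
    by_contra hlt
    rw [not_le] at hlt
    refine hlt.ne (hr' _ _ (funext fun n => ?_)).symm
    apply Subset.antisymm _ (upTypes_anti hxy n)
    rw [← hr x, ← hr y]
    exact upTypes_anti hlt.le n
  by_cases hfin : (range r).Finite
  · refine h (FinTh.of_fibers (f := r) (hmono.monotoneOn _) (by rwa [image_univ]) fun i => ?_)
    rw [univ_inter]
    by_cases hi : i ∈ range r
    · obtain ⟨x, rfl⟩ := hi
      convert hall x using 1
      ext y
      refine ⟨fun hy => ?_, fun hy => hr' _ _ hy⟩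
      have hy : r y = r x := hy
      change upTypes y = upTypes x
      rw [← hr y, hy, hr x]
    · convert FinTh.empty (α := M)
      exact eq_empty_of_forall_notMem fun y hy => hi ⟨y, hy⟩
  · have hinf : (range r).Infinite := hfin
    have hz₀ := hinf.natEmbedding
    let z : ℕ → M := fun i => hz₀ i
    have hz : ∀ i j, upTypes (z i) = upTypes (z j) → i = j := by
      intro i j hij
      apply hz₀.injective
      apply Subtype.ext
      obtain ⟨x, hx⟩ := (hz₀ i).2
      obtain ⟨y, hy⟩ := (hz₀ j).2
      simp only [z] at hij
      rw [← hx, ← hy] at hij ⊢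
      rw [hr, hr] at hij
      exact hr' _ _ hij
    obtain ⟨a, ha⟩ := hM (z 0) z
    have ha' : ∀ n, ∀ᶠ i in (hyperfilter ℕ : Filter ℕ), elTp n a = elTp n (z i) :=
      fun n => (ha n).mono fun i hi => (Prod.ext_iff.1 hi).1
    obtain ⟨y, hy⟩ := hM a z
    have hya : elTh y = elTh a := elTh_eq_iff.2 fun n => by
      obtain ⟨i, h1, h2⟩ := ((ha' n).and (hy n)).exists
      exact ((Prod.ext_iff.1 h2).1 : elTp n y = elTp n (z i)).trans h1.symm
    have hyX : y ∈ upClass a := mem_upClass_of_elTh hya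
    obtain ⟨n, hn⟩ := hall a
    have hne : ∀ᶠ i in (hyperfilter ℕ : Filter ℕ), upTypes (z i) ≠ upTypes a := by
      apply hyperfilter_le_cofinite
      refine Set.Finite.subset (s := {i | upTypes (z i) = upTypes a}) ?_ (fun i hi => ?_)
      · exact Set.Subsingleton.finite fun i hi j hj =>
          hz i j (Eq.trans hi (Eq.symm hj))
      · by_contra hc
        exact hi hc
    obtain ⟨i, hi, hni⟩ := ((hy (n + 3)).and hne).exists
    simp only [profile, Prod.mk.injEq] at hi
    obtain ⟨-, ⟨hi1, hi2⟩, hi3, hi4⟩ := hi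
    rcases lt_trichotomy a y with hay | rfl | hay
    · have hFin : FinTh (Ioo a (z i)) :=
        ⟨n, SepAt.of_tp_eq (fun p q hp hq => hn p q
          ((Piece.Ioo_of_ordConnected (mem_upClass_self a) hyX hay).trans hp)
          ((Piece.Ioo_of_ordConnected (mem_upClass_self a) hyX hay).trans hq)) hi1.symm⟩
      have haz : a < z i := hi3 ▸ hay
      obtain ⟨N, hN⟩ : ∃ N, ¬ upTypes a N ⊆ upTypes (z i) N := by
        by_contra! hc
        exact hni (funext fun N => (upTypes_anti haz.le N).antisymm (hc N))
      have hJ : ∀ᶠ j in (hyperfilter ℕ : Filter ℕ), z j ∈ Ioo a (z i) := by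
        filter_upwards [hy 0, ha' (N + 1)] with j h1 h2
        simp only [profile, Prod.mk.injEq] at h1
        refine ⟨h1.2.2.1 ▸ hay, lt_of_not_ge fun hge => hN ?_⟩
        rw [upTypes_eq_of_elTp h2]
        exact upTypes_anti hge N
      obtain ⟨j, k, hjk, e⟩ := exists_ne_elTh_eq hFin
        (J := {j | z j ∈ Ioo a (z i)})
        (fun hf => notMem_hyperfilter_of_finite hf hJ) fun j hj => hj
      exact hjk (hz _ _ (mem_upClass_of_elTh e))
    · have : z i = a := by
        apply le_antisymm
        · exact not_lt.1 (hi3 ▸ lt_irrefl a)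
        · exact not_lt.1 (hi4 ▸ lt_irrefl a)
      exact hni (by rw [this])
    · have hFin : FinTh (Ioo (z i) a) :=
        ⟨n, SepAt.of_tp_eq (fun p q hp hq => hn p q
          ((Piece.Ioo_of_ordConnected hyX (mem_upClass_self a) hay).trans hp)
          ((Piece.Ioo_of_ordConnected hyX (mem_upClass_self a) hay).trans hq)) hi2.symm⟩
      have haz : z i < a := hi4 ▸ hay
      obtain ⟨N, hN⟩ : ∃ N, ¬ upTypes (z i) N ⊆ upTypes a N := by
        by_contra! hc
        exact hni (funext fun N => (hc N).antisymm (upTypes_anti haz.le N))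
      have hJ : ∀ᶠ j in (hyperfilter ℕ : Filter ℕ), z j ∈ Ioo (z i) a := by
        filter_upwards [hy 0, ha' (N + 1)] with j h1 h2
        simp only [profile, Prod.mk.injEq] at h1
        refine ⟨lt_of_not_ge fun hge => hN ?_, h1.2.2.2 ▸ hay⟩
        rw [upTypes_eq_of_elTp h2]
        exact upTypes_anti hge N
      obtain ⟨j, k, hjk, e⟩ := exists_ne_elTh_eq hFin
        (J := {j | z j ∈ Ioo (z i) a})
        (fun hf => notMem_hyperfilter_of_finite hf hJ) fun j hj => hj
      exact hjk (hz _ _ (mem_upClass_of_elTh e))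

/-- A set with a labelling such that any label-preserving move extends by one point, and every
label is cofinal and coinitial. -/
structure HomogeneousOn {τ : Type*} (X : Set M) (t : M → τ) : Prop where
  right : ∀ x ∈ X, ∀ x' ∈ X, ∀ y ∈ X, t x = t x' → x < y →
    ∃ y' ∈ X, x' < y' ∧ Th (X ∩ Ioo x' y') = Th (X ∩ Ioo x y) ∧ t y' = t y
  left : ∀ y ∈ X, ∀ y' ∈ X, ∀ x ∈ X, t y = t y' → x < y →
    ∃ x' ∈ X, x' < y' ∧ Th (X ∩ Ioo x' y') = Th (X ∩ Ioo x y) ∧ t x' = t x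
  cofinal : ∀ x ∈ X, ∀ w ∈ X, ∃ y ∈ X, w < y ∧ t y = t x
  coinitial : ∀ x ∈ X, ∀ w ∈ X, ∃ y ∈ X, y < w ∧ t y = t x

theorem exists_right_extension (hM : LimitClosed M) {x x' y : M} (h : elTh x = elTh x')
    (hxy : x < y) : ∃ y', x' < y' ∧ Th (Ioo x' y') = Th (Ioo x y) ∧ elTh y' = elTh y := by
  have h' := elTh_eq_iff.1 h
  have hz : ∀ n, ∃ z, x' < z ∧ tp n (Ioo x' z) = tp n (Ioo x y) ∧ tp n (Ioi z) = tp n (Ioi y) := by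
    intro n
    obtain ⟨z, hz, e1, e2⟩ := tp_halves_of_succ (Prod.ext_iff.1 (h' (n + 1))).2 (a := y) hxy
    rw [Ioi_inter_Iio, Ioi_inter_Iio] at e1
    simp only [Ioi_inter_Ioi, max_eq_right hxy.le, max_eq_right (le_of_lt hz)] at e2
    exact ⟨z, hz, e1.symm, e2.symm⟩
  choose z hz1 hz2 hz3 using hz
  obtain ⟨y', hy'⟩ := hM x' z
  have hlt : x' < y' := by
    obtain ⟨i, hi⟩ := (hy' 0).exists
    simp only [profile, Prod.mk.injEq] at hi
    exact hi.2.2.1 ▸ hz1 i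
  have key : ∀ n, tp n (Ioo x' y') = tp n (Ioo x y) ∧ tp n (Ioi y') = tp n (Ioi y) := by
    intro n
    have hn : ∀ᶠ k in (hyperfilter ℕ : Filter ℕ), n ≤ k :=
      Nat.hyperfilter_le_atTop (eventually_ge_atTop n)
    obtain ⟨i, hi, hni⟩ := ((hy' n).and hn).exists
    simp only [profile, Prod.mk.injEq] at hi
    exact ⟨hi.2.1.1.trans (tp_eq_of_le hni (hz2 i)), hi.1.2.trans (tp_eq_of_le hni (hz3 i))⟩
  refine ⟨y', hlt, Th_eq_iff.2 fun n => (key n).1, elTh_eq_iff.2 fun n => Prod.ext ?_ (key n).2⟩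
  change tp n (Iio y') = tp n (Iio y)
  rw [tp_Iio_of_lt hlt, tp_Iio_of_lt hxy, (key n).1,
    show tp n (Iio x) = tp n (Iio x') from (Prod.ext_iff.1 (h' n)).1]

theorem exists_left_extension (hM : LimitClosed M) {y y' x : M} (h : elTh y = elTh y')
    (hxy : x < y) : ∃ x', x' < y' ∧ Th (Ioo x' y') = Th (Ioo x y) ∧ elTh x' = elTh x := by
  have h' := elTh_eq_iff.1 h
  have hz : ∀ n, ∃ z, z < y' ∧ tp n (Ioo z y') = tp n (Ioo x y) ∧ tp n (Iio z) = tp n (Iio x) := by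
    intro n
    obtain ⟨z, hz, e1, e2⟩ := tp_halves_of_succ (Prod.ext_iff.1 (h' (n + 1))).1 (a := x) hxy
    simp only [Iio_inter_Iio, min_eq_right hxy.le, min_eq_right (le_of_lt hz)] at e1
    rw [inter_comm, Ioi_inter_Iio, inter_comm, Ioi_inter_Iio] at e2
    exact ⟨z, hz, e2.symm, e1.symm⟩
  choose z hz1 hz2 hz3 using hz
  obtain ⟨x', hx'⟩ := hM y' z
  have hlt : x' < y' := by
    obtain ⟨i, hi⟩ := (hx' 0).exists
    simp only [profile, Prod.mk.injEq] at hi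
    exact hi.2.2.2 ▸ hz1 i
  have key : ∀ n, tp n (Ioo x' y') = tp n (Ioo x y) ∧ tp n (Iio x') = tp n (Iio x) := by
    intro n
    have hn : ∀ᶠ k in (hyperfilter ℕ : Filter ℕ), n ≤ k :=
      Nat.hyperfilter_le_atTop (eventually_ge_atTop n)
    obtain ⟨i, hi, hni⟩ := ((hx' n).and hn).exists
    simp only [profile, Prod.mk.injEq] at hi
    exact ⟨hi.2.1.2.trans (tp_eq_of_le hni (hz2 i)), hi.1.1.trans (tp_eq_of_le hni (hz3 i))⟩
  refine ⟨x', hlt, Th_eq_iff.2 fun n => (key n).1, elTh_eq_iff.2 fun n => Prod.ext (key n).2 ?_⟩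
  change tp n (Ioi x') = tp n (Ioi x)
  rw [tp_Ioi_of_lt hlt, tp_Ioi_of_lt hxy, (key n).1,
    show tp n (Ioi y) = tp n (Ioi y') from (Prod.ext_iff.1 (h' n)).2]

theorem inter_Ioo_of_ordConnected {X : Set M} [hX : OrdConnected X] {a b : M} (ha : a ∈ X)
    (hb : b ∈ X) : X ∩ Ioo a b = Ioo a b :=
  inter_eq_right.2 (Ioo_subset_Icc_self.trans (hX.out ha hb))

theorem homogeneousOn_upClass (hM : LimitClosed M) {c : M} (h : ¬ FinTh (upClass c)) :
    HomogeneousOn (upClass c) (elTh : M → _) := by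
  have mem : ∀ {x y}, elTh x = elTh y → y ∈ upClass c → x ∈ upClass c := by
    intro x y hxy hy
    rw [← upClass_eq hy]
    exact mem_upClass_of_elTh hxy
  have right : ∀ x ∈ upClass c, ∀ x' ∈ upClass c, ∀ y ∈ upClass c, elTh x = elTh x' → x < y →
      ∃ y' ∈ upClass c, x' < y' ∧ Th (upClass c ∩ Ioo x' y') = Th (upClass c ∩ Ioo x y) ∧
        elTh y' = elTh y := by
    intro x hx x' hx' y hy e hxy
    obtain ⟨y', h1, h2, h3⟩ := exists_right_extension hM e hxy
    refine ⟨y', mem h3 hy, h1, ?_, h3⟩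
    rw [inter_Ioo_of_ordConnected hx hy, inter_Ioo_of_ordConnected hx' (mem h3 hy), h2]
  have left : ∀ y ∈ upClass c, ∀ y' ∈ upClass c, ∀ x ∈ upClass c, elTh y = elTh y' → x < y →
      ∃ x' ∈ upClass c, x' < y' ∧ Th (upClass c ∩ Ioo x' y') = Th (upClass c ∩ Ioo x y) ∧
        elTh x' = elTh x := by
    intro y hy y' hy' x hx e hxy
    obtain ⟨x', h1, h2, h3⟩ := exists_left_extension hM e hxy
    refine ⟨x', mem h3 hx, h1, ?_, h3⟩
    rw [inter_Ioo_of_ordConnected hx hy, inter_Ioo_of_ordConnected (mem h3 hx) hy', h2]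
  have weak : ∀ x ∈ upClass c, ∀ w ∈ upClass c, ∃ y ∈ upClass c, w ≤ y ∧ elTh y = elTh x := by
    intro x hx w hw
    have hxw : upTypes x = upTypes w := Eq.trans hx (Eq.symm hw)
    have : ∀ n, ∃ u, w ≤ u ∧ elTp n u = elTp n x := by
      intro n
      have : elTp n x ∈ upTypes w n := hxw ▸ ⟨x, le_rfl, rfl⟩
      exact this
    choose u hu1 hu2 using this
    obtain ⟨y, hy⟩ := hM w u
    have hyx : elTh y = elTh x := elTh_eq_iff.2 fun n => by
      have hn : ∀ᶠ k in (hyperfilter ℕ : Filter ℕ), n ≤ k :=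
        Nat.hyperfilter_le_atTop (eventually_ge_atTop n)
      obtain ⟨i, hi, hni⟩ := ((hy n).and hn).exists
      have h1 : elTp n y = elTp n (u i) := (Prod.ext_iff.1 hi).1
      have h2 := Prod.ext_iff.1 (hu2 i)
      exact h1.trans (Prod.ext (tp_eq_of_le hni h2.1) (tp_eq_of_le hni h2.2))
    refine ⟨y, mem hyx hx, ?_, hyx⟩
    obtain ⟨i, hi⟩ := (hy 0).exists
    simp only [profile, Prod.mk.injEq] at hi
    exact not_lt.1 (hi.2.2.2 ▸ (hu1 i).not_gt)
  have nomax : ∀ w ∈ upClass c, ∃ w' ∈ upClass c, w < w' := by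
    intro w hw
    by_contra! hmax
    obtain ⟨x, hx, hxw⟩ : ∃ x ∈ upClass c, x < w := by
      by_contra! hmin
      apply h
      have : upClass c = {w} := by
        ext x
        exact ⟨fun hx => le_antisymm (hmax x hx) (hmin x hx), fun hx => by rwa [mem_singleton_iff.1 hx]⟩
      apply FinTh.of_finite
      refine Set.Finite.subset (((finite_singleton w).powerset).image Th) (image_mono ?_)
      intro p hp
      rw [← this]
      exact hp.subset
    obtain ⟨y, hy, hwy, e⟩ := weak x hx w hw
    have : y = w := le_antisymm (hmax y hy) hwy
    rw [this] at e
    obtain ⟨w', hw', hlt, -, -⟩ := right x hx w hw w hw e.symm hxw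
    exact (hmax w' hw').not_gt hlt
  have cofinal : ∀ x ∈ upClass c, ∀ w ∈ upClass c, ∃ y ∈ upClass c, w < y ∧ elTh y = elTh x := by
    intro x hx w hw
    obtain ⟨w', hw', hlt⟩ := nomax w hw
    obtain ⟨y, hy, hwy, e⟩ := weak x hx w' hw'
    exact ⟨y, hy, hlt.trans_le hwy, e⟩
  refine ⟨right, left, cofinal, fun x hx w hw => ?_⟩
  obtain ⟨w', hw', hlt, e⟩ := cofinal w hw x hx
  obtain ⟨y, hy, hyw, -, ey⟩ := left w' hw' w hw x hx e hlt
  exact ⟨y, hy, hyw, ey⟩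

end Classes

theorem Th_subtype {M : Type*} [LinearOrder M] (S : Set M) (s : Set S) :
    Th s = Th (Subtype.val '' s) :=
  (Th_image (f := Subtype.val) fun _ _ _ _ h => h).symm

theorem Th_univ_subtype {M : Type*} [LinearOrder M] (S : Set M) :
    Th (univ : Set S) = Th S := by
  rw [Th_subtype, image_univ, Subtype.range_coe]

theorem image_subtype_Ioo {M : Type*} [LinearOrder M] (S : Set M) (a b : S) :
    Subtype.val '' (Ioo a b) = S ∩ Ioo a.1 b.1 := by
  ext x
  constructor
  · rintro ⟨y, hy, rfl⟩
    exact ⟨y.2, hy⟩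
  · rintro ⟨hx, h⟩
    exact ⟨⟨x, hx⟩, h, rfl⟩

/-- Every order realising infinitely many theories of intervals is elementarily equivalent to a
countable sum whose middle summand is homogeneous and still realises infinitely many. -/
theorem exists_countable_homogeneous (A : Type) [LinearOrder A] (hA : ¬ FinTh (univ : Set A)) :
    ∃ (L X R : Type) (_ : LinearOrder L) (_ : LinearOrder X) (_ : LinearOrder R),
      Countable L ∧ Countable X ∧ Countable R ∧
      (∃ (τ : Type) (t : X → τ), HomogeneousOn (univ : Set X) t) ∧ ¬ FinTh (univ : Set X) ∧
      Th (univ : Set A) = Th (univ : Set L) + Th (univ : Set X) + Th (univ : Set R) := by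
  let M := Germ (hyperfilter ℕ : Filter ℕ) A
  have hM : LimitClosed M := limitClosed_germ A
  have hThM : Th (univ : Set M) = Th (univ : Set A) := Th_eq_iff.2 fun n => tp_univ_germ n
  have hMF : ¬ FinTh (univ : Set M) := fun h => hA (h.of_Th_eq hThM.symm)
  obtain ⟨c, hc⟩ := exists_not_finTh_upClass hM hMF
  have hom := homogeneousOn_upClass hM hc
  generalize hX : upClass c = X at hc hom
  have hcX : c ∈ X := hX ▸ mem_upClass_self c
  have hXc : OrdConnected X := hX ▸ upClass_ordConnected c
  let Lo : Set M := {x | x ∉ X ∧ x < c}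
  let Hi : Set M := {x | x ∉ X ∧ c < x}
  have hLX : ∀ x ∈ Lo, ∀ y ∈ X, x < y := by
    intro x hx y hy
    by_contra hlt
    exact hx.1 (hXc.out hy hcX ⟨not_lt.1 hlt, hx.2.le⟩)
  have hXR : ∀ x ∈ X, ∀ y ∈ Hi, x < y := by
    intro x hx y hy
    by_contra hlt
    exact hy.1 (hXc.out hcX hx ⟨hy.2.le, not_lt.1 hlt⟩)
  have hcov : (univ : Set M) = Lo ∪ X ∪ Hi := by
    refine (eq_univ_of_forall fun x => ?_).symm
    by_cases hx : x ∈ X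
    · exact Or.inl (Or.inr hx)
    · rcases lt_trichotomy x c with h | rfl | h
      · exact Or.inl (Or.inl ⟨hx, h⟩)
      · exact (hx hcX).elim
      · exact Or.inr ⟨hx, h⟩
  have h1 : ∀ x x' y : M, ∃ y', x ∈ X → x' ∈ X → y ∈ X → elTh x = elTh x' → x < y →
      y' ∈ X ∧ x' < y' ∧ Th (X ∩ Ioo x' y') = Th (X ∩ Ioo x y) ∧ elTh y' = elTh y := by
    intro x x' y
    by_cases h : x ∈ X ∧ x' ∈ X ∧ y ∈ X ∧ elTh x = elTh x' ∧ x < y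
    · obtain ⟨a1, a2, a3, a4, a5⟩ := h
      obtain ⟨y', hy'⟩ := hom.right x a1 x' a2 y a3 a4 a5
      exact ⟨y', fun _ _ _ _ _ => hy'⟩
    · exact ⟨c, fun a1 a2 a3 a4 a5 => (h ⟨a1, a2, a3, a4, a5⟩).elim⟩
  have h2 : ∀ y y' x : M, ∃ x', y ∈ X → y' ∈ X → x ∈ X → elTh y = elTh y' → x < y →
      x' ∈ X ∧ x' < y' ∧ Th (X ∩ Ioo x' y') = Th (X ∩ Ioo x y) ∧ elTh x' = elTh x := by
    intro y y' x
    by_cases h : y ∈ X ∧ y' ∈ X ∧ x ∈ X ∧ elTh y = elTh y' ∧ x < y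
    · obtain ⟨a1, a2, a3, a4, a5⟩ := h
      obtain ⟨x', hx'⟩ := hom.left y a1 y' a2 x a3 a4 a5
      exact ⟨x', fun _ _ _ _ _ => hx'⟩
    · exact ⟨c, fun a1 a2 a3 a4 a5 => (h ⟨a1, a2, a3, a4, a5⟩).elim⟩
  have h3 : ∀ x w : M, ∃ y, x ∈ X → w ∈ X → y ∈ X ∧ w < y ∧ elTh y = elTh x := by
    intro x w
    by_cases h : x ∈ X ∧ w ∈ X
    · obtain ⟨y, hy⟩ := hom.cofinal x h.1 w h.2
      exact ⟨y, fun _ _ => hy⟩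
    · exact ⟨c, fun a1 a2 => (h ⟨a1, a2⟩).elim⟩
  have h4 : ∀ x w : M, ∃ y, x ∈ X → w ∈ X → y ∈ X ∧ y < w ∧ elTh y = elTh x := by
    intro x w
    by_cases h : x ∈ X ∧ w ∈ X
    · obtain ⟨y, hy⟩ := hom.coinitial x h.1 w h.2
      exact ⟨y, fun _ _ => hy⟩
    · exact ⟨c, fun a1 a2 => (h ⟨a1, a2⟩).elim⟩
  choose f1 hf1 using h1
  choose f2 hf2 using h2
  choose f3 hf3 using h3
  choose f4 hf4 using h4
  let W : List M → Set M := fun l => match l with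
    | [x, x', y] => {f1 x x' y, f2 x x' y}
    | [x, w] => {f3 x w, f4 x w}
    | _ => ∅
  have hW : ∀ l, (W l).Countable := by
    intro l
    simp only [W]
    split
    · exact (Set.toFinite _).countable
    · exact (Set.toFinite _).countable
    · exact countable_empty
  obtain ⟨D, hD, -, hDW, hDtp⟩ := exists_countable_tp_eq {Lo, X, Hi}
    (Set.toFinite _).countable W hW (countable_empty (α := M))
  have hK : ∀ K ∈ ({Lo, X, Hi} : Set (Set M)), Th (K ∩ D) = Th K := fun K hK =>
    Th_eq_iff.2 fun n => hDtp n K hK [] (by simp)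
  have hIoo : ∀ a ∈ D, ∀ b ∈ D, Th (X ∩ D ∩ Ioo a b) = Th (X ∩ Ioo a b) := by
    intro a ha b hb
    refine Th_eq_iff.2 fun n => ?_
    have := hDtp n X (by simp) [(true, b), (false, a)] (by simp [ha, hb])
    simp only [cut] at this
    rwa [inter_assoc X, Ioi_inter_Iio, inter_right_comm] at this
  have hcD : ∀ {K : Set M}, Countable (K ∩ D : Set M) := fun {K} =>
    (hD.mono inter_subset_right).to_subtype
  refine ⟨(Lo ∩ D : Set M), (X ∩ D : Set M), (Hi ∩ D : Set M), inferInstance, inferInstance,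
    inferInstance, hcD, hcD, hcD, ⟨_, fun x => elTh x.1, ⟨?_, ?_, ?_, ?_⟩⟩, ?_, ?_⟩
  · rintro x - x' - y - e hxy
    obtain ⟨a1, a2, a3, a4⟩ := hf1 x x' y x.2.1 x'.2.1 y.2.1 e hxy
    have hd : f1 x x' y ∈ D := hDW [x.1, x'.1, y.1] (by simp [x.2.2, x'.2.2, y.2.2])
      (by simp [W])
    refine ⟨⟨_, a1, hd⟩, trivial, a2, ?_, a4⟩
    rw [univ_inter, univ_inter, Th_subtype, Th_subtype, image_subtype_Ioo, image_subtype_Ioo,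
      hIoo _ x.2.2 _ y.2.2, hIoo _ x'.2.2 _ hd, a3]
  · rintro x - x' - y - e hxy
    obtain ⟨a1, a2, a3, a4⟩ := hf2 x x' y x.2.1 x'.2.1 y.2.1 e hxy
    have hd : f2 x x' y ∈ D := hDW [x.1, x'.1, y.1] (by simp [x.2.2, x'.2.2, y.2.2])
      (by simp [W])
    refine ⟨⟨_, a1, hd⟩, trivial, a2, ?_, a4⟩
    rw [univ_inter, univ_inter, Th_subtype, Th_subtype, image_subtype_Ioo, image_subtype_Ioo,
      hIoo _ y.2.2 _ x.2.2, hIoo _ hd _ x'.2.2, a3]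
  · rintro x - w -
    obtain ⟨a1, a2, a3⟩ := hf3 x w x.2.1 w.2.1
    have hd : f3 x w ∈ D := hDW [x.1, w.1] (by simp [x.2.2, w.2.2]) (by simp [W])
    exact ⟨⟨_, a1, hd⟩, trivial, a2, a3⟩
  · rintro x - w -
    obtain ⟨a1, a2, a3⟩ := hf4 x w x.2.1 w.2.1
    have hd : f4 x w ∈ D := hDW [x.1, w.1] (by simp [x.2.2, w.2.2]) (by simp [W])
    exact ⟨⟨_, a1, hd⟩, trivial, a2, a3⟩
  · intro h
    apply hc
    apply h.of_Th_eq
    rw [Th_univ_subtype, hK X (by simp)]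
  · rw [Th_univ_subtype, Th_univ_subtype, Th_univ_subtype, hK X (by simp), hK Lo (by simp),
      hK Hi (by simp), ← hThM, hcov, Th_union, Th_union hLX]
    rintro x (hx | hx) y hy
    · exact (hLX x hx c hcX).trans (hXR c hcX y hy)
    · exact hXR x hx y hy

section Intervals

variable {M : Type*} [LinearOrder M] {a b x : M} (n : ℕ)

theorem tp_Ioo_eq_add (h1 : a < x) (h2 : x ≤ b) :
    tp n (Ioo a b) = tp n (Ioo a x) + tp n (Ico x b) := by
  rw [← Ioo_union_Ico_eq_Ioo h1 h2, tp_union]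
  exact fun _ hu _ hv => hu.2.trans_le hv.1

theorem tp_Ico_eq_add (h1 : a ≤ x) (h2 : x ≤ b) :
    tp n (Ico a b) = tp n (Ico a x) + tp n (Ico x b) := by
  rw [← Ico_union_Ico_eq_Ico h1 h2, tp_union]
  exact fun _ hu _ hv => hu.2.trans_le hv.1

theorem tp_Ioi_eq_add (h1 : a < x) : tp n (Ioi a) = tp n (Ioo a x) + tp n (Ici x) := by
  rw [← Ioo_union_Ici_eq_Ioi h1, tp_union]
  exact fun _ hu _ hv => hu.2.trans_le hv

theorem tp_Iio_eq_add (h1 : x ≤ b) : tp n (Iio b) = tp n (Iio x) + tp n (Ico x b) := by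
  rw [← Iio_union_Ico_eq_Iio h1, tp_union]
  exact fun _ hu _ hv => lt_of_lt_of_le hu hv.1

theorem tp_Ico_eq_pt_add (h : a < b) :
    tp n (Ico a b) = tp n ({()} : Set Unit) + tp n (Ioo a b) := by
  have h1 : Ico a b = (fun _ : Unit => a) '' {()} ∪ Ioo a b := by
    rw [image_singleton, ← insert_eq, Ioo_insert_left h]
  rw [h1, tp_union, tp_image]
  · intro x _ y _ hxy
    exact (hxy.ne (Subsingleton.elim _ _)).elim
  · rintro _ ⟨_, _, rfl⟩ y hy
    exact hy.1

theorem tp_Ici_eq_pt_add (a : M) :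
    tp n (Ici a) = tp n ({()} : Set Unit) + tp n (Ioi a) := by
  have h1 : Ici a = (fun _ : Unit => a) '' {()} ∪ Ioi a := by
    rw [image_singleton, ← insert_eq, Ioi_insert]
  rw [h1, tp_union, tp_image]
  · intro x _ y _ hxy
    exact (hxy.ne (Subsingleton.elim _ _)).elim
  · rintro _ ⟨_, _, rfl⟩ y hy
    exact hy

theorem tp_Ioo_eq_add_pt_add (h1 : a < x) (h2 : x < b) :
    tp n (Ioo a b) = tp n (Ioo a x) + tp n ({()} : Set Unit) + tp n (Ioo x b) := by
  rw [tp_Ioo_eq_add n h1 h2.le, tp_Ico_eq_pt_add n h2, add_assoc]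

theorem tp_univ_eq (a : M) :
    tp n (univ : Set M) = tp n (Iio a) + tp n ({()} : Set Unit) + tp n (Ioi a) := by
  rw [add_assoc, ← tp_Ici_eq_pt_add, ← tp_union, Iio_union_Ici]
  exact fun _ hu _ hv => lt_of_lt_of_le hu hv

end Intervals

/-- Some positive multiple of every element of a finite monoid is idempotent. -/
theorem exists_idempotent_nsmul {G : Type*} [AddMonoid G] [Finite G] (g : G) :
    ∃ k, 1 ≤ k ∧ k • g + k • g = k • g := by
  obtain ⟨i, j, hij, e⟩ := Finite.exists_ne_map_eq_of_infinite fun k : ℕ => k • g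
  wlog hlt : i < j generalizing i j
  · exact this j i hij.symm e.symm (lt_of_le_of_ne (not_lt.1 hlt) hij.symm)
  obtain ⟨p, rfl⟩ := Nat.exists_eq_add_of_lt hlt
  have step : ∀ m, i ≤ m → m • g = (m + (p + 1)) • g := by
    intro m hm
    obtain ⟨d, rfl⟩ := Nat.exists_eq_add_of_le hm
    have e : i • g = (i + p + 1) • g := e
    rw [add_nsmul, e, ← add_nsmul]
    congr 1
    omega
  have steps : ∀ c m, i ≤ m → m • g = (m + c * (p + 1)) • g := by
    intro c
    induction c with
    | zero => intro m _; simp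
    | succ c ih =>
      intro m hm
      rw [ih m hm, step _ (by omega)]
      congr 1
      ring
  refine ⟨(i + 1) * (p + 1), by nlinarith, ?_⟩
  rw [← add_nsmul]
  refine (steps (i + 1) _ ?_).symm
  nlinarith

/-- A finite semigroup has an idempotent `e` such that every `e + u + e` can be completed to `e`
on both sides. -/
theorem exists_completing_idempotent {G : Type*} [AddMonoid G] [Finite G] (Γ : Set G)
    (hne : Γ.Nonempty) (hadd : ∀ u ∈ Γ, ∀ v ∈ Γ, u + v ∈ Γ) :
    ∃ e ∈ Γ, e + e = e ∧ ∀ u ∈ Γ, (∃ v ∈ Γ, e + u + e + v = e) ∧ ∃ v ∈ Γ, v + (e + u + e) = e := by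
  classical
  have hsmul : ∀ u ∈ Γ, ∀ k, 1 ≤ k → k • u ∈ Γ := by
    intro u hu k hk
    induction k, hk using Nat.le_induction with
    | base => simpa using hu
    | succ k _ ih =>
      rw [succ_nsmul]
      exact hadd _ ih _ hu
  let Q : G → Set G := fun e => (fun u => e + u + e) '' Γ
  have hex : ∃ k, ∃ e ∈ Γ, e + e = e ∧ (Q e).ncard = k := by
    obtain ⟨g, hg⟩ := hne
    obtain ⟨k, hk, e⟩ := exists_idempotent_nsmul g
    exact ⟨_, k • g, hsmul g hg k hk, e, rfl⟩
  obtain ⟨e, he, hee, hcard⟩ := Nat.find_spec hex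
  refine ⟨e, he, hee, fun u hu => ?_⟩
  set g := e + u + e with hg
  have hgΓ : g ∈ Γ := hadd _ (hadd _ he _ hu) _ he
  have heg : e + g = g := by rw [hg, ← add_assoc, ← add_assoc, hee]
  have hge : g + e = g := by rw [hg, add_assoc, hee]
  obtain ⟨k, hk, hid⟩ := exists_idempotent_nsmul g
  obtain ⟨k, rfl⟩ := Nat.exists_eq_add_of_le' hk
  have hef : e + (k + 1) • g = (k + 1) • g := by rw [succ_nsmul', ← add_assoc, heg]
  have hfe : (k + 1) • g + e = (k + 1) • g := by rw [succ_nsmul, add_assoc, hge]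
  have hfΓ : (k + 1) • g ∈ Γ := hsmul g hgΓ _ hk
  have hsub : Q ((k + 1) • g) ⊆ Q e := by
    rintro _ ⟨w, hw, rfl⟩
    refine ⟨(k + 1) • g + w + (k + 1) • g, hadd _ (hadd _ hfΓ _ hw) _ hfΓ, ?_⟩
    change e + ((k + 1) • g + w + (k + 1) • g) + e = _
    rw [add_assoc, add_assoc _ _ e, hfe, add_assoc, ← add_assoc, hef]
    exact (add_assoc _ _ _).symm
  have heq : Q ((k + 1) • g) = Q e := by
    refine Set.eq_of_subset_of_ncard_le hsub ?_ (Set.toFinite _)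
    rw [hcard]
    exact Nat.find_min' hex ⟨_, hfΓ, hid, rfl⟩
  have heQ : e ∈ Q ((k + 1) • g) := by
    rw [heq]
    refine ⟨e, he, ?_⟩
    change e + e + e = e
    rw [hee, hee]
  obtain ⟨w, -, hw⟩ := heQ
  have hfeq : (k + 1) • g = e := by
    have hw : (k + 1) • g + w + (k + 1) • g = e := hw
    have h : (k + 1) • g + e = e := by
      rw [← hw, ← add_assoc, ← add_assoc, hid]
    exact hfe.symm.trans h
  have h2 : (2 * k + 1 + 1) • g = e := by
    rw [show 2 * k + 1 + 1 = (k + 1) + (k + 1) by ring, add_nsmul, hid, hfeq]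
  refine ⟨⟨(2 * k + 1) • g, hsmul g hgΓ _ (by omega), ?_⟩,
    ⟨(2 * k + 1) • g, hsmul g hgΓ _ (by omega), ?_⟩⟩
  · rw [← succ_nsmul', h2]
  · rw [← succ_nsmul, h2]

/-- An `ω`-sum followed by an `ω*`-sum of intervals of idempotent type `e` has type `e`. -/
theorem tp_Ici_add_tp_Iio {α β : Type*} [LinearOrder α] [LinearOrder β] :
    ∀ (n : ℕ) (e : OrdTyp n), e + e = e → ∀ (x : ℕ → α) (y : ℕ → β),
      StrictMono x → (∀ w, ∃ i, w < x i) → (∀ i j, i < j → tp n (Ico (x i) (x j)) = e) →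
      StrictAnti y → (∀ w, ∃ i, y i < w) → (∀ i j, i < j → tp n (Ico (y j) (y i)) = e) →
      tp n (Ici (x 0)) + tp n (Iio (y 0)) = e
  | 0, _, _, _, _, _, _, _, _, _, _ => rfl
  | n + 1, e, he, x, y, hx, hxc, hxe, hy, hyc, hye => by
    have he' : trunc e + trunc e = trunc e := by rw [← trunc_add, he]
    have ih : ∀ i j, tp n (Ici (x i)) + tp n (Iio (y j)) = trunc e := by
      intro i j
      refine tp_Ici_add_tp_Iio n (trunc e) he' (fun k => x (k + i)) (fun k => y (k + j)) ?_ ?_ ?_ ?_ ?_ ?_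
        |> fun h => by simpa using h
      · exact fun a b h => hx (by omega)
      · intro w
        obtain ⟨k, hk⟩ := hxc w
        exact ⟨k, hk.trans_le (hx.monotone (by omega))⟩
      · intro a b h
        rw [← trunc_tp, hxe _ _ (by omega)]
      · exact fun a b h => hy (by omega)
      · intro w
        obtain ⟨k, hk⟩ := hyc w
        exact ⟨k, (hy.antitone (by omega)).trans_lt hk⟩
      · intro a b h
        rw [← trunc_tp, hye _ _ (by omega)]
    have left : ∀ p q, (∃ c, Mem (p, c) (tp (n + 1) (Ici (x 0))) ∧ c + tp n (Iio (y 0)) = q) ↔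
        ∃ c, Mem (p, c) e ∧ c + trunc e = q := by
      have dec : ∀ k, ∀ a ∈ Ico (x 0) (x k), tp n (Ici (x 0) ∩ Ioi a) + tp n (Iio (y 0)) =
          tp n (Ico (x 0) (x k) ∩ Ioi a) + trunc e := by
        intro k a ha
        rw [← ih k 0, ← add_assoc, ← tp_union]
        · congr 2
          ext u
          simp only [mem_inter_iff, mem_Ici, mem_Ioi, mem_union, mem_Ico]
          constructor
          · rintro ⟨h1, h2⟩
            rcases lt_or_ge u (x k) with h | h
            · exact Or.inl ⟨⟨h1, h⟩, h2⟩
            · exact Or.inr h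
          · rintro (⟨⟨h1, h2⟩, h3⟩ | h)
            · exact ⟨h1, h3⟩
            · exact ⟨ha.1.trans (ha.2.le.trans h), ha.2.trans_le h⟩
        · exact fun u hu v hv => hu.1.2.trans_le hv
      have dec' : ∀ k, ∀ a ∈ Ico (x 0) (x k),
          tp n (Ici (x 0) ∩ Iio a) = tp n (Ico (x 0) (x k) ∩ Iio a) := by
        intro k a ha
        rw [Ici_inter_Iio, Ico_inter_Iio, min_eq_right ha.2.le]
      intro p q
      constructor
      · rintro ⟨c, hc, rfl⟩
        obtain ⟨a, ha, rfl, rfl⟩ := mem_tp.1 hc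
        obtain ⟨k, hk⟩ := hxc a
        have hk0 : 0 < k := by
          rcases Nat.eq_zero_or_pos k with rfl | h
          · exact (not_lt.2 ha hk).elim
          · exact h
        refine ⟨tp n (Ico (x 0) (x k) ∩ Ioi a), ?_, (dec k a ⟨ha, hk⟩).symm⟩
        rw [← hxe 0 k hk0, dec' k a ⟨ha, hk⟩]
        exact mem_tp.2 ⟨a, ⟨ha, hk⟩, rfl, rfl⟩
      · rintro ⟨c, hc, rfl⟩
        rw [← hxe 0 1 one_pos] at hc
        obtain ⟨a, ha, rfl, rfl⟩ := mem_tp.1 hc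
        exact ⟨_, mem_tp.2 ⟨a, ha.1, dec' 1 a ha, rfl⟩, dec 1 a ha⟩
    have right : ∀ p q, (∃ c, Mem (c, q) (tp (n + 1) (Iio (y 0))) ∧ tp n (Ici (x 0)) + c = p) ↔
        ∃ c, Mem (c, q) e ∧ trunc e + c = p := by
      have dec : ∀ k, ∀ a ∈ Ico (y k) (y 0), tp n (Ici (x 0)) + tp n (Iio (y 0) ∩ Iio a) =
          trunc e + tp n (Ico (y k) (y 0) ∩ Iio a) := by
        intro k a ha
        rw [← ih 0 k, add_assoc, ← tp_union]
        · congr 2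
          ext u
          simp only [mem_inter_iff, mem_Iio, mem_union, mem_Ico]
          constructor
          · rintro ⟨h1, h2⟩
            rcases lt_or_ge u (y k) with h | h
            · exact Or.inl h
            · exact Or.inr ⟨⟨h, h1⟩, h2⟩
          · rintro (h | ⟨⟨h1, h2⟩, h3⟩)
            · exact ⟨h.trans (ha.1.trans_lt ha.2), h.trans_le ha.1⟩
            · exact ⟨h2, h3⟩
        · exact fun u hu v hv => lt_of_lt_of_le hu hv.1.1
      have dec' : ∀ k, ∀ a ∈ Ico (y k) (y 0),
          tp n (Iio (y 0) ∩ Ioi a) = tp n (Ico (y k) (y 0) ∩ Ioi a) := by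
        intro k a ha
        congr 1
        ext u
        simp only [mem_inter_iff, mem_Iio, mem_Ioi, mem_Ico]
        exact ⟨fun h => ⟨⟨ha.1.trans h.2.le, h.1⟩, h.2⟩, fun h => ⟨h.1.2, h.2⟩⟩
      intro p q
      constructor
      · rintro ⟨c, hc, rfl⟩
        obtain ⟨a, ha, rfl, rfl⟩ := mem_tp.1 hc
        obtain ⟨k, hk⟩ := hyc a
        have hk0 : 0 < k := by
          rcases Nat.eq_zero_or_pos k with rfl | h
          · exact (lt_asymm ha hk).elim
          · exact h
        refine ⟨tp n (Ico (y k) (y 0) ∩ Iio a), ?_, (dec k a ⟨hk.le, ha⟩).symm⟩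
        rw [← hye 0 k hk0, dec' k a ⟨hk.le, ha⟩]
        exact mem_tp.2 ⟨a, ⟨hk.le, ha⟩, rfl, rfl⟩
      · rintro ⟨c, hc, rfl⟩
        rw [← hye 0 1 one_pos] at hc
        obtain ⟨a, ha, rfl, rfl⟩ := mem_tp.1 hc
        exact ⟨_, mem_tp.2 ⟨a, ha.2, rfl, dec' 1 a ha⟩, dec 1 a ha⟩
    apply ext_mem
    intro p q
    rw [show Mem (p, q) e ↔ Mem (p, q) (e + e) by rw [he], mem_add, mem_add, trunc_tp, trunc_tp, left p q, right p q]

/-- Every final segment followed by an initial segment is realised by an interval. -/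
structure SelfAdditive (X : Type*) [LinearOrder X] : Prop where
  right : ∀ (n : ℕ) (a b : X), ∃ b', a < b' ∧ tp n (Ioo a b') = tp n (Ioi a) + tp n (Iio b) ∧
    tp n (Ioi b') = tp n (Ioi b)
  left : ∀ (n : ℕ) (a b : X), ∃ a', a' < b ∧ tp n (Ioo a' b) = tp n (Ioi a) + tp n (Iio b) ∧
    tp n (Iio a') = tp n (Iio a)

section Homogeneous

variable {X τ : Type*} [LinearOrder X] {t : X → τ}

theorem HomogeneousOn.exists_right (h : HomogeneousOn (univ : Set X) t) {x x' y : X}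
    (e : t x = t x') (hxy : x < y) :
    ∃ y', x' < y' ∧ (∀ n, tp n (Ioo x' y') = tp n (Ioo x y)) ∧ t y' = t y := by
  obtain ⟨y', -, h1, h2, h3⟩ := h.right x trivial x' trivial y trivial e hxy
  rw [univ_inter, univ_inter] at h2
  exact ⟨y', h1, Th_eq_iff.1 h2, h3⟩

theorem HomogeneousOn.exists_left (h : HomogeneousOn (univ : Set X) t) {y y' x : X}
    (e : t y = t y') (hxy : x < y) :
    ∃ x', x' < y' ∧ (∀ n, tp n (Ioo x' y') = tp n (Ioo x y)) ∧ t x' = t x := by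
  obtain ⟨y', -, h1, h2, h3⟩ := h.left y trivial y' trivial x trivial e hxy
  rw [univ_inter, univ_inter] at h2
  exact ⟨y', h1, Th_eq_iff.1 h2, h3⟩

theorem HomogeneousOn.tp_Ioi (h : HomogeneousOn (univ : Set X) t) :
    ∀ (n : ℕ) {x x' : X}, t x = t x' → tp n (Ioi x) = tp n (Ioi x')
  | 0, _, _, _ => rfl
  | n + 1, x, x', e => by
    have key : ∀ {x x' : X}, t x = t x' → ∀ a ∈ Ioi x, ∃ b ∈ Ioi x',
        tp n (Ioi x ∩ Iio a) = tp n (Ioi x' ∩ Iio b) ∧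
        tp n (Ioi x ∩ Ioi a) = tp n (Ioi x' ∩ Ioi b) := by
      intro x x' e a ha
      obtain ⟨b, h1, h2, h3⟩ := h.exists_right e ha
      refine ⟨b, h1, ?_, ?_⟩
      · rw [Ioi_inter_Iio, Ioi_inter_Iio, h2]
      · rw [Ioi_inter_Ioi, Ioi_inter_Ioi, max_eq_right (le_of_lt ha), max_eq_right h1.le]
        exact h.tp_Ioi n h3.symm
    rw [tp_succ_eq_iff]
    refine ⟨key e, fun b hb => ?_⟩
    obtain ⟨a, ha, h1, h2⟩ := key e.symm b hb
    exact ⟨a, ha, h1.symm, h2.symm⟩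

theorem HomogeneousOn.tp_Iio (h : HomogeneousOn (univ : Set X) t) :
    ∀ (n : ℕ) {x x' : X}, t x = t x' → tp n (Iio x) = tp n (Iio x')
  | 0, _, _, _ => rfl
  | n + 1, x, x', e => by
    have key : ∀ {x x' : X}, t x = t x' → ∀ a ∈ Iio x, ∃ b ∈ Iio x',
        tp n (Iio x ∩ Iio a) = tp n (Iio x' ∩ Iio b) ∧
        tp n (Iio x ∩ Ioi a) = tp n (Iio x' ∩ Ioi b) := by
      intro x x' e a ha
      obtain ⟨b, h1, h2, h3⟩ := h.exists_left e ha
      refine ⟨b, h1, ?_, ?_⟩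
      · rw [Iio_inter_Iio, Iio_inter_Iio, min_eq_right (le_of_lt ha), min_eq_right h1.le]
        exact h.tp_Iio n h3.symm
      · rw [inter_comm, Ioi_inter_Iio, inter_comm, Ioi_inter_Iio, h2]
    rw [tp_succ_eq_iff]
    refine ⟨key e, fun b hb => ?_⟩
    obtain ⟨a, ha, h1, h2⟩ := key e.symm b hb
    exact ⟨a, ha, h1.symm, h2.symm⟩

theorem HomogeneousOn.selfAdditive [Countable X] (h : HomogeneousOn (univ : Set X) t) :
    SelfAdditive X := by
  have cof : ∀ x w : X, ∃ y, w < y ∧ t y = t x := fun x w =>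
    let ⟨y, _, hy⟩ := h.cofinal x trivial w trivial
    ⟨y, hy⟩
  have coi : ∀ x w : X, ∃ y, y < w ∧ t y = t x := fun x w =>
    let ⟨y, _, hy⟩ := h.coinitial x trivial w trivial
    ⟨y, hy⟩
  have key : ∀ (n : ℕ) (o : X), ∃ e : OrdTyp n,
      (∀ x, t x = t o → ∃ y, x < y ∧ t y = t o ∧ tp n (Ico x y) = e) ∧
      (∀ y, t y = t o → ∃ x, x < y ∧ t x = t o ∧ tp n (Ico x y) = e) ∧
      ∀ x y, t x = t o → t y = t o → tp n (Ici x) + tp n (Iio y) = e := by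
    intro n o
    let Γ : Set (OrdTyp n) := {g | ∃ x y, t x = t o ∧ t y = t o ∧ x < y ∧ tp n (Ico x y) = g}
    have hΓ : Γ.Nonempty := by
      obtain ⟨y, hy, e⟩ := cof o o
      exact ⟨_, o, y, rfl, e, hy, rfl⟩
    have up : ∀ g ∈ Γ, ∀ x, t x = t o → ∃ y, x < y ∧ t y = t o ∧ tp n (Ico x y) = g := by
      rintro _ ⟨u, v, hu, hv, huv, rfl⟩ x hx
      obtain ⟨y, h1, h2, h3⟩ := h.exists_right (hu.trans hx.symm) huv
      exact ⟨y, h1, h3.trans hv, by rw [tp_Ico_eq_pt_add n h1, tp_Ico_eq_pt_add n huv, h2]⟩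
    have down : ∀ g ∈ Γ, ∀ y, t y = t o → ∃ x, x < y ∧ t x = t o ∧ tp n (Ico x y) = g := by
      rintro _ ⟨u, v, hu, hv, huv, rfl⟩ x hx
      obtain ⟨y, h1, h2, h3⟩ := h.exists_left (hv.trans hx.symm) huv
      exact ⟨y, h1, h3.trans hu, by rw [tp_Ico_eq_pt_add n h1, tp_Ico_eq_pt_add n huv, h2]⟩
    have hadd : ∀ u ∈ Γ, ∀ v ∈ Γ, u + v ∈ Γ := by
      rintro _ ⟨x, y, hx, hy, hxy, rfl⟩ v hv
      obtain ⟨z, hz, hzo, e⟩ := up v hv y hy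
      exact ⟨x, z, hx, hzo, hxy.trans hz, by rw [tp_Ico_eq_add n hxy.le hz.le, e]⟩
    obtain ⟨e, he, hee, hcomp⟩ := exists_completing_idempotent Γ hΓ hadd
    have far_up : ∀ x, t x = t o → ∀ w, ∃ y, w < y ∧ x < y ∧ t y = t o ∧ tp n (Ico x y) = e := by
      intro x hx w
      obtain ⟨x1, h1, t1, e1⟩ := up e he x hx
      obtain ⟨x2, h2, t2⟩ := cof o (max x1 w)
      have h12 : x1 < x2 := (le_max_left _ _).trans_lt h2
      obtain ⟨v, hv, hvv⟩ := (hcomp (tp n (Ico x1 x2)) ⟨x1, x2, t1, t2, h12, rfl⟩).1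
      obtain ⟨x3, h3, t3, e3⟩ := up e he x2 t2
      obtain ⟨x4, h4, t4, e4⟩ := up v hv x3 t3
      refine ⟨x4, ((le_max_right _ _).trans_lt h2).trans (h3.trans h4),
        h1.trans (h12.trans (h3.trans h4)), t4, ?_⟩
      rw [tp_Ico_eq_add n (h1.trans (h12.trans h3)).le h4.le,
        tp_Ico_eq_add n (h1.trans h12).le h3.le, tp_Ico_eq_add n h1.le h12.le, e1, e3, e4, hvv]
    have far_down : ∀ y, t y = t o → ∀ w, ∃ x, x < w ∧ x < y ∧ t x = t o ∧
        tp n (Ico x y) = e := by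
      intro x hx w
      obtain ⟨x1, h1, t1, e1⟩ := down e he x hx
      obtain ⟨x2, h2, t2⟩ := coi o (min x1 w)
      have h12 : x2 < x1 := h2.trans_le (min_le_left _ _)
      obtain ⟨v, hv, hvv⟩ := (hcomp (tp n (Ico x2 x1)) ⟨x2, x1, t2, t1, h12, rfl⟩).2
      obtain ⟨x3, h3, t3, e3⟩ := down e he x2 t2
      obtain ⟨x4, h4, t4, e4⟩ := down v hv x3 t3
      refine ⟨x4, (h4.trans h3).trans (h2.trans_le (min_le_right _ _)),
        (h4.trans h3).trans (h12.trans h1), t4, ?_⟩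
      rw [tp_Ico_eq_add n h4.le (h3.trans (h12.trans h1)).le,
        tp_Ico_eq_add n (h3.trans h12).le h1.le, tp_Ico_eq_add n h3.le h12.le, e1, e3, e4, hvv]
    refine ⟨e, fun x hx => ?_, fun y hy => ?_, fun x y hx hy => ?_⟩
    · exact up e he x hx
    · exact down e he y hy
    · have : Nonempty X := ⟨o⟩
      obtain ⟨enum, henum⟩ := exists_surjective_nat X
      choose! nx hn1 hn2 hn3 hn4 using far_up
      choose! ny hy1 hy2 hy3 hy4 using far_down
      let xs : ℕ → X := fun k => Nat.rec x (fun i z => nx z (enum i)) k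
      let ys : ℕ → X := fun k => Nat.rec y (fun i z => ny z (enum i)) k
      have xt : ∀ k, t (xs k) = t o := by
        intro k
        induction k with
        | zero => exact hx
        | succ k ih => exact hn3 _ ih _
      have yt : ∀ k, t (ys k) = t o := by
        intro k
        induction k with
        | zero => exact hy
        | succ k ih => exact hy3 _ ih _
      have xm : StrictMono xs := strictMono_nat_of_lt_succ fun k => hn2 _ (xt k) _
      have ym : StrictAnti ys := strictAnti_nat_of_succ_lt fun k => hy2 _ (yt k) _
      refine tp_Ici_add_tp_Iio n e hee xs ys xm ?_ ?_ ym ?_ ?_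
      · intro w
        obtain ⟨k, rfl⟩ := henum w
        exact ⟨k + 1, hn1 _ (xt k) _⟩
      · intro i j hij
        induction j, hij using Nat.le_induction with
        | base => exact hn4 _ (xt i) _
        | succ j hj ih =>
          rw [tp_Ico_eq_add n (xm.monotone (by omega : i ≤ j)) (xm.monotone (Nat.le_succ j)), ih,
            show tp n (Ico (xs j) (xs (j + 1))) = e from hn4 _ (xt j) _, hee]
      · intro w
        obtain ⟨k, rfl⟩ := henum w
        exact ⟨k + 1, hy1 _ (yt k) _⟩
      · intro i j hij
        induction j, hij using Nat.le_induction with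
        | base => exact hy4 _ (yt i) _
        | succ j hj ih =>
          rw [tp_Ico_eq_add n (ym.antitone (Nat.le_succ j)) (ym.antitone (by omega : i ≤ j)), ih,
            show tp n (Ico (ys (j + 1)) (ys j)) = e from hy4 _ (yt j) _, hee]
  constructor
  · intro n a b
    obtain ⟨e, e1, e2, e3⟩ := key n a
    obtain ⟨x, hax, hx⟩ := cof a a
    obtain ⟨y, hyb, hy⟩ := coi a b
    obtain ⟨y', hxy', hy', ee⟩ := e1 x hx
    obtain ⟨b', hb', hI, htb⟩ := h.exists_right (hy.trans hy'.symm) hyb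
    refine ⟨b', hax.trans (hxy'.trans hb'), ?_, h.tp_Ioi n htb⟩
    rw [tp_Ioo_eq_add n (hax.trans hxy') hb'.le, tp_Ioo_eq_add n hax hxy'.le, ee, ← e3 x y hx hy,
      tp_Ico_eq_pt_add n hb', hI, ← tp_Ico_eq_pt_add n hyb, ← add_assoc, ← tp_Ioi_eq_add n hax,
      add_assoc, ← tp_Iio_eq_add n hyb.le]
  · intro n a b
    obtain ⟨e, e1, e2, e3⟩ := key n a
    obtain ⟨x, hax, hx⟩ := cof a a
    obtain ⟨y, hyb, hy⟩ := coi a b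
    obtain ⟨x', hxy', hx', ee⟩ := e2 y hy
    obtain ⟨a', ha', hI, hta⟩ := h.exists_left (hx.trans hx'.symm) hax
    refine ⟨a', ha'.trans (hxy'.trans hyb), ?_, h.tp_Iio n hta⟩
    rw [tp_Ioo_eq_add n (ha'.trans hxy') hyb.le, tp_Ioo_eq_add n ha' hxy'.le, ee, hI,
      ← e3 x y hx hy, ← add_assoc, ← tp_Ioi_eq_add n hax, add_assoc, ← tp_Iio_eq_add n hyb.le]

end Homogeneous

section BackForth

variable {α β γ : Type*} [LinearOrder α] [LinearOrder β] [LinearOrder γ]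

/-- The second player survives `n` rounds of the Ehrenfeucht–Fraïssé game on two linear orders
started at the finite or infinite position `r`. -/
def BackForth : ℕ → Set (α × β) → Prop
  | 0, r => ∀ p ∈ r, ∀ q ∈ r, (p.1 < q.1 ↔ p.2 < q.2)
  | n + 1, r => (∀ a, ∃ b, BackForth n (insert (a, b) r)) ∧ ∀ b, ∃ a, BackForth n (insert (a, b) r)

theorem BackForth.mono : ∀ {n : ℕ} {r r' : Set (α × β)}, BackForth n r → r' ⊆ r → BackForth n r'
  | 0, _, _, h, hr => fun p hp q hq => h p (hr hp) q (hr hq)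
  | _ + 1, _, _, h, hr =>
    ⟨fun a => (h.1 a).imp fun _ hb => BackForth.mono hb (insert_subset_insert hr),
      fun b => (h.2 b).imp fun _ ha => BackForth.mono ha (insert_subset_insert hr)⟩

theorem BackForth.of_succ [Nonempty α] {n : ℕ} {r : Set (α × β)} (h : BackForth (n + 1) r) :
    BackForth n r :=
  let ⟨_, hb⟩ := h.1 (Classical.arbitrary α)
  hb.mono (subset_insert _ _)

theorem BackForth.of_le [Nonempty α] {m n : ℕ} (hmn : m ≤ n) {r : Set (α × β)}
    (h : BackForth n r) : BackForth m r := by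
  induction n, hmn using Nat.le_induction with
  | base => exact h
  | succ n _ ih => exact ih h.of_succ

theorem BackForth.lt_iff {n : ℕ} {r : Set (α × β)} (h : BackForth n r)
    {a c : α} {b d : β} (hab : (a, b) ∈ r) (hcd : (c, d) ∈ r) : a < c ↔ b < d := by
  have : Nonempty α := ⟨a⟩
  exact h.of_le (Nat.zero_le n) _ hab _ hcd

theorem BackForth.comp : ∀ {n : ℕ} {r : Set (α × β)} {s : Set (β × γ)} {t : Set (α × γ)},
    BackForth n r → BackForth n s → (∀ p ∈ t, ∃ b, (p.1, b) ∈ r ∧ (b, p.2) ∈ s) → BackForth n t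
  | 0, r, s, t, hr, hs, ht => by
    intro p hp q hq
    obtain ⟨b, h1, h2⟩ := ht p hp
    obtain ⟨c, h3, h4⟩ := ht q hq
    exact (hr _ h1 _ h3).trans (hs _ h2 _ h4)
  | n + 1, r, s, t, hr, hs, ht => by
    have key : ∀ a b c, BackForth n (insert (a, b) r) → BackForth n (insert (b, c) s) →
        BackForth n (insert (a, c) t) := by
      intro a b c h1 h2
      refine h1.comp h2 ?_
      rintro p (rfl | hp)
      · exact ⟨b, Or.inl rfl, Or.inl rfl⟩
      · obtain ⟨d, h3, h4⟩ := ht p hp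
        exact ⟨d, Or.inr h3, Or.inr h4⟩
    constructor
    · intro a
      obtain ⟨b, hb⟩ := hr.1 a
      obtain ⟨c, hc⟩ := hs.1 b
      exact ⟨c, key a b c hb hc⟩
    · intro c
      obtain ⟨b, hb⟩ := hs.2 c
      obtain ⟨a, ha⟩ := hr.2 b
      exact ⟨a, key a b c ha hb⟩

theorem BackForth.swap : ∀ {n : ℕ} {r : Set (α × β)}, BackForth n r →
    BackForth n (Prod.swap ⁻¹' r)
  | 0, _, h => fun _ hp _ hq => (h _ hp _ hq).symm
  | n + 1, r, h => by
    have key : ∀ a b, BackForth n (insert (a, b) r) →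
        BackForth n (insert (b, a) (Prod.swap ⁻¹' r)) := by
      intro a b h
      refine h.swap.mono ?_
      rintro p (rfl | hp)
      · exact Or.inl rfl
      · exact Or.inr hp
    exact ⟨fun b => (h.2 b).imp fun _ => key _ _, fun a => (h.1 a).imp fun _ => key _ _⟩

/-- The convex set with the prescribed lower and upper bounds. -/
def between (A B : Set α) : Set α := {z | (∀ a ∈ A, a < z) ∧ ∀ b ∈ B, z < b}

theorem between_inter_Iio (A B : Set α) (a : α) : between A B ∩ Iio a = between A (insert a B) := by
  ext z
  simp only [between, mem_inter_iff, mem_ofPred_eq, mem_Iio, mem_insert_iff, forall_eq_or_imp]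
  tauto

theorem between_inter_Ioi (A B : Set α) (a : α) : between A B ∩ Ioi a = between (insert a A) B := by
  ext z
  simp only [between, mem_inter_iff, mem_ofPred_eq, mem_Ioi, mem_insert_iff, forall_eq_or_imp]
  tauto

theorem BackForth.tp_between : ∀ {n : ℕ} {r : Set (α × β)}, BackForth n r → ∀ {A B : Set (α × β)},
    A ⊆ r → B ⊆ r → tp n (between (Prod.fst '' A) (Prod.fst '' B)) =
      tp n (between (Prod.snd '' A) (Prod.snd '' B))
  | 0, _, _, _, _, _, _ => rfl
  | n + 1, r, h, A, B, hA, hB => by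
    have mem : ∀ a b, BackForth n (insert (a, b) r) →
        (a ∈ between (Prod.fst '' A) (Prod.fst '' B) ↔
          b ∈ between (Prod.snd '' A) (Prod.snd '' B)) := by
      intro a b h
      simp only [between, mem_ofPred_eq, forall_mem_image]
      refine and_congr (forall₂_congr fun p hp => ?_) (forall₂_congr fun p hp => ?_)
      · exact h.lt_iff (Or.inr (hA hp)) (Or.inl rfl)
      · exact h.lt_iff (Or.inl rfl) (Or.inr (hB hp))
    have key : ∀ a b, BackForth n (insert (a, b) r) →
        tp n (between (Prod.fst '' A) (Prod.fst '' B) ∩ Iio a) =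
          tp n (between (Prod.snd '' A) (Prod.snd '' B) ∩ Iio b) ∧
        tp n (between (Prod.fst '' A) (Prod.fst '' B) ∩ Ioi a) =
          tp n (between (Prod.snd '' A) (Prod.snd '' B) ∩ Ioi b) := by
      intro a b h
      have e1 := h.tp_between (hA.trans (subset_insert _ _)) (insert_subset_insert (a := (a, b)) hB)
      have e2 := h.tp_between (insert_subset_insert (a := (a, b)) hA) (hB.trans (subset_insert _ _))
      simp only [image_insert_eq] at e1 e2
      simp only [between_inter_Iio, between_inter_Ioi]
      exact ⟨e1, e2⟩
    rw [tp_succ_eq_iff]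
    constructor
    · intro a ha
      obtain ⟨b, hb⟩ := h.1 a
      exact ⟨b, (mem a b hb).1 ha, key a b hb⟩
    · intro b hb
      obtain ⟨a, ha⟩ := h.2 b
      exact ⟨a, (mem a b ha).2 hb, key a b ha⟩

theorem BackForth.tp_Ioo {n : ℕ} {r : Set (α × β)} (h : BackForth n r)
    {a c : α} {b d : β} (hab : (a, b) ∈ r) (hcd : (c, d) ∈ r) :
    tp n (Ioo a c) = tp n (Ioo b d) := by
  have := h.tp_between (singleton_subset_iff.2 hab) (singleton_subset_iff.2 hcd)
  simpa [between, Ioo] using this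

theorem BackForth.tp_Iio {n : ℕ} {r : Set (α × β)} (h : BackForth n r)
    {a : α} {b : β} (hab : (a, b) ∈ r) : tp n (Iio a) = tp n (Iio b) := by
  have := h.tp_between (empty_subset r) (singleton_subset_iff.2 hab)
  simpa [between, Iio] using this

theorem BackForth.tp_Ioi {n : ℕ} {r : Set (α × β)} (h : BackForth n r)
    {a : α} {b : β} (hab : (a, b) ∈ r) : tp n (Ioi a) = tp n (Ioi b) := by
  have := h.tp_between (singleton_subset_iff.2 hab) (empty_subset r)
  simpa [between, Ioi] using this

theorem BackForth.tp_univ {n : ℕ} {r : Set (α × β)} (h : BackForth n r) :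
    tp n (univ : Set α) = tp n (univ : Set β) := by
  simpa [between] using h.tp_between (empty_subset r) (empty_subset r)

theorem inter_Ioi_eq_self {s : Set α} {a : α} (h : ∀ z ∈ s, a < z) : s ∩ Ioi a = s :=
  inter_eq_left.2 h

theorem inter_Iio_eq_self {s : Set α} {a : α} (h : ∀ z ∈ s, z < a) : s ∩ Iio a = s :=
  inter_eq_left.2 h

theorem inter_Iio_eq_empty {s : Set α} {a : α} (h : ∀ z ∈ s, a < z) : s ∩ Iio a = ∅ :=
  eq_empty_of_forall_notMem fun z hz => lt_asymm (h z hz.1) hz.2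

theorem inter_Ioi_eq_empty {s : Set α} {a : α} (h : ∀ z ∈ s, z < a) : s ∩ Ioi a = ∅ :=
  eq_empty_of_forall_notMem fun z hz => lt_asymm (h z hz.1) hz.2

/-- The part of the order cut out by the points `f p`, `p ∈ r`, those with `p ∈ S` lying below. -/
def cell {δ : Type*} (f : δ → α) (r S : Set δ) : Set α :=
  {z | ∀ p ∈ r, (p ∈ S → f p < z) ∧ (p ∉ S → z < f p)}

theorem cell_insert_of_mem {δ : Type*} (f : δ → α) (r : Set δ) {S : Set δ} {p : δ} (hp : p ∈ S) :
    cell f (insert p r) S = cell f r S ∩ Ioi (f p) := by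
  ext z
  simp only [cell, mem_ofPred_eq, mem_insert_iff, forall_eq_or_imp, hp, mem_inter_iff, mem_Ioi]
  simp [and_comm]

theorem cell_insert_of_notMem {δ : Type*} (f : δ → α) (r : Set δ) {S : Set δ} {p : δ} (hp : p ∉ S) :
    cell f (insert p r) S = cell f r S ∩ Iio (f p) := by
  ext z
  simp only [cell, mem_ofPred_eq, mem_insert_iff, forall_eq_or_imp, hp, mem_inter_iff, mem_Iio]
  simp [and_comm]

/-- Two positions are `n`-equivalent at the level of the cells they determine. -/
structure CellEquiv (n : ℕ) (r : Set (α × β)) : Prop where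
  lt_iff : ∀ p ∈ r, ∀ q ∈ r, (p.1 < q.1 ↔ p.2 < q.2)
  tp_eq : ∀ S, tp n (cell Prod.fst r S) = tp n (cell Prod.snd r S)

theorem CellEquiv.swap {n : ℕ} {r : Set (α × β)} (h : CellEquiv n r) :
    CellEquiv n (Prod.swap ⁻¹' r) := by
  refine ⟨fun p hp q hq => (h.lt_iff _ hp _ hq).symm, fun S => ?_⟩
  have e1 : cell Prod.fst (Prod.swap ⁻¹' r) S = cell Prod.snd r (Prod.swap ⁻¹' S) := by
    ext z
    exact ⟨fun hz p hp => hz p.swap hp, fun hz p hp => hz p.swap hp⟩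
  have e2 : cell Prod.snd (Prod.swap ⁻¹' r) S = cell Prod.fst r (Prod.swap ⁻¹' S) := by
    ext z
    exact ⟨fun hz p hp => hz p.swap hp, fun hz p hp => hz p.swap hp⟩
  rw [e1, e2, h.tp_eq]

theorem CellEquiv.exists_right {n : ℕ} {r : Set (α × β)} (h : CellEquiv (n + 1) r) (a : α) :
    ∃ b, CellEquiv n (insert (a, b) r) := by
  classical
  have hn : ∀ S, tp n (cell Prod.fst r S) = tp n (cell Prod.snd r S) := fun S =>
    tp_eq_of_succ (h.tp_eq S)
  by_cases ha : ∃ p ∈ r, p.1 = a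
  · obtain ⟨⟨a', b⟩, hp, rfl⟩ := ha
    refine ⟨b, ?_⟩
    rw [insert_eq_of_mem hp]
    exact ⟨h.lt_iff, hn⟩
  push Not at ha
  let S₀ : Set (α × β) := {p | p.1 < a}
  have haS : a ∈ cell Prod.fst r S₀ :=
    fun p hp => ⟨fun h => h, fun h => lt_of_le_of_ne (not_lt.1 h) (ha p hp).symm⟩
  obtain ⟨b, hb, e1, e2⟩ := (tp_succ_eq_iff.1 (h.tp_eq S₀)).1 a haS
  have side : ∀ p ∈ r, (p.1 < a ↔ p.2 < b) ∧ (a < p.1 ↔ b < p.2) := by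
    intro p hp
    by_cases hS : p ∈ S₀
    · exact ⟨iff_of_true hS ((hb p hp).1 hS),
        iff_of_false (lt_asymm hS) (lt_asymm ((hb p hp).1 hS))⟩
    · exact ⟨iff_of_false hS (lt_asymm ((hb p hp).2 hS)),
        iff_of_true ((haS p hp).2 hS) ((hb p hp).2 hS)⟩
  refine ⟨b, ?_, fun S => ?_⟩
  · rintro p (rfl | hp) q (rfl | hq)
    · simp
    · exact (side q hq).2
    · exact (side p hp).1
    · exact h.lt_iff p hp q hq
  · by_cases hS : ∀ p ∈ r, (p ∈ S ↔ p ∈ S₀)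
    · have c1 : cell Prod.fst r S = cell Prod.fst r S₀ := by
        ext z
        exact forall₂_congr fun p hp => by rw [hS p hp]
      have c2 : cell Prod.snd r S = cell Prod.snd r S₀ := by
        ext z
        exact forall₂_congr fun p hp => by rw [hS p hp]
      by_cases hab : (a, b) ∈ S
      · rw [cell_insert_of_mem _ _ hab, cell_insert_of_mem _ _ hab, c1, c2, e2]
      · rw [cell_insert_of_notMem _ _ hab, cell_insert_of_notMem _ _ hab, c1, c2, e1]
    · push Not at hS
      obtain ⟨p, hp, ⟨h1, h2⟩ | ⟨h1, h2⟩⟩ := hS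
      · have f1 : ∀ z ∈ cell Prod.fst r S, a < z := fun z hz =>
          ((haS p hp).2 h2).trans ((hz p hp).1 h1)
        have f2 : ∀ z ∈ cell Prod.snd r S, b < z := fun z hz =>
          ((hb p hp).2 h2).trans ((hz p hp).1 h1)
        by_cases hab : (a, b) ∈ S
        · rw [cell_insert_of_mem _ _ hab, cell_insert_of_mem _ _ hab,
            inter_Ioi_eq_self f1, inter_Ioi_eq_self f2, hn]
        · rw [cell_insert_of_notMem _ _ hab, cell_insert_of_notMem _ _ hab,
            inter_Iio_eq_empty f1, inter_Iio_eq_empty f2, tp_empty, tp_empty]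
      · have f1 : ∀ z ∈ cell Prod.fst r S, z < a := fun z hz =>
          ((hz p hp).2 h1).trans ((haS p hp).1 h2)
        have f2 : ∀ z ∈ cell Prod.snd r S, z < b := fun z hz =>
          ((hz p hp).2 h1).trans ((hb p hp).1 h2)
        by_cases hab : (a, b) ∈ S
        · rw [cell_insert_of_mem _ _ hab, cell_insert_of_mem _ _ hab,
            inter_Ioi_eq_empty f1, inter_Ioi_eq_empty f2, tp_empty, tp_empty]
        · rw [cell_insert_of_notMem _ _ hab, cell_insert_of_notMem _ _ hab,
            inter_Iio_eq_self f1, inter_Iio_eq_self f2, hn]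

theorem CellEquiv.backForth : ∀ {n : ℕ} {r : Set (α × β)}, CellEquiv n r → BackForth n r
  | 0, _, h => h.lt_iff
  | n + 1, r, h => by
    refine ⟨fun a => (h.exists_right a).imp fun b hb => hb.backForth, fun b => ?_⟩
    obtain ⟨a, ha⟩ := h.swap.exists_right b
    refine ⟨a, ha.swap.backForth.mono ?_⟩
    rintro p (rfl | hp)
    · exact Or.inl rfl
    · exact Or.inr hp

theorem backForth_empty {n : ℕ} (h : tp n (univ : Set α) = tp n (univ : Set β)) :
    BackForth n (∅ : Set (α × β)) :=
  CellEquiv.backForth ⟨by simp, fun S => by simpa [cell] using h⟩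

end BackForth

section SelfAdditive

variable {X Y : Type*} [LinearOrder X] [LinearOrder Y]

theorem mem_tp_Ioi {n : ℕ} {a : X} {p q : OrdTyp n} : Mem (p, q) (tp (n + 1) (Ioi a)) ↔
    ∃ x, a < x ∧ tp n (Ioo a x) = p ∧ tp n (Ioi x) = q := by
  rw [mem_tp]
  refine exists_congr fun x => and_congr_right fun hx => ?_
  rw [Ioi_inter_Iio, inter_Ioi_eq_Ioi hx]
where
  inter_Ioi_eq_Ioi {a x : X} (h : a < x) : Ioi a ∩ Ioi x = Ioi x :=
    inter_eq_right.2 (Ioi_subset_Ioi h.le)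

theorem mem_tp_Iio {n : ℕ} {a : X} {p q : OrdTyp n} : Mem (p, q) (tp (n + 1) (Iio a)) ↔
    ∃ x, x < a ∧ tp n (Iio x) = p ∧ tp n (Ioo x a) = q := by
  rw [mem_tp]
  refine exists_congr fun x => and_congr_right fun hx => ?_
  rw [inter_comm _ (Ioi x), Ioi_inter_Iio, inter_eq_right.2 (Iio_subset_Iio (le_of_lt hx))]

theorem mem_tp_univ {n : ℕ} {p q : OrdTyp n} : Mem (p, q) (tp (n + 1) (univ : Set X)) ↔
    ∃ x : X, tp n (Iio x) = p ∧ tp n (Ioi x) = q := by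
  simp [mem_tp]

theorem mem_tp_Ioo {n : ℕ} {a b : X} {p q : OrdTyp n} : Mem (p, q) (tp (n + 1) (Ioo a b)) ↔
    ∃ x, a < x ∧ x < b ∧ tp n (Ioo a x) = p ∧ tp n (Ioo x b) = q := by
  rw [mem_tp]
  refine exists_congr fun x => ?_
  rw [mem_Ioo, and_assoc]
  refine and_congr_right fun hx => and_congr_right fun hx' => ?_
  rw [Ioo_inter_Iio, min_eq_right hx'.le, inter_comm, Ioi_inter_Ioo, max_eq_left hx.le]

theorem exists_tp_point {n : ℕ} (h : tp (n + 1) (univ : Set X) = tp (n + 1) (univ : Set Y)) (x : X) :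
    ∃ y : Y, tp n (Iio y) = tp n (Iio x) ∧ tp n (Ioi y) = tp n (Ioi x) := by
  rw [← mem_tp_univ, ← h, mem_tp_univ]
  exact ⟨x, rfl, rfl⟩

theorem SelfAdditive.transfer (hX : SelfAdditive X) (h : Th (univ : Set X) = Th (univ : Set Y)) :
    SelfAdditive Y := by
  have h := Th_eq_iff.1 h
  constructor
  · intro n a b
    obtain ⟨a₀, -, ha⟩ := exists_tp_point (h (n + 1 + 1)).symm a
    obtain ⟨b₀, hb1, hb2⟩ := exists_tp_point (h (n + 1)).symm b
    obtain ⟨b', h1, h2, h3⟩ := hX.right n a₀ b₀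
    have h4 := mem_tp_Ioi.2 ⟨b', h1, h2, h3⟩
    rw [ha] at h4
    obtain ⟨b'', h5, h6, h7⟩ := mem_tp_Ioi.1 h4
    exact ⟨b'', h5, by rw [h6, tp_eq_of_succ ha, hb1], by rw [h7, hb2]⟩
  · intro n a b
    obtain ⟨b₀, hb, -⟩ := exists_tp_point (h (n + 1 + 1)).symm b
    obtain ⟨a₀, ha1, ha2⟩ := exists_tp_point (h (n + 1)).symm a
    obtain ⟨b', h1, h2, h3⟩ := hX.left n a₀ b₀
    have h4 := mem_tp_Iio.2 ⟨b', h1, h3, h2⟩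
    rw [hb] at h4
    obtain ⟨b'', h5, h6, h7⟩ := mem_tp_Iio.1 h4
    exact ⟨b'', h5, by rw [h7, tp_eq_of_succ hb, ha2], by rw [h6, ha1]⟩

theorem SelfAdditive.Ioi_add_univ (hX : SelfAdditive X) :
    ∀ (n : ℕ) (a : X), tp n (Ioi a) + tp n (univ : Set X) = tp n (Ioi a)
  | 0, _ => rfl
  | n + 1, a => by
    apply ext_mem
    intro p q
    simp only [mem_add, trunc_tp, mem_tp_Ioi, mem_tp_univ]
    constructor
    · rintro (⟨c, ⟨x, hx, rfl, rfl⟩, rfl⟩ | ⟨c, ⟨x, rfl, rfl⟩, rfl⟩)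
      · exact ⟨x, hx, rfl, (hX.Ioi_add_univ n x).symm⟩
      · exact hX.right n a x
    · rintro ⟨x, hx, rfl, rfl⟩
      exact Or.inl ⟨_, ⟨x, hx, rfl, rfl⟩, hX.Ioi_add_univ n x⟩

theorem SelfAdditive.univ_add_Iio (hX : SelfAdditive X) :
    ∀ (n : ℕ) (a : X), tp n (univ : Set X) + tp n (Iio a) = tp n (Iio a)
  | 0, _ => rfl
  | n + 1, a => by
    apply ext_mem
    intro p q
    simp only [mem_add, trunc_tp, mem_tp_Iio, mem_tp_univ]
    constructor
    · rintro (⟨c, ⟨x, rfl, rfl⟩, rfl⟩ | ⟨c, ⟨x, hx, rfl, rfl⟩, rfl⟩)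
      · obtain ⟨y, h1, h2, h3⟩ := hX.left n x a
        exact ⟨y, h1, h3, h2⟩
      · exact ⟨x, hx, (hX.univ_add_Iio n x).symm, rfl⟩
    · rintro ⟨x, hx, rfl, rfl⟩
      exact Or.inr ⟨_, ⟨x, hx, rfl, rfl⟩, hX.univ_add_Iio n x⟩

/-- The interval between `a` and `b` is as long as it can be. -/
def Far (a b : X) : Prop := a < b ∧ ∀ n, tp n (Ioo a b) = tp n (Ioi a) + tp n (Iio b)

theorem Far.mono {a b c d : X} (h : Far c d) (hac : a ≤ c) (hdb : d ≤ b) : Far a b := by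
  have h1 : Far a d := by
    refine ⟨hac.trans_lt h.1, fun n => ?_⟩
    rcases hac.eq_or_lt with rfl | hac
    · exact h.2 n
    · rw [tp_Ioo_eq_add_pt_add n hac h.1, h.2 n, tp_Ioi_eq_add n hac, tp_Ici_eq_pt_add]
      simp only [add_assoc]
  refine ⟨h1.1.trans_le hdb, fun n => ?_⟩
  rcases hdb.eq_or_lt with rfl | hdb
  · exact h1.2 n
  · rw [tp_Ioo_eq_add n h1.1 hdb.le, h1.2 n, add_assoc, ← tp_Iio_eq_add n hdb.le]

theorem Far.or (hX : SelfAdditive X) {a c z : X} (h : Far a z) (hac : a < c) (hcz : c < z) :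
    Far a c ∨ Far c z := by
  have key : ∀ n, tp n (Ioo a c) = tp n (Ioi a) + tp n (Iio c) ∨
      tp n (Ioo c z) = tp n (Ioi c) + tp n (Iio z) := by
    intro n
    have h1 := (mem_tp_Ioo (n := n)).2 ⟨c, hac, hcz, rfl, rfl⟩
    rw [h.2, mem_add] at h1
    simp only [trunc_tp, mem_tp_Ioi, mem_tp_Iio] at h1
    rcases h1 with ⟨_, ⟨x, hx, e1, rfl⟩, e2⟩ | ⟨_, ⟨x, hx, rfl, e1⟩, e2⟩
    · right
      have e3 : tp n (Ioi c) = tp n (Ioi x) := by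
        rw [tp_Ioi_eq_add n hcz, ← e2, tp_Ici_eq_pt_add, add_assoc, ← add_assoc (tp n (Iio z)),
          ← tp_univ_eq, hX.Ioi_add_univ]
      rw [e3, e2]
    · left
      have e3 : tp n (Iio c) = tp n (Iio x) := by
        rw [tp_Iio_eq_add n hac.le, tp_Ico_eq_pt_add n hac, ← e2, ← add_assoc, ← add_assoc,
          ← tp_univ_eq, hX.univ_add_Iio]
      rw [e3, e2]
  by_contra hn
  rw [not_or] at hn
  simp only [Far, hac, hcz, true_and, not_forall] at hn
  obtain ⟨⟨i, hi⟩, ⟨j, hj⟩⟩ := hn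
  have down : ∀ {x y : X} {i k : ℕ}, i ≤ k → tp k (Ioo x y) = tp k (Ioi x) + tp k (Iio y) →
      tp i (Ioo x y) = tp i (Ioi x) + tp i (Iio y) := by
    intro x y i k hik
    induction k, hik using Nat.le_induction with
    | base => exact id
    | succ k _ ih =>
      intro h
      apply ih
      rw [← trunc_tp, h, trunc_add, trunc_tp, trunc_tp]
  rcases key (max i j) with h | h
  · exact hi (down (le_max_left _ _) h)
  · exact hj (down (le_max_right _ _) h)

/-- The complete type of a pair of elements. -/
def pairTp (a b : X) (n : ℕ) :
    (OrdTyp n × OrdTyp n) × (OrdTyp n × OrdTyp n) × OrdTyp n × Prop :=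
  ((tp n (Iio a), tp n (Ioi a)), (tp n (Iio b), tp n (Ioi b)), tp n (Ioo a b), a < b)

theorem pairTp_eq_iff {a b : X} {c d : Y} {n : ℕ} : pairTp a b n = pairTp c d n ↔
    (tp n (Iio a) = tp n (Iio c) ∧ tp n (Ioi a) = tp n (Ioi c)) ∧
    (tp n (Iio b) = tp n (Iio d) ∧ tp n (Ioi b) = tp n (Ioi d)) ∧
    tp n (Ioo a b) = tp n (Ioo c d) ∧ (a < b ↔ c < d) := by
  simp [pairTp]

theorem pairTp_eq_of_le {a b : X} {c d : Y} {m n : ℕ} (hmn : m ≤ n)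
    (h : pairTp a b n = pairTp c d n) : pairTp a b m = pairTp c d m := by
  rw [pairTp_eq_iff] at h ⊢
  exact ⟨⟨tp_eq_of_le hmn h.1.1, tp_eq_of_le hmn h.1.2⟩,
    ⟨tp_eq_of_le hmn h.2.1.1, tp_eq_of_le hmn h.2.1.2⟩, tp_eq_of_le hmn h.2.2.1, h.2.2.2⟩

theorem far_iff_of_pairTp_eq {a b : X} {c d : Y} (h : pairTp a b = pairTp c d) :
    Far a b ↔ Far c d := by
  have h := fun n => pairTp_eq_iff.1 (congr_fun h n)
  refine and_congr (h 0).2.2.2 (forall_congr' fun n => ?_)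
  rw [(h n).1.2, (h n).2.1.1, (h n).2.2.1]

theorem pairTp_map (f : X ≃o Y) (a b : X) : pairTp (f a) (f b) = pairTp a b := by
  funext n
  rw [pairTp_eq_iff, ← f.image_Iio, ← f.image_Ioi, ← f.image_Iio, ← f.image_Ioi, ← f.image_Ioo]
  have h : ∀ s : Set X, tp n (f '' s) = tp n s := fun s => tp_image n (f.strictMono.strictMonoOn s)
  exact ⟨⟨h _, h _⟩, ⟨h _, h _⟩, h _, f.lt_iff_lt⟩

theorem cell_empty {δ : Type*} (f : δ → X) (S : Set δ) : cell f ∅ S = univ := by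
  simp [cell]

theorem backForth_pair {a b : X} {c d : Y} {n : ℕ} (hab : a ≤ b) (hcd : c ≤ d)
    (h : pairTp a b n = pairTp c d n) : BackForth n {(a, c), (b, d)} := by
  obtain ⟨⟨h1, h2⟩, ⟨h3, h4⟩, h5, h6⟩ := pairTp_eq_iff.1 h
  refine CellEquiv.backForth ⟨?_, fun S => ?_⟩
  · simp [h6, hab.not_gt, hcd.not_gt]
  · rw [← insert_empty_eq (b, d)]
    by_cases hs : (a, c) ∈ S <;> by_cases ht : (b, d) ∈ S
    · simp only [cell_insert_of_mem _ _ hs, cell_insert_of_mem _ _ ht, cell_empty, univ_inter,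
        Ioi_inter_Ioi, max_eq_left hab, max_eq_left hcd, h4]
    · simp only [cell_insert_of_mem _ _ hs, cell_insert_of_notMem _ _ ht, cell_empty, univ_inter,
        Iio_inter_Ioi, h5]
    · simp only [cell_insert_of_notMem _ _ hs, cell_insert_of_mem _ _ ht, cell_empty, univ_inter,
        Ioi_inter_Iio, Ioo_eq_empty_of_le hab, Ioo_eq_empty_of_le hcd, tp_empty]
    · simp only [cell_insert_of_notMem _ _ hs, cell_insert_of_notMem _ _ ht, cell_empty, univ_inter,
        Iio_inter_Iio, min_eq_right hab, min_eq_right hcd, h1]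

section Lex

variable {J : Type*} [LinearOrder J]

/-- The copies of `X` in the lexicographic product indexed by `K`. -/
def copies (X : Type*) (K : Set J) : Set (J ×ₗ X) := {p | (ofLex p).1 ∈ K}

theorem strictMono_toLex (j : J) : StrictMono fun x : X => (toLex (j, x) : J ×ₗ X) := fun _ _ h =>
  Prod.Lex.toLex_lt_toLex.2 (Or.inr ⟨rfl, h⟩)

theorem copies_inter_Iio {K : Set J} {j : J} (hj : j ∈ K) (x : X) :
    copies X K ∩ Iio (toLex (j, x)) =
      copies X (K ∩ Iio j) ∪ (fun y => toLex (j, y)) '' Iio x := by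
  ext p
  induction p with | _ p
  obtain ⟨k, y⟩ := p
  simp only [copies, mem_inter_iff, mem_ofPred_eq, mem_Iio, mem_union, mem_image,
    Prod.Lex.toLex_lt_toLex, ofLex_toLex, EmbeddingLike.apply_eq_iff_eq, Prod.mk.injEq]
  constructor
  · rintro ⟨h, h1 | ⟨rfl, h1⟩⟩
    · exact Or.inl ⟨h, h1⟩
    · exact Or.inr ⟨y, h1, rfl, rfl⟩
  · rintro (⟨h, h1⟩ | ⟨y, h1, rfl, rfl⟩)
    · exact ⟨h, Or.inl h1⟩
    · exact ⟨hj, Or.inr ⟨rfl, h1⟩⟩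

theorem copies_inter_Ioi {K : Set J} {j : J} (hj : j ∈ K) (x : X) :
    copies X K ∩ Ioi (toLex (j, x)) =
      (fun y => toLex (j, y)) '' Ioi x ∪ copies X (K ∩ Ioi j) := by
  ext p
  induction p with | _ p
  obtain ⟨k, y⟩ := p
  simp only [copies, mem_inter_iff, mem_ofPred_eq, mem_Ioi, mem_union, mem_image,
    Prod.Lex.toLex_lt_toLex, ofLex_toLex, EmbeddingLike.apply_eq_iff_eq, Prod.mk.injEq]
  constructor
  · rintro ⟨h, h1 | ⟨rfl, h1⟩⟩
    · exact Or.inr ⟨h, h1⟩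
    · exact Or.inl ⟨y, h1, rfl, rfl⟩
  · rintro (⟨y, h1, rfl, rfl⟩ | ⟨h, h1⟩)
    · exact ⟨hj, Or.inr ⟨rfl, h1⟩⟩
    · exact ⟨h, Or.inl h1⟩

theorem tp_copies_inter_Iio (n : ℕ) {K : Set J} {j : J} (hj : j ∈ K) (x : X) :
    tp n (copies X K ∩ Iio (toLex (j, x))) = tp n (copies X (K ∩ Iio j)) + tp n (Iio x) := by
  rw [copies_inter_Iio hj, tp_union, tp_image n ((strictMono_toLex j).strictMonoOn _)]
  rintro p hp _ ⟨y, -, rfl⟩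
  exact Prod.Lex.lt_iff.2 (Or.inl hp.2)

theorem tp_copies_inter_Ioi (n : ℕ) {K : Set J} {j : J} (hj : j ∈ K) (x : X) :
    tp n (copies X K ∩ Ioi (toLex (j, x))) = tp n (Ioi x) + tp n (copies X (K ∩ Ioi j)) := by
  rw [copies_inter_Ioi hj, tp_union, tp_image n ((strictMono_toLex j).strictMonoOn _)]
  rintro _ ⟨y, -, rfl⟩ p hp
  exact Prod.Lex.lt_iff.2 (Or.inl hp.2)

theorem copies_empty {X J : Type*} : copies X (∅ : Set J) = ∅ := rfl

theorem SelfAdditive.tp_copies (hX : SelfAdditive X) : ∀ (n : ℕ) {K : Set J}, K.Nonempty →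
    tp n (copies X K) = tp n (univ : Set X)
  | 0, _, _ => rfl
  | n + 1, K, hK => by
    have key : ∀ j ∈ K, ∀ x : X,
        tp n (copies X K ∩ Iio (toLex (j, x))) = tp n (Iio x) ∧
        tp n (copies X K ∩ Ioi (toLex (j, x))) = tp n (Ioi x) := by
      intro j hj x
      rw [tp_copies_inter_Iio n hj, tp_copies_inter_Ioi n hj]
      constructor
      · rcases (K ∩ Iio j).eq_empty_or_nonempty with h | h
        · rw [h, copies_empty, tp_empty, zero_add]
        · rw [hX.tp_copies n h, hX.univ_add_Iio]
      · rcases (K ∩ Ioi j).eq_empty_or_nonempty with h | h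
        · rw [h, copies_empty, tp_empty, add_zero]
        · rw [hX.tp_copies n h, hX.Ioi_add_univ]
    apply ext_mem
    intro p q
    rw [mem_tp, mem_tp_univ]
    constructor
    · rintro ⟨a, ha, rfl, rfl⟩
      exact ⟨(ofLex a).2, (key _ ha _).1.symm, (key _ ha _).2.symm⟩
    · rintro ⟨x, rfl, rfl⟩
      obtain ⟨j, hj⟩ := hK
      exact ⟨toLex (j, x), hj, key j hj x⟩

theorem copies_univ {X J : Type*} : copies X (univ : Set J) = univ := rfl

theorem SelfAdditive.Th_lex [Nonempty J] (hX : SelfAdditive X) :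
    Th (univ : Set (J ×ₗ X)) = Th (univ : Set X) :=
  Th_eq_iff.2 fun n => by rw [← copies_univ, hX.tp_copies n univ_nonempty]

theorem SelfAdditive.tp_copies_add_Iio (hX : SelfAdditive X) (n : ℕ) (K : Set J) (x : X) :
    tp n (copies X K) + tp n (Iio x) = tp n (Iio x) := by
  rcases K.eq_empty_or_nonempty with rfl | h
  · rw [copies_empty, tp_empty, zero_add]
  · rw [hX.tp_copies n h, hX.univ_add_Iio]

theorem SelfAdditive.Ioi_add_tp_copies (hX : SelfAdditive X) (n : ℕ) (K : Set J) (x : X) :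
    tp n (Ioi x) + tp n (copies X K) = tp n (Ioi x) := by
  rcases K.eq_empty_or_nonempty with rfl | h
  · rw [copies_empty, tp_empty, add_zero]
  · rw [hX.tp_copies n h, hX.Ioi_add_univ]

theorem SelfAdditive.tp_Iio_lex (hX : SelfAdditive X) (n : ℕ) (j : J) (x : X) :
    tp n (Iio (toLex (j, x))) = tp n (Iio x) := by
  rw [← univ_inter (Iio _), ← copies_univ, tp_copies_inter_Iio n (mem_univ j),
    hX.tp_copies_add_Iio]

theorem SelfAdditive.tp_Ioi_lex (hX : SelfAdditive X) (n : ℕ) (j : J) (x : X) :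
    tp n (Ioi (toLex (j, x))) = tp n (Ioi x) := by
  rw [← univ_inter (Ioi _), ← copies_univ, tp_copies_inter_Ioi n (mem_univ j),
    hX.Ioi_add_tp_copies]

theorem tp_Ioo_lex (n : ℕ) (j : J) (x y : X) :
    tp n (Ioo (toLex (j, x) : J ×ₗ X) (toLex (j, y))) = tp n (Ioo x y) := by
  rw [← tp_image n ((strictMono_toLex j).strictMonoOn (Ioo x y))]
  congr 1
  ext p
  induction p with | _ p
  obtain ⟨k, z⟩ := p
  simp only [mem_Ioo, Prod.Lex.toLex_lt_toLex, mem_image, EmbeddingLike.apply_eq_iff_eq,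
    Prod.mk.injEq]
  constructor
  · rintro ⟨h1 | ⟨rfl, h1⟩, h2 | ⟨h3, h2⟩⟩
    · exact (lt_asymm h1 h2).elim
    · exact (h1.ne h3.symm).elim
    · exact (h2.false).elim
    · exact ⟨z, ⟨h1, h2⟩, rfl, rfl⟩
  · rintro ⟨z, h, rfl, rfl⟩
    exact ⟨Or.inr ⟨rfl, h.1⟩, Or.inr ⟨rfl, h.2⟩⟩

theorem SelfAdditive.far_lex (hX : SelfAdditive X) {j k : J} (hjk : j < k) (x y : X) :
    Far (toLex (j, x) : J ×ₗ X) (toLex (k, y)) := by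
  refine ⟨Prod.Lex.toLex_lt_toLex.2 (Or.inl hjk), fun n => ?_⟩
  rw [hX.tp_Iio_lex, hX.tp_Ioi_lex, ← Ioi_inter_Iio, ← univ_inter (Ioi _), ← copies_univ,
    copies_inter_Ioi (mem_univ j), union_inter_distrib_right, tp_union, univ_inter,
    tp_copies_inter_Iio n (show k ∈ Ioi j from hjk), hX.tp_copies_add_Iio, inter_eq_left.2,
    tp_image n ((strictMono_toLex j).strictMonoOn _)]
  · rintro _ ⟨z, -, rfl⟩
    exact Prod.Lex.toLex_lt_toLex.2 (Or.inl hjk)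
  · rintro _ ⟨⟨z, -, rfl⟩, -⟩ p hp
    exact Prod.Lex.lt_iff.2 (Or.inl hp.1.2)

theorem SelfAdditive.pairTp_lex (hX : SelfAdditive X) (j : J) (x y : X) :
    pairTp (toLex (j, x) : J ×ₗ X) (toLex (j, y)) = pairTp x y := by
  funext n
  rw [pairTp_eq_iff]
  exact ⟨⟨hX.tp_Iio_lex n j x, hX.tp_Ioi_lex n j x⟩, ⟨hX.tp_Iio_lex n j y, hX.tp_Ioi_lex n j y⟩,
    tp_Ioo_lex n j x y, (strictMono_toLex j).lt_iff_lt⟩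

end Lex

end SelfAdditive

section Omitting

variable {X Y : Type*} [LinearOrder X] [LinearOrder Y]

theorem backForth_diagonal : ∀ n : ℕ, BackForth n {p : X × X | p.1 = p.2}
  | 0 => fun p hp q hq => by rw [show p.1 = p.2 from hp, show q.1 = q.2 from hq]
  | n + 1 => by
    have key : ∀ a : X, BackForth n (insert (a, a) {p : X × X | p.1 = p.2}) := fun a => by
      rw [insert_eq_of_mem (show (a, a) ∈ {p : X × X | p.1 = p.2} from rfl)]
      exact backForth_diagonal n
    exact ⟨fun a => ⟨a, key a⟩, fun a => ⟨a, key a⟩⟩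

theorem exists_finite_witness (n : ℕ) {E : Set X} (hE : E.Finite) :
    ∃ F : Set X, F.Finite ∧ ∀ a, ∃ b ∈ F, BackForth n (insert (a, b) {p | p.1 = p.2 ∧ p.1 ∈ E}) := by
  classical
  have := hE.to_subtype
  let D : Set (X × X) := {p | p.1 = p.2 ∧ p.1 ∈ E}
  let S' : Set E → Set X := fun T => (cell ((↑) : E → X) univ T)
  let code : X → (E → Prop × Prop) × (Set E → OrdTyp n × OrdTyp n) := fun a =>
    (fun e => (e.1 < a, a < e.1), fun T => (tp n (S' T ∩ Iio a), tp n (S' T ∩ Ioi a)))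
  refine ⟨range fun c : range code => rangeSplitting code c, finite_range _, fun a => ?_⟩
  obtain ⟨b, hbF, hab⟩ : ∃ b ∈ range fun c : range code => rangeSplitting code c,
      code b = code a :=
    ⟨_, ⟨⟨code a, mem_range_self a⟩, rfl⟩, apply_rangeSplitting code _⟩
  refine ⟨b, hbF, ?_⟩
  have h1 : ∀ e ∈ E, (e < b ↔ e < a) ∧ (b < e ↔ a < e) := fun e he => by
    simpa [code] using congr_fun (congr_arg Prod.fst hab) ⟨e, he⟩
  have h2 : ∀ T, tp n (S' T ∩ Iio b) = tp n (S' T ∩ Iio a) ∧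
      tp n (S' T ∩ Ioi b) = tp n (S' T ∩ Ioi a) := fun T => by
    simpa [code] using congr_fun (congr_arg Prod.snd hab) T
  refine CellEquiv.backForth ⟨?_, fun S => ?_⟩
  · rintro p (rfl | ⟨hp, hp'⟩) q (rfl | ⟨hq, hq'⟩)
    · simp
    · rw [← hq]; exact (h1 _ hq').2.symm
    · rw [← hp]; exact (h1 _ hp').1.symm
    · rw [hp, hq]
  · have e1 : cell Prod.fst D S = S' {e | ((e, e) : X × X) ∈ S} := by
      ext z
      constructor
      · exact fun h e _ => h (e.1, e.1) ⟨rfl, e.2⟩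
      · rintro h ⟨c, d⟩ ⟨hcd, hc⟩
        obtain rfl : c = d := hcd
        exact h ⟨c, hc⟩ trivial
    have e2 : cell Prod.snd D S = S' {e | ((e, e) : X × X) ∈ S} := by
      ext z
      constructor
      · exact fun h e _ => h (e.1, e.1) ⟨rfl, e.2⟩
      · rintro h ⟨c, d⟩ ⟨hcd, hc⟩
        obtain rfl : c = d := hcd
        exact h ⟨c, hc⟩ trivial
    change tp n (cell Prod.fst (insert (a, b) D) S) = tp n (cell Prod.snd (insert (a, b) D) S)
    by_cases hS : (a, b) ∈ S
    · rw [cell_insert_of_mem _ _ hS, cell_insert_of_mem _ _ hS, e1, e2]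
      exact (h2 _).2.symm
    · rw [cell_insert_of_notMem _ _ hS, cell_insert_of_notMem _ _ hS, e1, e2]
      exact (h2 _).1.symm

/-- The position of the game in which the first `k` terms of two sequences have been played. -/
def played (k : ℕ) (x : ℕ → X) (y : ℕ → Y) : Set (X × Y) := {p | ∃ t < k, p = (x t, y t)}

theorem mem_played {X Y : Type*} {k t : ℕ} (h : t < k) (x : ℕ → X) (y : ℕ → Y) : (x t, y t) ∈ played k x y :=
  ⟨t, h, rfl⟩

theorem BackForth.exists_played {n : ℕ} (x : ℕ → X) : ∀ (k : ℕ) {r : Set (X × Y)},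
    BackForth (n + k) r → r.Nonempty → ∃ y : ℕ → Y, BackForth n (r ∪ played k x y)
  | 0, r, h, hr => by
    obtain ⟨p, -⟩ := hr
    refine ⟨fun _ => p.2, h.mono ?_⟩
    rintro q (hq | ⟨t, ht, -⟩)
    · exact hq
    · exact absurd ht (Nat.not_lt_zero t)
  | k + 1, r, h, hr => by
    obtain ⟨b, hb⟩ := h.1 (x k)
    obtain ⟨y, hy⟩ := BackForth.exists_played x k hb (insert_nonempty _ _)
    refine ⟨Function.update y k b, hy.mono ?_⟩
    rintro q (hq | ⟨t, ht, rfl⟩)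
    · exact Or.inl (Or.inr hq)
    · rcases (Nat.lt_succ_iff.1 ht).eq_or_lt with rfl | ht
      · exact Or.inl (Or.inl (by simp))
      · exact Or.inr ⟨t, ht, by simp [Function.update_of_ne ht.ne]⟩

theorem BackForth.pairTp_eq {n : ℕ} {r : Set (X × Y)} (h : BackForth n r) {a c : X} {b d : Y}
    (hab : (a, b) ∈ r) (hcd : (c, d) ∈ r) : pairTp a c n = pairTp b d n :=
  pairTp_eq_iff.2 ⟨⟨h.tp_Iio hab, h.tp_Ioi hab⟩, ⟨h.tp_Iio hcd, h.tp_Ioi hcd⟩,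
    h.tp_Ioo hab hcd, h.lt_iff hab hcd⟩

/-- The type of the pair `c ≤ d` is not isolated among the pairs of `X`. -/
def NonIsolated (X : Type*) [LinearOrder X] {Y : Type*} [LinearOrder Y] (c d : Y) : Prop :=
  ∀ n, ∃ a b : X, a ≤ b ∧ pairTp a b n = pairTp c d n ∧ pairTp a b ≠ pairTp c d

theorem NonIsolated.exists_avoiding {c d : Y} (hq : NonIsolated X c d) (n k : ℕ)
    (x : ℕ → X) {i j : ℕ} (hi : i < k) (hj : j < k) :
    ∃ n' ≥ n, ∃ x' : ℕ → X, BackForth n (played k x x') ∧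
      ¬ (x' i ≤ x' j ∧ pairTp (x' i) (x' j) n' = pairTp c d n') := by
  by_cases h : x i ≤ x j ∧ pairTp (x i) (x j) = pairTp c d
  · obtain ⟨hij, he⟩ := h
    obtain ⟨a, b, hab, h1, h2⟩ := hq (n + k)
    obtain ⟨m, hm⟩ := Function.ne_iff.1 h2
    have h3 : BackForth (n + k) {(x i, a), (x j, b)} :=
      backForth_pair hij hab ((congr_fun he _).trans h1.symm)
    obtain ⟨x', hx'⟩ := h3.exists_played x k (insert_nonempty _ _)
    have ea : x' i = a := by
      have l1 := hx'.lt_iff (Or.inl (Or.inl rfl)) (Or.inr (mem_played hi x x'))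
      have l2 := hx'.lt_iff (Or.inr (mem_played hi x x')) (Or.inl (Or.inl rfl))
      exact le_antisymm (not_lt.1 fun h => lt_irrefl _ (l1.2 h))
        (not_lt.1 fun h => lt_irrefl _ (l2.2 h))
    have eb : x' j = b := by
      have l1 := hx'.lt_iff (Or.inl (Or.inr rfl)) (Or.inr (mem_played hj x x'))
      have l2 := hx'.lt_iff (Or.inr (mem_played hj x x')) (Or.inl (Or.inr rfl))
      exact le_antisymm (not_lt.1 fun h => lt_irrefl _ (l1.2 h))
        (not_lt.1 fun h => lt_irrefl _ (l2.2 h))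
    refine ⟨max n m, le_max_left _ _, x', hx'.mono subset_union_right, fun h => hm ?_⟩
    rw [ea, eb] at h
    exact pairTp_eq_of_le (le_max_right _ _) h.2
  · have hd : BackForth n (played k x x) := (backForth_diagonal n).mono fun p hp => by
      obtain ⟨t, -, rfl⟩ := hp
      rfl
    rw [not_and_or] at h
    rcases h with h | h
    · exact ⟨n, le_rfl, x, hd, fun h' => h h'.1⟩
    · obtain ⟨m, hm⟩ := Function.ne_iff.1 h
      exact ⟨max n m, le_max_left _ _, x, hd,
        fun h' => hm (pairTp_eq_of_le (le_max_right _ _) h'.2)⟩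

/-- A finite piece of information about a countable order elementarily equivalent to `X`: the first
`size` of the points `pt`, up to `rank` rounds of the game. -/
structure Approx (X : Type*) where
  rank : ℕ
  size : ℕ
  pt : ℕ → X

/-- The approximation `C'` refines `C`, contains witnesses for it, and decides that the points
with indices `i` and `j` do not have the type of `(c, d)`. -/
structure Approx.Step (c d : Y) (i j : ℕ) (C C' : Approx X) : Prop where
  rank_lt : C.rank < C'.rank
  size_lt : C.size < C'.size
  backForth : BackForth C.rank (played C.size C.pt C'.pt)
  exists_witness : ∀ a, ∃ l < C'.size,
    BackForth C.rank (insert (a, C'.pt l) (played C.size C.pt C'.pt))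
  avoids : i < C.size → j < C.size →
    ¬ (C'.pt i ≤ C'.pt j ∧ pairTp (C'.pt i) (C'.pt j) C'.rank = pairTp c d C'.rank)

theorem Approx.exists_step [Nonempty X] {c d : Y} (hq : NonIsolated X c d) (i j : ℕ)
    (C : Approx X) : ∃ C', Approx.Step c d i j C C' := by
  classical
  obtain ⟨n, k, x⟩ := C
  have avoid : ∃ n' ≥ n + 1, ∃ x₁ : ℕ → X, BackForth (n + 1) (played k x x₁) ∧
      (i < k → j < k → ¬ (x₁ i ≤ x₁ j ∧ pairTp (x₁ i) (x₁ j) n' = pairTp c d n')) := by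
    by_cases h : i < k ∧ j < k
    · obtain ⟨n', hn', x₁, h1, h2⟩ := hq.exists_avoiding (n + 1) k x h.1 h.2
      exact ⟨n', hn', x₁, h1, fun _ _ => h2⟩
    · refine ⟨n + 1, le_rfl, x, ?_, fun h1 h2 => (h ⟨h1, h2⟩).elim⟩
      refine (backForth_diagonal _).mono fun p hp => ?_
      obtain ⟨t, -, rfl⟩ := hp
      rfl
  obtain ⟨n', hn', x₁, h1, h2⟩ := avoid
  obtain ⟨F, hF, hw⟩ := exists_finite_witness n (E := x₁ '' Iio k) ((finite_Iio k).image x₁)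
  obtain ⟨l, hl⟩ : ∃ l : List X, ∀ b ∈ F, b ∈ l := ⟨hF.toFinset.toList, by simp⟩
  let x' : ℕ → X := fun t => if t < k then x₁ t else l.getD (t - k) (Classical.arbitrary X)
  have hx' : ∀ t < k, x' t = x₁ t := fun t ht => if_pos ht
  have hp : played k x x' = played k x x₁ := by
    ext p
    exact exists_congr fun t => and_congr_right fun ht => by rw [hx' t ht]
  refine ⟨⟨n', k + l.length + 1, x'⟩, ⟨Nat.lt_of_succ_le hn', by dsimp only; omega, ?_, ?_, ?_⟩⟩
  · dsimp only
    rw [hp]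
    have : Nonempty X := inferInstance
    exact h1.of_succ
  · intro a
    obtain ⟨b, hb⟩ := h1.1 a
    obtain ⟨e, he, hbe⟩ := hw b
    obtain ⟨t, ht, rfl⟩ := List.mem_iff_getElem.1 (hl e he)
    refine ⟨k + t, by dsimp only; omega, ?_⟩
    have : x' (k + t) = l[t] := by simp [x', List.getD_eq_getElem?_getD, ht]
    dsimp only
    rw [this, hp]
    refine hb.comp hbe ?_
    rintro p (rfl | ⟨t, ht, rfl⟩)
    · exact ⟨b, Or.inl rfl, Or.inl rfl⟩
    · exact ⟨x₁ t, Or.inr ⟨t, ht, rfl⟩, Or.inr ⟨rfl, t, ht, rfl⟩⟩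
  · intro hi hj
    dsimp only at hi hj ⊢
    rw [hx' i hi, hx' j hj]
    exact h2 hi hj

/-- An omitting types theorem for types of pairs. -/
theorem NonIsolated.exists_omitting {X : Type} [LinearOrder X] {c d : Y}
    (hq : NonIsolated X c d) : ∃ (Z : Type) (_ : LinearOrder Z), Countable Z ∧
      Th (univ : Set Z) = Th (univ : Set X) ∧ ∀ a b : Z, a ≤ b → pairTp a b ≠ pairTp c d := by
  have : Nonempty X := ⟨(hq 0).choose⟩
  choose step hstep using fun s => Approx.exists_step hq (Nat.unpair s).1 (Nat.unpair s).2
  let C : ℕ → Approx X := fun s =>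
    Nat.rec ⟨0, 1, fun _ => Classical.arbitrary X⟩ (fun s C => step s C) s
  have hC : ∀ s, Approx.Step c d (Nat.unpair s).1 (Nat.unpair s).2 (C s) (C (s + 1)) :=
    fun s => hstep s (C s)
  have rank_mono : StrictMono fun s => (C s).rank := strictMono_nat_of_lt_succ fun s => (hC s).rank_lt
  have size_mono : StrictMono fun s => (C s).size := strictMono_nat_of_lt_succ fun s => (hC s).size_lt
  have lt_size : ∀ s, s < (C s).size := by
    intro s
    induction s with
    | zero => exact Nat.one_pos
    | succ s ih => exact Nat.lt_of_le_of_lt ih (hC s).size_lt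
  have hle : ∀ {s t}, s ≤ t → BackForth (C s).rank (played (C s).size (C s).pt (C t).pt) := by
    intro s t hst
    induction t, hst using Nat.le_induction with
    | base =>
      refine (backForth_diagonal _).mono fun p hp => ?_
      obtain ⟨t, -, rfl⟩ := hp
      rfl
    | succ t hst ih =>
      refine ih.comp ((hC t).backForth.of_le (rank_mono.monotone hst)) ?_
      rintro p ⟨l, hl, rfl⟩
      exact ⟨_, mem_played hl _ _, mem_played (hl.trans_le (size_mono.monotone hst)) _ _⟩
  let G := Germ (hyperfilter ℕ : Filter ℕ) X
  let y : ℕ → G := fun i => ((fun s => (C s).pt i : ℕ → X) : G)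
  let Z := range y
  let z : ℕ → Z := fun i => ⟨y i, mem_range_self i⟩
  have hz : ∀ a : Z, ∃ i, a = z i := by
    rintro ⟨_, i, rfl⟩
    exact ⟨i, rfl⟩
  have lt_iff : ∀ {s i j}, i < (C s).size → j < (C s).size →
      (z i < z j ↔ (C s).pt i < (C s).pt j) := by
    intro s i j hi hj
    have ev : ∀ᶠ t in (hyperfilter ℕ : Filter ℕ),
        ((C t).pt i < (C t).pt j ↔ (C s).pt i < (C s).pt j) := by
      filter_upwards [Nat.hyperfilter_le_atTop (eventually_ge_atTop s)] with t ht
      exact ((hle ht).lt_iff (mem_played hi _ _) (mem_played hj _ _)).symm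
    change y i < y j ↔ _
    rw [show (y i < y j ↔ ∀ᶠ t in (hyperfilter ℕ : Filter ℕ), (C t).pt i < (C t).pt j) from
      Germ.coe_lt, eventually_congr ev]
    simp
  have main : ∀ n s, n ≤ (C s).rank → BackForth n (played (C s).size z (C s).pt) := by
    intro n
    induction n with
    | zero =>
      rintro s - _ ⟨i, hi, rfl⟩ _ ⟨j, hj, rfl⟩
      exact lt_iff hi hj
    | succ n ih =>
      intro s hs
      constructor
      · intro a
        obtain ⟨l, rfl⟩ := hz a
        obtain ⟨t, ht, hlt⟩ : ∃ t, s ≤ t ∧ l < (C t).size :=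
          ⟨max s (l + 1), le_max_left _ _, (Nat.lt_of_succ_le (le_max_right s (l + 1))).trans_le
            (size_mono.le_apply)⟩
        have h1 := ih t ((Nat.le_of_succ_le hs).trans (rank_mono.monotone ht))
        obtain ⟨a, ha⟩ := ((hle ht).of_le hs).2 ((C t).pt l)
        refine ⟨a, h1.comp ha.swap ?_⟩
        rintro p (rfl | ⟨i, hi, rfl⟩)
        · exact ⟨_, mem_played hlt _ _, Or.inl rfl⟩
        · exact ⟨_, mem_played (hi.trans_le (size_mono.monotone ht)) _ _,
            Or.inr (mem_played hi _ _)⟩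
      · intro a
        obtain ⟨l, hl, hb⟩ := (hC s).exists_witness a
        have h1 := ih (s + 1) ((Nat.le_of_succ_le hs).trans (hC s).rank_lt.le)
        refine ⟨z l, h1.comp (hb.of_le (Nat.le_of_succ_le hs)).swap ?_⟩
        rintro p (rfl | ⟨i, hi, rfl⟩)
        · exact ⟨_, mem_played hl _ _, Or.inl rfl⟩
        · exact ⟨_, mem_played (hi.trans (hC s).size_lt) _ _, Or.inr (mem_played hi _ _)⟩
  refine ⟨Z, inferInstance, (countable_range y).to_subtype, ?_, ?_⟩
  · exact Th_eq_iff.2 fun n => (main n n rank_mono.le_apply).tp_univ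
  · intro a b hab he
    obtain ⟨i, rfl⟩ := hz a
    obtain ⟨j, rfl⟩ := hz b
    let s := Nat.pair i j
    have hs := hC s
    rw [show (Nat.unpair s).1 = i by simp [s], show (Nat.unpair s).2 = j by simp [s] ] at hs
    have hi : i < (C s).size := (Nat.left_le_pair i j).trans_lt (lt_size s)
    have hj : j < (C s).size := (Nat.right_le_pair i j).trans_lt (lt_size s)
    have hi' := hi.trans hs.size_lt
    have hj' := hj.trans hs.size_lt
    refine hs.avoids hi hj ⟨not_lt.1 fun h => ?_, ?_⟩
    · exact not_lt.2 hab ((lt_iff (s := s + 1) hj' hi').2 h)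
    · rw [← he]
      exact ((main _ (s + 1) le_rfl).pairTp_eq (mem_played hi' _ _) (mem_played hj' _ _)).symm

end Omitting

section SumLex

variable {α β : Type*} [LinearOrder α] [LinearOrder β]

theorem strictMono_inlₗ : StrictMono (Sum.inlₗ : α → α ⊕ₗ β) := Sum.Lex.inl_strictMono

theorem strictMono_inrₗ : StrictMono (Sum.inrₗ : β → α ⊕ₗ β) := Sum.Lex.inr_strictMono

theorem sumLex_cases {α β : Type*} (z : α ⊕ₗ β) : (∃ a, z = Sum.inlₗ a) ∨ ∃ b, z = Sum.inrₗ b := by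
  rcases h : ofLex z with a | b
  · exact Or.inl ⟨a, h⟩
  · exact Or.inr ⟨b, h⟩

theorem inlₗ_lt_inrₗ (a : α) (b : β) : (Sum.inlₗ a : α ⊕ₗ β) < Sum.inrₗ b :=
  Sum.Lex.inl_lt_inr a b

theorem tp_image_inlₗ_union (n : ℕ) (s : Set α) (t : Set β) :
    tp n ((Sum.inlₗ '' s ∪ Sum.inrₗ '' t : Set (α ⊕ₗ β))) = tp n s + tp n t := by
  rw [tp_union n, tp_image n (strictMono_inlₗ.strictMonoOn _),
    tp_image n (strictMono_inrₗ.strictMonoOn _)]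
  rintro _ ⟨a, -, rfl⟩ _ ⟨b, -, rfl⟩
  exact inlₗ_lt_inrₗ a b

theorem sumLex_eq_image_union {α β : Type*} (s : Set (α ⊕ₗ β)) :
    s = Sum.inlₗ '' (Sum.inlₗ ⁻¹' s) ∪ Sum.inrₗ '' (Sum.inrₗ ⁻¹' s) := by
  ext z
  constructor
  · intro hz
    rcases sumLex_cases z with ⟨a, rfl⟩ | ⟨b, rfl⟩
    · exact Or.inl ⟨a, hz, rfl⟩
    · exact Or.inr ⟨b, hz, rfl⟩
  · rintro (⟨a, ha, rfl⟩ | ⟨b, hb, rfl⟩)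
    · exact ha
    · exact hb

theorem tp_sumLex (n : ℕ) (s : Set (α ⊕ₗ β)) :
    tp n s = tp n (Sum.inlₗ ⁻¹' s : Set α) + tp n (Sum.inrₗ ⁻¹' s : Set β) := by
  conv_lhs => rw [sumLex_eq_image_union s]
  exact tp_image_inlₗ_union n _ _

theorem tp_univ_sumLex (n : ℕ) :
    tp n (univ : Set (α ⊕ₗ β)) = tp n (univ : Set α) + tp n (univ : Set β) :=
  tp_sumLex n _

theorem Th_univ_sumLex :
    Th (univ : Set (α ⊕ₗ β)) = Th (univ : Set α) + Th (univ : Set β) :=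
  funext tp_univ_sumLex

theorem tp_Iio_inlₗ (n : ℕ) (a : α) : tp n (Iio (Sum.inlₗ a : α ⊕ₗ β)) = tp n (Iio a) := by
  rw [tp_sumLex]
  have h1 : (Sum.inlₗ ⁻¹' Iio (Sum.inlₗ a : α ⊕ₗ β)) = Iio a := by
    ext z; exact strictMono_inlₗ.lt_iff_lt
  have h2 : (Sum.inrₗ ⁻¹' Iio (Sum.inlₗ a : α ⊕ₗ β)) = (∅ : Set β) := by
    ext z; exact iff_of_false (inlₗ_lt_inrₗ a z).not_gt (by simp)
  rw [h1, h2, tp_empty, add_zero]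

theorem tp_Ioi_inlₗ (n : ℕ) (a : α) :
    tp n (Ioi (Sum.inlₗ a : α ⊕ₗ β)) = tp n (Ioi a) + tp n (univ : Set β) := by
  rw [tp_sumLex]
  have h1 : (Sum.inlₗ ⁻¹' Ioi (Sum.inlₗ a : α ⊕ₗ β)) = Ioi a := by
    ext z; exact strictMono_inlₗ.lt_iff_lt
  have h2 : (Sum.inrₗ ⁻¹' Ioi (Sum.inlₗ a : α ⊕ₗ β)) = (univ : Set β) := by
    ext z; exact iff_of_true (inlₗ_lt_inrₗ a z) trivial
  rw [h1, h2]

theorem tp_Iio_inrₗ (n : ℕ) (b : β) :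
    tp n (Iio (Sum.inrₗ b : α ⊕ₗ β)) = tp n (univ : Set α) + tp n (Iio b) := by
  rw [tp_sumLex]
  have h1 : (Sum.inlₗ ⁻¹' Iio (Sum.inrₗ b : α ⊕ₗ β)) = univ := by
    ext z; exact iff_of_true (inlₗ_lt_inrₗ z b) trivial
  have h2 : (Sum.inrₗ ⁻¹' Iio (Sum.inrₗ b : α ⊕ₗ β)) = Iio b := by
    ext z; exact strictMono_inrₗ.lt_iff_lt
  rw [h1, h2]

theorem tp_Ioi_inrₗ (n : ℕ) (b : β) : tp n (Ioi (Sum.inrₗ b : α ⊕ₗ β)) = tp n (Ioi b) := by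
  rw [tp_sumLex]
  have h1 : (Sum.inlₗ ⁻¹' Ioi (Sum.inrₗ b : α ⊕ₗ β)) = ∅ := by
    ext z; exact iff_of_false (inlₗ_lt_inrₗ z b).not_gt (by simp)
  have h2 : (Sum.inrₗ ⁻¹' Ioi (Sum.inrₗ b : α ⊕ₗ β)) = Ioi b := by
    ext z; exact strictMono_inrₗ.lt_iff_lt
  rw [h1, h2, tp_empty, zero_add]

theorem tp_Ioo_inlₗ (n : ℕ) (a a' : α) :
    tp n (Ioo (Sum.inlₗ a : α ⊕ₗ β) (Sum.inlₗ a')) = tp n (Ioo a a') := by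
  rw [tp_sumLex]
  have h1 : (Sum.inlₗ ⁻¹' Ioo (Sum.inlₗ a : α ⊕ₗ β) (Sum.inlₗ a')) = Ioo a a' := by
    ext z; exact and_congr strictMono_inlₗ.lt_iff_lt strictMono_inlₗ.lt_iff_lt
  have h2 : (Sum.inrₗ ⁻¹' Ioo (Sum.inlₗ a : α ⊕ₗ β) (Sum.inlₗ a')) = (∅ : Set β) := by
    ext z; exact iff_of_false (fun h => (inlₗ_lt_inrₗ a' z).not_gt h.2) (by simp)
  rw [h1, h2, tp_empty, add_zero]

theorem tp_Ioo_inrₗ (n : ℕ) (b b' : β) :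
    tp n (Ioo (Sum.inrₗ b : α ⊕ₗ β) (Sum.inrₗ b')) = tp n (Ioo b b') := by
  rw [tp_sumLex]
  have h1 : (Sum.inlₗ ⁻¹' Ioo (Sum.inrₗ b : α ⊕ₗ β) (Sum.inrₗ b')) = ∅ := by
    ext z; exact iff_of_false (fun h => (inlₗ_lt_inrₗ z b).not_gt h.1) (by simp)
  have h2 : (Sum.inrₗ ⁻¹' Ioo (Sum.inrₗ b : α ⊕ₗ β) (Sum.inrₗ b')) = Ioo b b' := by
    ext z; exact and_congr strictMono_inrₗ.lt_iff_lt strictMono_inrₗ.lt_iff_lt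
  rw [h1, h2, tp_empty, zero_add]

theorem tp_Ioo_inlₗ_inrₗ (n : ℕ) (a : α) (b : β) :
    tp n (Ioo (Sum.inlₗ a : α ⊕ₗ β) (Sum.inrₗ b)) = tp n (Ioi a) + tp n (Iio b) := by
  rw [tp_sumLex]
  have h1 : (Sum.inlₗ ⁻¹' Ioo (Sum.inlₗ a : α ⊕ₗ β) (Sum.inrₗ b)) = Ioi a := by
    ext z
    exact ⟨fun h => strictMono_inlₗ.lt_iff_lt.1 h.1,
      fun h => ⟨strictMono_inlₗ h, inlₗ_lt_inrₗ z b⟩⟩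
  have h2 : (Sum.inrₗ ⁻¹' Ioo (Sum.inlₗ a : α ⊕ₗ β) (Sum.inrₗ b)) = Iio b := by
    ext z
    exact ⟨fun h => strictMono_inrₗ.lt_iff_lt.1 h.2,
      fun h => ⟨inlₗ_lt_inrₗ a z, strictMono_inrₗ h⟩⟩
  rw [h1, h2]

end SumLex

section NonIsolated

variable {X : Type} [LinearOrder X]

theorem eventually_pairTp_eq_germ {ι : Type*} {U : Ultrafilter ι} (a b : ι → X) (n : ℕ) :
    ∀ᶠ i in U, pairTp (a i) (b i) n = pairTp (a : Germ (U : Filter ι) X) (b : Germ (U : Filter ι) X) n := by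
  have h1 := eventually_tp_eq_internalSet (U := U) n fun k => (univ ∩ Iio (a k) : Set X)
  have h2 := eventually_tp_eq_internalSet (U := U) n fun k => (univ ∩ Ioi (a k) : Set X)
  have h3 := eventually_tp_eq_internalSet (U := U) n fun k => (univ ∩ Iio (b k) : Set X)
  have h4 := eventually_tp_eq_internalSet (U := U) n fun k => (univ ∩ Ioi (b k) : Set X)
  have h5 := eventually_tp_eq_internalSet (U := U) n fun k => (univ ∩ Ioi (a k) ∩ Iio (b k) : Set X)
  rw [← internalSet_inter_Iio, internalSet_univ] at h1 h3
  rw [← internalSet_inter_Ioi, internalSet_univ] at h2 h4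
  rw [← internalSet_inter_Iio, ← internalSet_inter_Ioi, internalSet_univ] at h5
  simp only [univ_inter, Ioi_inter_Iio] at h1 h2 h3 h4 h5
  have h6 : ∀ᶠ k in U, (a k < b k ↔ (a : Germ (U : Filter ι) X) < b) := by
    by_cases h : (a : Germ (U : Filter ι) X) < b
    · filter_upwards [Germ.coe_lt.1 h] with k hk
      exact iff_of_true hk h
    · filter_upwards [Ultrafilter.eventually_not.2 fun h' => h (Germ.coe_lt.2 h')] with k hk
      exact iff_of_false hk h
  filter_upwards [h1, h2, h3, h4, h5, h6] with k e1 e2 e3 e4 e5 e6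
  exact pairTp_eq_iff.2 ⟨⟨e1, e2⟩, ⟨e3, e4⟩, e5, e6⟩

/-- The four kinds of pieces determined by a pair of points. -/
def pieceOf {Y : Type*} [LinearOrder Y] (a b : Y) : Fin 4 → Set Y
  | 0 => univ
  | 1 => Iio a
  | 2 => Ioi a
  | 3 => Ioo a b

theorem exists_eq_pieceOf [Nonempty X] {p : Set X} (h : Piece univ p) :
    ∃ a b κ, a ≤ b ∧ p = pieceOf a b κ := by
  rcases h.cases_endpoints with rfl | ⟨a, -, rfl⟩ | ⟨a, -, rfl⟩ | ⟨a, -, b, -, hab, rfl⟩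
  · exact ⟨Classical.arbitrary X, _, 0, le_rfl, rfl⟩
  · exact ⟨a, a, 1, le_rfl, univ_inter _⟩
  · exact ⟨a, a, 2, le_rfl, univ_inter _⟩
  · exact ⟨a, b, 3, hab.le, by rw [univ_inter, Ioi_inter_Iio]; rfl⟩

theorem tp_pieceOf_eq {Y Z : Type*} [LinearOrder Y] [LinearOrder Z] {n : ℕ} {a b : Y} {c d : Z}
    (h : pairTp a b n = pairTp c d n) (κ : Fin 4) :
    tp n (pieceOf a b κ) = tp n (pieceOf c d κ) := by
  rw [pairTp_eq_iff] at h
  match κ with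
  | 0 => rw [pieceOf, pieceOf, tp_univ_eq n a, tp_univ_eq n c, h.1.1, h.1.2]
  | 1 => exact h.1.1
  | 2 => exact h.1.2
  | 3 => exact h.2.2.1

theorem exists_nonIsolated (h : ¬ FinTh (univ : Set X)) :
    ∃ c d : Germ (hyperfilter ℕ : Filter ℕ) X, c ≤ d ∧ NonIsolated X c d := by
  have : Nonempty X := by
    by_contra hne
    rw [not_nonempty_iff] at hne
    exact h (by rw [univ_eq_empty_iff.2 hne]; exact FinTh.empty)
  simp only [FinTh, SepAt, not_exists, not_forall] at h
  choose p p' hp hp' htp hTh using h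
  choose a b κ hab e using fun n => exists_eq_pieceOf (hp n)
  choose a' b' κ' hab' e' using fun n => exists_eq_pieceOf (hp' n)
  by_contra hcon
  have iso : ∀ (a b : ℕ → X), (∀ n, a n ≤ b n) → ∀ᶠ i in (hyperfilter ℕ : Filter ℕ),
      pairTp (a i) (b i) = pairTp (a : Germ (hyperfilter ℕ : Filter ℕ) X)
        (b : Germ (hyperfilter ℕ : Filter ℕ) X) := by
    intro a b hab
    by_contra hne
    refine hcon ⟨a, b, Germ.coe_le.2 (Eventually.of_forall hab), fun n => ?_⟩
    obtain ⟨i, h1, h2⟩ := ((eventually_pairTp_eq_germ a b n).and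
      (Ultrafilter.eventually_not.2 hne)).exists
    exact ⟨a i, b i, hab i, h1, h2⟩
  obtain ⟨k, hk⟩ := (hyperfilter ℕ).exists_eventually_eq κ
  obtain ⟨k', hk'⟩ := (hyperfilter ℕ).exists_eventually_eq κ'
  have ev := ((iso a b hab).and (iso a' b' hab')).and (hk.and hk')
  have key : ∀ m, tp m (pieceOf (a : Germ (hyperfilter ℕ : Filter ℕ) X) b k) =
      tp m (pieceOf (a' : Germ (hyperfilter ℕ : Filter ℕ) X) b' k') := by
    intro m
    obtain ⟨i, ⟨⟨h1, h2⟩, h3, h4⟩, h5⟩ := (ev.and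
      (Nat.hyperfilter_le_atTop (eventually_ge_atTop m))).exists
    rw [← tp_pieceOf_eq (congr_fun h1 m), ← tp_pieceOf_eq (congr_fun h2 m), ← h3, ← h4, ← e, ← e']
    exact tp_eq_of_le h5 (htp i)
  obtain ⟨i, ⟨h1, h2⟩, h3, h4⟩ := ev.exists
  refine hTh i (Th_eq_iff.2 fun m => ?_)
  rw [e, e', h3, h4, tp_pieceOf_eq (congr_fun h1 m), tp_pieceOf_eq (congr_fun h2 m), key]

theorem exists_countable_pair {G : Type} [LinearOrder G] {c d : G} (hcd : c ≤ d) :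
    ∃ (Y : Type) (_ : LinearOrder Y), Countable Y ∧ Th (univ : Set Y) = Th (univ : Set G) ∧
      ∃ c' d' : Y, c' ≤ d' ∧ pairTp c' d' = pairTp c d := by
  obtain ⟨D, hD, hC, -, htp⟩ := exists_countable_tp_eq {(univ : Set G)} (countable_singleton _)
    (fun _ => ∅) (fun _ => countable_empty) (C := {c, d}) (by simp)
  have hc : c ∈ D := hC (by simp)
  have hd : d ∈ D := hC (by simp)
  have htp := fun n => htp n univ rfl
  refine ⟨D, inferInstance, hD.to_subtype, ?_, ⟨c, hc⟩, ⟨d, hd⟩, hcd, funext fun n => ?_⟩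
  · rw [Th_univ_subtype, Th_eq_iff]
    intro n
    simpa [cut] using htp n [] (by simp)
  have im : ∀ s : Set D, tp n s = tp n (Subtype.val '' s) := fun s => congr_fun (Th_subtype D s) n
  rw [pairTp_eq_iff, im, im, im, im, im]
  have i1 : ∀ x : D, Subtype.val '' (Iio x) = Iio x.1 ∩ D := fun x => by
    ext z
    exact ⟨fun ⟨w, hw, e⟩ => e ▸ ⟨hw, w.2⟩, fun h => ⟨⟨z, h.2⟩, h.1, rfl⟩⟩
  have i2 : ∀ x : D, Subtype.val '' (Ioi x) = Ioi x.1 ∩ D := fun x => by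
    ext z
    exact ⟨fun ⟨w, hw, e⟩ => e ▸ ⟨hw, w.2⟩, fun h => ⟨⟨z, h.2⟩, h.1, rfl⟩⟩
  rw [i1, i2, i1, i2, image_subtype_Ioo]
  refine ⟨⟨?_, ?_⟩, ⟨?_, ?_⟩, ?_, Iff.rfl⟩
  · simpa [cut] using htp n [(true, c)] (by simp [hc])
  · simpa [cut] using htp n [(false, c)] (by simp [hc])
  · simpa [cut] using htp n [(true, d)] (by simp [hd])
  · simpa [cut] using htp n [(false, d)] (by simp [hd])
  · simpa [cut, Ioi_inter_Iio, Iio_inter_Ioi, inter_comm D] using htp n [(true, d), (false, c)] (by simp [hc, hd])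

end NonIsolated

section NearClass

variable {X : Type*} [LinearOrder X]

/-- The points which are at no great distance from `c`. -/
def nearClass (c : X) : Set X := {z | ¬ Far c z ∧ ¬ Far z c}

theorem not_far_self (c : X) : ¬ Far c c := fun h => lt_irrefl _ h.1

theorem mem_nearClass_self (c : X) : c ∈ nearClass c := ⟨not_far_self c, not_far_self c⟩

theorem mem_nearClass_of_not_far {c d : X} (hcd : c ≤ d) (h : ¬ Far c d) : d ∈ nearClass c :=
  ⟨h, fun h' => hcd.not_gt h'.1⟩

theorem nearClass_not_far (hX : SelfAdditive X) {c u v : X} (hu : u ∈ nearClass c)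
    (hv : v ∈ nearClass c) : ¬ Far u v := by
  intro h
  rcases le_or_gt c u with hc | hc
  · exact hv.1 (h.mono hc le_rfl)
  rcases le_or_gt v c with hc' | hc'
  · exact hu.2 (h.mono le_rfl hc')
  · exact (h.or hX hc hc').elim hu.2 hv.1

theorem ordConnected_nearClass {c u v w : X} (hu : u ∈ nearClass c) (hv : v ∈ nearClass c)
    (huw : u ≤ w) (hwv : w ≤ v) : w ∈ nearClass c :=
  ⟨fun h => hv.1 (h.mono le_rfl hwv), fun h => hu.2 (h.mono huw le_rfl)⟩

theorem far_of_notMem_nearClass (hX : SelfAdditive X) {c u v : X} (hu : u ∈ nearClass c)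
    (hv : v ∉ nearClass c) : (u < v → Far u v) ∧ (v < u → Far v u) := by
  rw [nearClass, mem_ofPred_eq, not_and_or, not_not, not_not] at hv
  constructor
  · intro huv
    rcases hv with hv | hv
    · rcases le_or_gt u c with hc | hc
      · exact hv.mono hc le_rfl
      · exact (hv.or hX hc huv).resolve_left hu.1
    · exact (hu.2 (hv.mono huv.le le_rfl)).elim
  · intro hvu
    rcases hv with hv | hv
    · exact (hu.1 (hv.mono le_rfl hvu.le)).elim
    · rcases le_or_gt c u with hc | hc
      · exact hv.mono le_rfl hc
      · exact (hv.or hX hvu hc).resolve_right hu.2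

theorem nearClass_inter_Ioo {c u v : X} (hu : u ∈ nearClass c) (hv : v ∈ nearClass c) :
    nearClass c ∩ Ioo u v = Ioo u v :=
  inter_eq_right.2 fun _ h => ordConnected_nearClass hu hv h.1.le h.2.le

theorem SelfAdditive.nearClass_Ioi_add (hX : SelfAdditive X) {c : X} : ∀ (n : ℕ) {y : X},
    y ∈ nearClass c → tp n (nearClass c ∩ Ioi y) + tp n (univ : Set X) = tp n (Ioi y)
  | 0, _, _ => rfl
  | n + 1, y, hy => by
    apply ext_mem
    intro p q
    simp only [mem_add, trunc_tp, mem_tp_Ioi, mem_tp_univ]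
    have ih := fun {y} hy => hX.nearClass_Ioi_add (c := c) n (y := y) hy
    have absorb : ∀ x : X, tp n (nearClass c ∩ Ioi y) + tp n (Iio x) =
        tp n (Ioi y) + tp n (Iio x) := by
      intro x
      rw [← hX.univ_add_Iio n x, ← add_assoc, ih hy, ← add_assoc, hX.Ioi_add_univ]
    have cut : ∀ z ∈ nearClass c, y < z → tp n (nearClass c ∩ Ioi y ∩ Iio z) = tp n (Ioo y z) ∧
        tp n (nearClass c ∩ Ioi y ∩ Ioi z) = tp n (nearClass c ∩ Ioi z) := by
      intro z hz hyz
      rw [inter_assoc, Ioi_inter_Iio, nearClass_inter_Ioo hy hz, inter_assoc, Ioi_inter_Ioi,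
        max_eq_right hyz.le]
      exact ⟨rfl, rfl⟩
    constructor
    · rintro (⟨r, hr, rfl⟩ | ⟨r, ⟨x, rfl, rfl⟩, rfl⟩)
      · obtain ⟨z, hz, rfl, rfl⟩ := mem_tp.1 hr
        refine ⟨z, hz.2, (cut z hz.1 hz.2).1.symm, ?_⟩
        rw [(cut z hz.1 hz.2).2, ih hz.1]
      · rw [absorb]
        exact hX.right n y x
    · rintro ⟨z, hz, rfl, rfl⟩
      by_cases hzc : z ∈ nearClass c
      · refine Or.inl ⟨_, mem_tp.2 ⟨z, ⟨hzc, hz⟩, (cut z hzc hz).1, rfl⟩, ?_⟩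
        rw [(cut z hzc hz).2, ih hzc]
      · refine Or.inr ⟨_, ⟨z, rfl, rfl⟩, ?_⟩
        rw [absorb, ((far_of_notMem_nearClass hX hy hzc).1 hz).2]

theorem SelfAdditive.add_nearClass_Iio (hX : SelfAdditive X) {c : X} : ∀ (n : ℕ) {y : X},
    y ∈ nearClass c → tp n (univ : Set X) + tp n (nearClass c ∩ Iio y) = tp n (Iio y)
  | 0, _, _ => rfl
  | n + 1, y, hy => by
    apply ext_mem
    intro p q
    simp only [mem_add, trunc_tp, mem_tp_Iio, mem_tp_univ]
    have ih := fun {y} hy => hX.add_nearClass_Iio (c := c) n (y := y) hy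
    have absorb : ∀ x : X, tp n (Ioi x) + tp n (nearClass c ∩ Iio y) =
        tp n (Ioi x) + tp n (Iio y) := by
      intro x
      rw [← hX.Ioi_add_univ n x, add_assoc, ih hy, add_assoc, hX.univ_add_Iio]
    have cut : ∀ z ∈ nearClass c, z < y → tp n (nearClass c ∩ Iio y ∩ Ioi z) = tp n (Ioo z y) ∧
        tp n (nearClass c ∩ Iio y ∩ Iio z) = tp n (nearClass c ∩ Iio z) := by
      intro z hz hyz
      rw [inter_assoc, Iio_inter_Ioi, nearClass_inter_Ioo hz hy, inter_assoc, Iio_inter_Iio,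
        min_eq_right hyz.le]
      exact ⟨rfl, rfl⟩
    constructor
    · rintro (⟨r, ⟨x, rfl, rfl⟩, rfl⟩ | ⟨r, hr, rfl⟩)
      · rw [absorb]
        obtain ⟨z, h1, h2, h3⟩ := hX.left n x y
        exact ⟨z, h1, h3, h2⟩
      · obtain ⟨z, hz, rfl, rfl⟩ := mem_tp.1 hr
        refine ⟨z, hz.2, ?_, (cut z hz.1 hz.2).1.symm⟩
        rw [(cut z hz.1 hz.2).2, ih hz.1]
    · rintro ⟨z, hz, rfl, rfl⟩
      by_cases hzc : z ∈ nearClass c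
      · refine Or.inr ⟨_, mem_tp.2 ⟨z, ⟨hzc, hz⟩, rfl, (cut z hzc hz).1⟩, ?_⟩
        rw [(cut z hzc hz).2, ih hzc]
      · refine Or.inl ⟨_, ⟨z, rfl, rfl⟩, ?_⟩
        rw [absorb, ((far_of_notMem_nearClass hX hy hzc).2 hz).2]

theorem SelfAdditive.add_nearClass_add (hX : SelfAdditive X) (n : ℕ) (c : X) :
    tp n (univ : Set X) + tp n (nearClass c) + tp n (univ : Set X) = tp n (univ : Set X) := by
  have h : nearClass c = nearClass c ∩ Iio c ∪ ({c} ∪ nearClass c ∩ Ioi c) := by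
    ext z
    rcases lt_trichotomy z c with h | rfl | h
    · simp [h, h.ne, h.not_gt]
    · simp [mem_nearClass_self]
    · simp [h, h.ne', h.not_gt]
  have hpt : tp n {c} = tp n ({()} : Set Unit) := by
    rw [← tp_image (f := fun _ : Unit => c) n (by intro a _ b _ h; exact (lt_irrefl _ h).elim)]
    simp
  rw [h, tp_union n, tp_union n, hpt, ← add_assoc, hX.add_nearClass_Iio n (mem_nearClass_self c),
    add_assoc, add_assoc, hX.nearClass_Ioi_add n (mem_nearClass_self c), ← add_assoc, ← tp_univ_eq]
  · rintro _ rfl y hy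
    exact hy.2
  · rintro x hx y (rfl | hy)
    · exact hx.2
    · exact lt_trans hx.2 hy.2

end NearClass

/-- The points of an order which start a short interval with type in `P`. -/
def markedSet (Z : Type*) [LinearOrder Z]
    (P : Set (∀ n, (OrdTyp n × OrdTyp n) × (OrdTyp n × OrdTyp n) × OrdTyp n × Prop)) : Set Z :=
  {u | ∃ v, u ≤ v ∧ ¬ Far u v ∧ pairTp u v ∈ P}

section Marked

theorem exists_marked_of_near {X Y : Type} [LinearOrder X] [LinearOrder Y] [Countable X] [Countable Y]
    (hX : SelfAdditive X) (hXY : Th (univ : Set X) = Th (univ : Set Y)) {c d : Y} (hcd : c ≤ d)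
    (hnear : ¬ Far c d) (havoid : ∀ a b : X, a ≤ b → pairTp a b ≠ pairTp c d) :
    ∃ (Z : Type) (_ : LinearOrder Z), Countable Z ∧ Th (univ : Set Z) = Th (univ : Set X) ∧
      (markedSet Z {pairTp c d}).Nonempty ∧
      ∀ u ∈ markedSet Z {pairTp c d}, ∀ v ∈ markedSet Z {pairTp c d}, ¬ Far u v := by
  have hY := hX.transfer hXY
  have hu : ∀ n, tp n (univ : Set X) = tp n (univ : Set Y) := Th_eq_iff.1 hXY
  let C := nearClass c
  have im : ∀ n (s : Set C), tp n s = tp n (Subtype.val '' s) := fun n s =>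
    congr_fun (Th_subtype C s) n
  have iC : ∀ n, tp n (univ : Set C) = tp n C := fun n => by simp [im]
  have i1 : ∀ n (x : C), tp n (Iio x) = tp n (C ∩ Iio x.1) := fun n x => by
    rw [im]; congr 1; ext z
    exact ⟨fun ⟨w, hw, e⟩ => e ▸ ⟨w.2, hw⟩, fun h => ⟨⟨z, h.1⟩, h.2, rfl⟩⟩
  have i2 : ∀ n (x : C), tp n (Ioi x) = tp n (C ∩ Ioi x.1) := fun n x => by
    rw [im]; congr 1; ext z
    exact ⟨fun ⟨w, hw, e⟩ => e ▸ ⟨w.2, hw⟩, fun h => ⟨⟨z, h.1⟩, h.2, rfl⟩⟩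
  have i3 : ∀ n (x y : C), tp n (Ioo x y) = tp n (Ioo x.1 y.1) := fun n x y => by
    rw [im, image_subtype_Ioo, nearClass_inter_Ioo x.2 y.2]
  have mid : ∀ n, tp n (univ : Set X) + (tp n (univ : Set C) + tp n (univ : Set X)) =
      tp n (univ : Set X) := fun n => by
    rw [hu, iC, ← add_assoc, hY.add_nearClass_add]
  have right : ∀ n (x : C), tp n (Ioi x) + tp n (univ : Set X) = tp n (Ioi x.1) := fun n x => by
    rw [i2, hu, hY.nearClass_Ioi_add n x.2]
  have left : ∀ n (x : C), tp n (univ : Set X) + tp n (Iio x) = tp n (Iio x.1) := fun n x => by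
    rw [i1, hu, hY.add_nearClass_Iio n x.2]
  have absR : ∀ n (x : X), tp n (Ioi x) + (tp n (univ : Set C) + tp n (univ : Set X)) =
      tp n (Ioi x) := fun n x => by
    rw [← hX.Ioi_add_univ, add_assoc, mid]
  have absL : ∀ n (x : X), tp n (univ : Set X) + (tp n (univ : Set C) + tp n (Iio x)) =
      tp n (Iio x) := fun n x => by
    rw [← hX.univ_add_Iio, ← add_assoc (tp n (univ : Set C)), ← add_assoc, mid]
  let Z := X ⊕ₗ (C ⊕ₗ X)
  let f : X → Z := fun x => Sum.inlₗ x
  let g : C → Z := fun y => Sum.inrₗ (Sum.inlₗ y)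
  let h : X → Z := fun x => Sum.inrₗ (Sum.inrₗ x)
  have hZ : ∀ z : Z, (∃ x, z = f x) ∨ (∃ y, z = g y) ∨ ∃ x, z = h x := by
    intro z
    rcases sumLex_cases z with ⟨x, rfl⟩ | ⟨w, rfl⟩
    · exact Or.inl ⟨x, rfl⟩
    · rcases sumLex_cases w with ⟨y, rfl⟩ | ⟨x, rfl⟩
      · exact Or.inr (Or.inl ⟨y, rfl⟩)
      · exact Or.inr (Or.inr ⟨x, rfl⟩)
  have fI : ∀ n x, tp n (Iio (f x)) = tp n (Iio x) := fun n x => tp_Iio_inlₗ n x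
  have fJ : ∀ n x, tp n (Ioi (f x)) = tp n (Ioi x) := fun n x => by
    rw [tp_Ioi_inlₗ, tp_univ_sumLex, absR]
  have gI : ∀ n y, tp n (Iio (g y)) = tp n (Iio y.1) := fun n y => by
    rw [tp_Iio_inrₗ, tp_Iio_inlₗ, left]
  have gJ : ∀ n y, tp n (Ioi (g y)) = tp n (Ioi y.1) := fun n y => by
    rw [tp_Ioi_inrₗ, tp_Ioi_inlₗ, right]
  have hI : ∀ n x, tp n (Iio (h x)) = tp n (Iio x) := fun n x => by
    rw [tp_Iio_inrₗ, tp_Iio_inrₗ, absL]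
  have hJ : ∀ n x, tp n (Ioi (h x)) = tp n (Ioi x) := fun n x => by
    rw [tp_Ioi_inrₗ, tp_Ioi_inrₗ]
  have ff : ∀ x x', pairTp (f x) (f x') = pairTp x x' := fun x x' => funext fun n =>
    pairTp_eq_iff.2 ⟨⟨fI n x, fJ n x⟩, ⟨fI n x', fJ n x'⟩, tp_Ioo_inlₗ n x x',
      strictMono_inlₗ.lt_iff_lt⟩
  have gg : ∀ y y', pairTp (g y) (g y') = pairTp y.1 y'.1 := fun y y' => funext fun n =>
    pairTp_eq_iff.2 ⟨⟨gI n y, gJ n y⟩, ⟨gI n y', gJ n y'⟩,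
      by rw [tp_Ioo_inrₗ, tp_Ioo_inlₗ, i3],
      (strictMono_inrₗ.lt_iff_lt.trans strictMono_inlₗ.lt_iff_lt)⟩
  have hh : ∀ x x', pairTp (h x) (h x') = pairTp x x' := fun x x' => funext fun n =>
    pairTp_eq_iff.2 ⟨⟨hI n x, hJ n x⟩, ⟨hI n x', hJ n x'⟩, by rw [tp_Ioo_inrₗ, tp_Ioo_inrₗ],
      strictMono_inrₗ.lt_iff_lt.trans strictMono_inrₗ.lt_iff_lt⟩
  have fg : ∀ x y, Far (f x) (g y) := fun x y => ⟨inlₗ_lt_inrₗ _ _, fun n => by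
    rw [tp_Ioo_inlₗ_inrₗ, fJ, gI, tp_Iio_inlₗ, ← left, ← add_assoc, hX.Ioi_add_univ]⟩
  have fh : ∀ x x', Far (f x) (h x') := fun x x' => ⟨inlₗ_lt_inrₗ _ _, fun n => by
    rw [tp_Ioo_inlₗ_inrₗ, fJ, hI, tp_Iio_inrₗ]
    conv_rhs => rw [← absL n x', ← add_assoc, hX.Ioi_add_univ]⟩
  have gh : ∀ y x, Far (g y) (h x) := fun y x => ⟨strictMono_inrₗ (inlₗ_lt_inrₗ _ _), fun n => by
    rw [tp_Ioo_inrₗ, tp_Ioo_inlₗ_inrₗ, gJ, hI, ← right, add_assoc, hX.univ_add_Iio]⟩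
  have marked : ∀ u ∈ markedSet Z {pairTp c d}, ∃ y, u = g y := by
    rintro u ⟨v, huv, hfar, hp⟩
    rcases hZ u with ⟨x, rfl⟩ | hy | ⟨x, rfl⟩
    · rcases hZ v with ⟨x', rfl⟩ | ⟨y, rfl⟩ | ⟨x', rfl⟩
      · exact (havoid x x' (strictMono_inlₗ.le_iff_le.1 huv) ((ff x x').symm.trans hp)).elim
      · exact (hfar (fg x y)).elim
      · exact (hfar (fh x x')).elim
    · exact hy
    · rcases hZ v with ⟨x', rfl⟩ | ⟨y, rfl⟩ | ⟨x', rfl⟩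
      · exact (huv.not_gt (fh x' x).1).elim
      · exact (huv.not_gt (gh y x).1).elim
      · exact (havoid x x' (strictMono_inrₗ.le_iff_le.1 (strictMono_inrₗ.le_iff_le.1 huv))
          ((hh x x').symm.trans hp)).elim
  refine ⟨Z, inferInstance, ?_, ?_, ?_, ?_⟩
  · have : Countable C := inferInstance
    exact inferInstanceAs (Countable (X ⊕ (C ⊕ X)))
  · refine Th_eq_iff.2 fun n => ?_
    rw [tp_univ_sumLex, tp_univ_sumLex, mid]
  · let c' : C := ⟨c, mem_nearClass_self c⟩
    let d' : C := ⟨d, mem_nearClass_of_not_far hcd hnear⟩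
    have hp : pairTp (g c') (g d') = pairTp c d := gg c' d'
    refine ⟨g c', g d', ?_, ?_, hp⟩
    · exact strictMono_inrₗ.monotone (strictMono_inlₗ.monotone hcd)
    · rwa [far_iff_of_pairTp_eq hp]
  · intro u hu' v hv'
    obtain ⟨y, rfl⟩ := marked u hu'
    obtain ⟨y', rfl⟩ := marked v hv'
    rw [far_iff_of_pairTp_eq (gg y y')]
    exact nearClass_not_far hY y.2 y'.2

theorem exists_marked {X : Type} [LinearOrder X] (hX : SelfAdditive X)
    (h : ¬ FinTh (univ : Set X)) :
    ∃ (Z : Type) (_ : LinearOrder Z), Countable Z ∧ Th (univ : Set Z) = Th (univ : Set X) ∧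
      ∃ P, (markedSet Z P).Nonempty ∧ ∀ u ∈ markedSet Z P, ∀ v ∈ markedSet Z P, ¬ Far u v := by
  obtain ⟨c, d, hcd, hq⟩ := exists_nonIsolated h
  have hG : ∀ n, tp n (univ : Set (Germ (hyperfilter ℕ : Filter ℕ) X)) = tp n (univ : Set X) :=
    tp_univ_germ
  have near : ∀ c d : Germ (hyperfilter ℕ : Filter ℕ) X, c ≤ d → NonIsolated X c d → ¬ Far c d →
      ∃ (Z : Type) (_ : LinearOrder Z), Countable Z ∧ Th (univ : Set Z) = Th (univ : Set X) ∧
      ∃ P, (markedSet Z P).Nonempty ∧ ∀ u ∈ markedSet Z P, ∀ v ∈ markedSet Z P, ¬ Far u v := by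
    intro c d hcd hq hnear
    obtain ⟨X₁, _, hc1, hTh1, havoid⟩ := hq.exists_omitting
    obtain ⟨Y, _, hcY, hThY, c', d', hcd', hp⟩ := exists_countable_pair hcd
    have hY : Th (univ : Set X₁) = Th (univ : Set Y) := by
      rw [hTh1, hThY]
      exact (Th_eq_iff.2 hG).symm
    rw [← hp] at havoid
    rw [← far_iff_of_pairTp_eq hp] at hnear
    obtain ⟨Z, _, h1, h2, h3, h4⟩ := exists_marked_of_near (hX.transfer hTh1.symm) hY hcd' hnear havoid
    exact ⟨Z, _, h1, h2.trans hTh1, _, h3, h4⟩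
  by_cases hfar : Far c d
  swap
  · exact near c d hcd hq hfar
  by_cases hc : NonIsolated X c c
  · exact near c c le_rfl hc (not_far_self c)
  by_cases hd : NonIsolated X d d
  · exact near d d le_rfl hd (not_far_self d)
  obtain ⟨X₁, _, hc1, hTh1, havoid⟩ := hq.exists_omitting
  have hX₁ := hX.transfer hTh1.symm
  have hTh1' := Th_eq_iff.1 hTh1
  have iso : ∀ e : Germ (hyperfilter ℕ : Filter ℕ) X, ¬ NonIsolated X e e → ∃ n, ∀ a : X₁,
      tp n (Iio a) = tp n (Iio e) → tp n (Ioi a) = tp n (Ioi e) → pairTp a a = pairTp e e := by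
    intro e he
    simp only [NonIsolated, not_forall, not_exists, not_and, not_not] at he
    obtain ⟨n, hn⟩ := he
    refine ⟨n, fun a h1 h2 => funext fun m => ?_⟩
    obtain ⟨x, hx1, hx2⟩ := exists_tp_point (hTh1' (max m n + 1)) a
    have hx : pairTp x x (max m n) = pairTp a a (max m n) := by
      simp [pairTp, hx1, hx2]
    have : pairTp a a n = pairTp e e n := by simp [pairTp, h1, h2]
    rw [← pairTp_eq_of_le (le_max_left m n) hx,
      hn x x le_rfl ((pairTp_eq_of_le (le_max_right m n) hx).trans this)]
  obtain ⟨n, hn⟩ := iso c hc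
  obtain ⟨m, hm⟩ := iso d hd
  refine ⟨X₁, _, hc1, hTh1, univ, ?_, ?_⟩
  · obtain ⟨x, -⟩ := exists_tp_point ((hG 1).trans (hTh1' 1).symm) c
    exact ⟨x, x, le_rfl, not_far_self x, trivial⟩
  · rintro e - f - hef
    obtain ⟨a₀, h1, h2⟩ := exists_tp_point ((hG (n + 1)).trans (hTh1' (n + 1)).symm) c
    obtain ⟨b₀, h3, h4⟩ := exists_tp_point ((hG (m + 1)).trans (hTh1' (m + 1)).symm) d
    obtain ⟨a, hae, ha1, ha2⟩ := hX₁.left n a₀ e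
    obtain ⟨b, hfb, hb1, hb2⟩ := hX₁.right m f b₀
    have ha3 : tp n (Ioi a) = tp n (Ioi a₀) := by
      rw [tp_Ioi_eq_add n hae, ha1, tp_Ici_eq_pt_add, add_assoc, ← add_assoc (tp n (Iio e)),
        ← tp_univ_eq, hX₁.Ioi_add_univ]
    have hb3 : tp m (Iio b) = tp m (Iio b₀) := by
      rw [tp_Iio_eq_add m hfb.le, tp_Ico_eq_pt_add m hfb, hb1, ← add_assoc, ← add_assoc,
        ← tp_univ_eq, hX₁.univ_add_Iio]
    have hpa := fun k => pairTp_eq_iff.1 (congr_fun (hn a (ha2.trans h1) (ha3.trans h2)) k)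
    have hpb := fun k => pairTp_eq_iff.1 (congr_fun (hm b (hb3.trans h3) (hb2.trans h4)) k)
    have hab : Far a b := hef.mono hae.le hfb.le
    refine havoid a b hab.1.le (funext fun k => pairTp_eq_iff.2 ⟨(hpa k).1, (hpb k).1, ?_, ?_⟩)
    · rw [hab.2, hfar.2, (hpa k).1.2, (hpb k).1.1]
    · exact iff_of_true hab.1 hfar.1

end Marked

theorem nonempty_orderIso_of_rel {A B : Type*} [LinearOrder A] [LinearOrder B] (r : A → B → Prop)
    (h1 : ∀ a, ∃ b, r a b) (h2 : ∀ b, ∃ a, r a b)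
    (h3 : ∀ a b a' b', r a b → r a' b' → (a < a' ↔ b < b')) : Nonempty (A ≃o B) := by
  choose f hf using h1
  have hmono : StrictMono f := fun a a' h => (h3 _ _ _ _ (hf a) (hf a')).1 h
  refine ⟨hmono.orderIsoOfSurjective f fun b => ?_⟩
  obtain ⟨a, ha⟩ := h2 b
  refine ⟨a, le_antisymm (not_lt.1 fun h => ?_) (not_lt.1 fun h => ?_)⟩
  · exact lt_irrefl _ ((h3 _ _ _ _ ha (hf a)).2 h)
  · exact lt_irrefl _ ((h3 _ _ _ _ (hf a) ha).2 h)

section Blocks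

/-- The rational unit interval, with the point `1 / (n + 2)` replaced by a chain of `n + 2` points
for every `n ∈ S`. -/
def blockSet (S : Set ℕ) : Set (ℚ ×ₗ ℕ) :=
  {p | (0 ≤ (ofLex p).1 ∧ (ofLex p).1 ≤ 1) ∧
    ((ofLex p).2 = 0 ∨ ∃ n ∈ S, (ofLex p).1 = 1 / (n + 2) ∧ (ofLex p).2 ≤ n + 1)}

/-- An order has a block with `n` inner points if it has two points which have exactly `n` points
in between and which are not close to points on the outside. -/
def HasBlock (A : Type*) [LinearOrder A] (n : ℕ) : Prop :=
  ∃ a b : A, a < b ∧ (Ioo a b).Finite ∧ (Ioo a b).ncard = n ∧ (∀ c < a, (Ioo c a).Infinite) ∧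
    ∀ c > b, (Ioo b c).Infinite

theorem HasBlock.map {A B : Type*} [LinearOrder A] [LinearOrder B] (f : A ≃o B) {n : ℕ}
    (h : HasBlock A n) : HasBlock B n := by
  obtain ⟨a, b, hab, hfin, hn, ha, hb⟩ := h
  refine ⟨f a, f b, f.lt_iff_lt.2 hab, ?_, ?_, fun c hc => ?_, fun c hc => ?_⟩
  · rw [← f.image_Ioo]
    exact hfin.image f
  · rw [← f.image_Ioo, ncard_image_of_injective _ f.injective, hn]
  · obtain ⟨c, rfl⟩ := f.surjective c
    rw [← f.image_Ioo]
    exact (ha c (f.lt_iff_lt.1 hc)).image f.injective.injOn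
  · obtain ⟨c, rfl⟩ := f.surjective c
    rw [← f.image_Ioo]
    exact (hb c (f.lt_iff_lt.1 hc)).image f.injective.injOn

theorem blockSet_Ioo_infinite {S : Set ℕ} {a b : blockSet S}
    (h : (ofLex a.1).1 < (ofLex b.1).1) : (Ioo a b).Infinite := by
  have hinf : (Ioo (ofLex a.1).1 (ofLex b.1).1).Infinite := Ioo_infinite h
  have : Infinite (Ioo (ofLex a.1).1 (ofLex b.1).1) := hinf.to_subtype
  let g : Ioo (ofLex a.1).1 (ofLex b.1).1 → blockSet S := fun x =>
    ⟨toLex (x.1, 0), ⟨a.2.1.1.trans x.2.1.le, x.2.2.le.trans b.2.1.2⟩, Or.inl rfl⟩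
  refine (infinite_range_of_injective (f := g) fun x y hxy => ?_).mono ?_
  · have := congr_arg (fun z : blockSet S => (ofLex z.1).1) hxy
    exact Subtype.ext this
  · rintro _ ⟨x, rfl⟩
    exact ⟨Prod.Lex.lt_iff.2 (Or.inl x.2.1), Prod.Lex.lt_iff.2 (Or.inl x.2.2)⟩

theorem blockSet_Ioo_eq {S : Set ℕ} {n : ℕ} (hn : n ∈ S) {a b : blockSet S}
    (ha : a.1 = toLex (1 / ((n : ℚ) + 2), 0)) (hb : b.1 = toLex (1 / ((n : ℚ) + 2), n + 1)) :
    (Ioo a b).Finite ∧ (Ioo a b).ncard = n := by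
  have hpos : 0 ≤ 1 / ((n : ℚ) + 2) ∧ 1 / ((n : ℚ) + 2) ≤ 1 := by
    refine ⟨by positivity, ?_⟩
    rw [div_le_one (by positivity)]
    linarith [(Nat.cast_nonneg n : (0 : ℚ) ≤ n)]
  have : Subtype.val '' Ioo a b = (fun k => toLex (1 / ((n : ℚ) + 2), k)) '' (Ioo 0 (n + 1)) := by
    ext p
    induction p with | _ p
    obtain ⟨x, k⟩ := p
    constructor
    · rintro ⟨c, ⟨h1, h2⟩, hc⟩
      have h1' : a.1 < c.1 := h1
      have h2' : c.1 < b.1 := h2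
      rw [ha, hc, Prod.Lex.toLex_lt_toLex] at h1'
      rw [hb, hc, Prod.Lex.toLex_lt_toLex] at h2'
      simp only at h1' h2'
      rcases h1' with h1' | ⟨rfl, h1'⟩
      · rcases h2' with h2' | ⟨rfl, h2'⟩
        · exact (lt_asymm h1' h2').elim
        · exact (lt_irrefl _ h1').elim
      · rcases h2' with h2' | ⟨-, h2'⟩
        · exact (lt_irrefl _ h2').elim
        · exact ⟨k, ⟨h1', h2'⟩, rfl⟩
    · rintro ⟨k', ⟨h1, h2⟩, hk⟩
      obtain ⟨rfl, rfl⟩ := Prod.mk_inj.1 (toLex_inj.1 hk)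
      refine ⟨⟨toLex (1 / ((n : ℚ) + 2), k'), hpos, Or.inr ⟨n, hn, rfl, h2.le⟩⟩, ⟨?_, ?_⟩, rfl⟩
      · change a.1 < _
        rw [ha, Prod.Lex.toLex_lt_toLex]
        exact Or.inr ⟨rfl, h1⟩
      · change _ < b.1
        rw [hb, Prod.Lex.toLex_lt_toLex]
        exact Or.inr ⟨rfl, h2⟩
  have hinj : Function.Injective fun k : ℕ => toLex (1 / ((n : ℚ) + 2), k) := fun k l h =>
    (Prod.mk_inj.1 (toLex_inj.1 h)).2
  constructor
  · refine Finite.of_finite_image ?_ Subtype.val_injective.injOn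
    rw [this]
    exact (finite_Ioo 0 (n + 1)).image _
  · rw [← ncard_image_of_injective _ Subtype.val_injective, this, ncard_image_of_injective _ hinj,
      ← Finset.coe_Ioo, ncard_coe_finset, Nat.card_Ioo]
    omega

theorem hasBlock_blockSet_iff {S : Set ℕ} {n : ℕ} : HasBlock (blockSet S) n ↔ n ∈ S := by
  have hpos : ∀ n : ℕ, 0 ≤ 1 / ((n : ℚ) + 2) ∧ 1 / ((n : ℚ) + 2) ≤ 1 := by
    intro n
    refine ⟨by positivity, ?_⟩
    rw [div_le_one (by positivity)]
    linarith [(Nat.cast_nonneg n : (0 : ℚ) ≤ n)]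
  have hinj : ∀ m n : ℕ, 1 / ((m : ℚ) + 2) = 1 / ((n : ℚ) + 2) → m = n := by
    intro m n h
    rw [one_div, one_div, inv_inj, add_left_inj, Nat.cast_inj] at h
    exact h
  let first : ∀ n ∈ S, blockSet S := fun n hn =>
    ⟨toLex (1 / ((n : ℚ) + 2), 0), hpos n, Or.inl rfl⟩
  let last : ∀ n ∈ S, blockSet S := fun n hn =>
    ⟨toLex (1 / ((n : ℚ) + 2), n + 1), hpos n, Or.inr ⟨n, hn, rfl, le_rfl⟩⟩
  constructor
  · rintro ⟨a, b, hab, hfin, hcard, hlow, hup⟩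
    have h1 : (ofLex a.1).1 = (ofLex b.1).1 := by
      rcases Prod.Lex.lt_iff.1 (show a.1 < b.1 from hab) with h | h
      · exact (blockSet_Ioo_infinite h hfin).elim
      · exact h.1
    have h2 : (ofLex a.1).2 < (ofLex b.1).2 := by
      rcases Prod.Lex.lt_iff.1 (show a.1 < b.1 from hab) with h | h
      · exact (h.ne h1).elim
      · exact h.2
    obtain ⟨m, hm, hbm, hbm'⟩ := b.2.2.resolve_left (by omega)
    obtain ⟨hf, hc⟩ := blockSet_Ioo_eq hm (a := first m hm) (b := last m hm) rfl rfl
    have hale : first m hm ≤ a := by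
      change (first m hm).1 ≤ a.1
      rw [Prod.Lex.le_iff]
      exact Or.inr ⟨(h1.trans hbm).symm, Nat.zero_le _⟩
    have hble : b ≤ last m hm := by
      change b.1 ≤ (last m hm).1
      rw [Prod.Lex.le_iff]
      exact Or.inr ⟨hbm, hbm'⟩
    have ha : first m hm = a := by
      by_contra hne
      refine hlow _ (lt_of_le_of_ne hale hne) (hf.subset ?_)
      exact Ioo_subset_Ioo_right (hab.le.trans hble)
    have hb : b = last m hm := by
      by_contra hne
      refine hup _ (lt_of_le_of_ne hble hne) (hf.subset ?_)
      exact Ioo_subset_Ioo_left (hale.trans hab.le)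
    rw [← ha, hb, hc] at hcard
    exact hcard ▸ hm
  · intro hn
    obtain ⟨hf, hc⟩ := blockSet_Ioo_eq hn (a := first n hn) (b := last n hn) rfl rfl
    refine ⟨first n hn, last n hn, ?_, hf, hc, fun c hcl => ?_, fun c hcl => ?_⟩
    · change (first n hn).1 < (last n hn).1
      exact Prod.Lex.lt_iff.2 (Or.inr ⟨rfl, Nat.succ_pos n⟩)
    · rcases Prod.Lex.lt_iff.1 (show c.1 < (first n hn).1 from hcl) with h | h
      · exact blockSet_Ioo_infinite h
      · exact (Nat.not_lt_zero _ h.2).elim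
    · rcases Prod.Lex.lt_iff.1 (show (last n hn).1 < c.1 from hcl) with h | ⟨h, h'⟩
      · exact blockSet_Ioo_infinite h
      · rcases c.2.2 with h0 | ⟨m, hm, h3, h4⟩
        · rw [h0] at h'
          exact (Nat.not_lt_zero _ h').elim
        · rw [← h] at h3
          have hnm := hinj n m h3
          subst hnm
          exact (h4.not_gt h').elim

theorem eq_of_blockSet_orderIso {S S' : Set ℕ} (f : blockSet S ≃o blockSet S') : S = S' := by
  ext n
  rw [← hasBlock_blockSet_iff, ← hasBlock_blockSet_iff]
  exact ⟨fun h => h.map f, fun h => h.map f.symm⟩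

end Blocks

section Recover

variable {I I' Z : Type} [LinearOrder I] [LinearOrder I'] [LinearOrder Z]

theorem toLex_mem_markedSet (hZ : SelfAdditive Z) {P} {i : I} {z : Z} :
    (toLex (i, z) : I ×ₗ Z) ∈ markedSet (I ×ₗ Z) P ↔ z ∈ markedSet Z P := by
  constructor
  · rintro ⟨v, hle, hfar, hp⟩
    induction v with | _ v
    obtain ⟨k, y⟩ := v
    rcases Prod.Lex.toLex_le_toLex.1 hle with h | ⟨h, h'⟩
    · exact (hfar (hZ.far_lex h z y)).elim
    · simp only at h h'
      subst h
      exact ⟨y, h', (far_iff_of_pairTp_eq (hZ.pairTp_lex i z y)).not.1 hfar,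
        hZ.pairTp_lex i z y ▸ hp⟩
  · rintro ⟨y, hle, hfar, hp⟩
    refine ⟨toLex (i, y), Prod.Lex.toLex_le_toLex.2 (Or.inr ⟨rfl, hle⟩), ?_, ?_⟩
    · exact (far_iff_of_pairTp_eq (hZ.pairTp_lex i z y)).not.2 hfar
    · rwa [hZ.pairTp_lex]

theorem far_lex_iff (hZ : SelfAdditive Z) {P}
    (hP : ∀ u ∈ markedSet Z P, ∀ v ∈ markedSet Z P, ¬ Far u v) {i k : I} {z y : Z}
    (hz : z ∈ markedSet Z P) (hy : y ∈ markedSet Z P) :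
    Far (toLex (i, z) : I ×ₗ Z) (toLex (k, y)) ↔ i < k := by
  refine ⟨fun h => ?_, fun h => hZ.far_lex h z y⟩
  rcases Prod.Lex.toLex_lt_toLex.1 h.1 with h' | ⟨h', -⟩
  · exact h'
  · simp only at h'
    subst h'
    exact (hP z hz y hy ((far_iff_of_pairTp_eq (hZ.pairTp_lex i z y)).1 h)).elim

theorem nonempty_orderIso_of_lex (hZ : SelfAdditive Z) {P} (hne : (markedSet Z P).Nonempty)
    (hP : ∀ u ∈ markedSet Z P, ∀ v ∈ markedSet Z P, ¬ Far u v) (f : I ×ₗ Z ≃o I' ×ₗ Z) :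
    Nonempty (I ≃o I') := by
  obtain ⟨z₀, hz₀⟩ := hne
  have hmap : ∀ {A B : Type} [LinearOrder A] [LinearOrder B] (g : A ≃o B) (u : A),
      u ∈ markedSet A P → g u ∈ markedSet B P := by
    rintro A B _ _ g u ⟨v, h1, h2, h3⟩
    refine ⟨g v, g.monotone h1, ?_, ?_⟩
    · rwa [far_iff_of_pairTp_eq (pairTp_map g u v)]
    · rwa [pairTp_map]
  refine nonempty_orderIso_of_rel (fun i i' => ∃ z ∈ markedSet Z P, ∃ z' ∈ markedSet Z P,
    f (toLex (i, z)) = toLex (i', z')) (fun i => ?_) (fun i' => ?_) ?_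
  · have := hmap f _ ((toLex_mem_markedSet hZ (i := i)).2 hz₀)
    exact ⟨(ofLex (f (toLex (i, z₀)))).1, z₀, hz₀, (ofLex (f (toLex (i, z₀)))).2,
      (toLex_mem_markedSet hZ).1 this, rfl⟩
  · have := hmap f.symm _ ((toLex_mem_markedSet hZ (i := i')).2 hz₀)
    refine ⟨(ofLex (f.symm (toLex (i', z₀)))).1, (ofLex (f.symm (toLex (i', z₀)))).2,
      (toLex_mem_markedSet hZ).1 this, z₀, hz₀, ?_⟩
    exact f.apply_symm_apply _
  · rintro i i' k k' ⟨z, hz, z', hz', h⟩ ⟨y, hy, y', hy', h'⟩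
    rw [← far_lex_iff hZ hP hz hy, ← far_lex_iff hZ hP hz' hy', ← h, ← h',
      far_iff_of_pairTp_eq (pairTp_map f _ _)]

theorem nonempty_lex_orderIso {N N' : Type*} [LinearOrder N] [LinearOrder N']
    {e : I ×ₗ Z → N} {e' : I' ×ₗ Z → N'} (he : StrictMono e) (he' : StrictMono e')
    (hc : ∀ a b, ∀ x ∈ Ioo (e a) (e b), x ∈ range e)
    (hc' : ∀ a b, ∀ x ∈ Ioo (e' a) (e' b), x ∈ range e')
    {i j : I} {i' j' : I'} (hi : ∀ k, i ≤ k) (hj : ∀ k, k ≤ j) (hij : i < j)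
    (hi' : ∀ k, i' ≤ k) (hj' : ∀ k, k ≤ j') (hij' : i' < j') (z y : Z) {f : N → N'}
    (hf : BijOn f (Ioo (e (toLex (i, z))) (e (toLex (j, y))))
      (Ioo (e' (toLex (i', z))) (e' (toLex (j', y)))))
    (hmono : StrictMonoOn f (Ioo (e (toLex (i, z))) (e (toLex (j, y))))) :
    Nonempty (I ×ₗ Z ≃o I' ×ₗ Z) := by
  set l := (toLex (i, z) : I ×ₗ Z)
  set r := (toLex (j, y) : I ×ₗ Z)
  set l' := (toLex (i', z) : I' ×ₗ Z)
  set r' := (toLex (j', y) : I' ×ₗ Z)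
  have hlr : l < r := Prod.Lex.toLex_lt_toLex.2 (Or.inl hij)
  have hlr' : l' < r' := Prod.Lex.toLex_lt_toLex.2 (Or.inl hij')
  have low : ∀ {K : Type} [LinearOrder K] {k : K}, (∀ m, k ≤ m) → ∀ {p : K ×ₗ Z},
      p ≤ toLex (k, z) → ∃ x ≤ z, p = toLex (k, x) := by
    intro K _ k hk p hp
    induction p with | _ p
    obtain ⟨m, x⟩ := p
    rcases Prod.Lex.toLex_le_toLex.1 hp with h | ⟨h, h'⟩
    · exact ((hk m).not_gt h).elim
    · exact ⟨x, h', by rw [show m = k from h]⟩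
  have high : ∀ {K : Type} [LinearOrder K] {k : K}, (∀ m, m ≤ k) → ∀ {p : K ×ₗ Z},
      toLex (k, y) ≤ p → ∃ x, y ≤ x ∧ p = toLex (k, x) := by
    intro K _ k hk p hp
    induction p with | _ p
    obtain ⟨m, x⟩ := p
    rcases Prod.Lex.toLex_le_toLex.1 hp with h | ⟨h, h'⟩
    · exact ((hk m).not_gt h).elim
    · exact ⟨x, h', by rw [show m = k from h.symm]⟩
  have lt_same : ∀ {K : Type} [LinearOrder K] (k : K) (u v : Z),
      (toLex (k, u) : K ×ₗ Z) < toLex (k, v) ↔ u < v := fun k u v =>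
    (strictMono_toLex k).lt_iff_lt
  have le_same : ∀ {K : Type} [LinearOrder K] (k : K) (u v : Z),
      (toLex (k, u) : K ×ₗ Z) ≤ toLex (k, v) ↔ u ≤ v := fun k u v =>
    (strictMono_toLex k).le_iff_le
  let ρ : I ×ₗ Z → I' ×ₗ Z → Prop := fun p p' =>
    (∃ x ≤ z, p = toLex (i, x) ∧ p' = toLex (i', x)) ∨
    (p ∈ Ioo l r ∧ p' ∈ Ioo l' r' ∧ f (e p) = e' p') ∨
    (∃ x, y ≤ x ∧ p = toLex (j, x) ∧ p' = toLex (j', x))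
  have memI : ∀ {p}, e p ∈ Ioo (e l) (e r) ↔ p ∈ Ioo l r := by
    intro p; simp [he.lt_iff_lt]
  have memI' : ∀ {p}, e' p ∈ Ioo (e' l') (e' r') ↔ p ∈ Ioo l' r' := by
    intro p; simp [he'.lt_iff_lt]
  refine nonempty_orderIso_of_rel ρ (fun p => ?_) (fun p' => ?_) ?_
  · rcases le_or_gt p l with h | h
    · obtain ⟨x, hx, rfl⟩ := low hi h
      exact ⟨_, Or.inl ⟨x, hx, rfl, rfl⟩⟩
    rcases le_or_gt r p with h' | h'
    · obtain ⟨x, hx, rfl⟩ := high hj h'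
      exact ⟨_, Or.inr (Or.inr ⟨x, hx, rfl, rfl⟩)⟩
    have := hf.mapsTo (memI.2 ⟨h, h'⟩)
    obtain ⟨p', hp'⟩ := hc' _ _ _ this
    rw [← hp', memI'] at this
    exact ⟨p', Or.inr (Or.inl ⟨⟨h, h'⟩, this, hp'.symm⟩)⟩
  · rcases le_or_gt p' l' with h | h
    · obtain ⟨x, hx, rfl⟩ := low hi' h
      exact ⟨_, Or.inl ⟨x, hx, rfl, rfl⟩⟩
    rcases le_or_gt r' p' with h' | h'
    · obtain ⟨x, hx, rfl⟩ := high hj' h'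
      exact ⟨_, Or.inr (Or.inr ⟨x, hx, rfl, rfl⟩)⟩
    obtain ⟨w, hw, hw'⟩ := hf.surjOn (memI'.2 ⟨h, h'⟩)
    obtain ⟨p, rfl⟩ := hc _ _ _ hw
    exact ⟨p, Or.inr (Or.inl ⟨memI.1 hw, ⟨h, h'⟩, hw'⟩)⟩
  · have lowl : ∀ x ≤ z, (toLex (i, x) : I ×ₗ Z) ≤ l := fun x hx => (le_same i x z).2 hx
    have lowl' : ∀ x ≤ z, (toLex (i', x) : I' ×ₗ Z) ≤ l' := fun x hx => (le_same i' x z).2 hx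
    have highr : ∀ x, y ≤ x → r ≤ (toLex (j, x) : I ×ₗ Z) := fun x hx => (le_same j y x).2 hx
    have highr' : ∀ x, y ≤ x → r' ≤ (toLex (j', x) : I' ×ₗ Z) := fun x hx => (le_same j' y x).2 hx
    rintro p p' q q' (⟨x, hx, rfl, rfl⟩ | ⟨hp, hp', hpp⟩ | ⟨x, hx, rfl, rfl⟩)
      (⟨u, hu, rfl, rfl⟩ | ⟨hq, hq', hqq⟩ | ⟨u, hu, rfl, rfl⟩)
    · rw [lt_same, lt_same]
    · exact iff_of_true ((lowl x hx).trans_lt hq.1) ((lowl' x hx).trans_lt hq'.1)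
    · exact iff_of_true ((lowl x hx).trans_lt (hlr.trans_le (highr u hu)))
        ((lowl' x hx).trans_lt (hlr'.trans_le (highr' u hu)))
    · exact iff_of_false ((lowl u hu).trans hp.1.le).not_gt ((lowl' u hu).trans hp'.1.le).not_gt
    · rw [← he.lt_iff_lt, ← hmono.lt_iff_lt (memI.2 hp) (memI.2 hq), hpp, hqq, he'.lt_iff_lt]
    · exact iff_of_true (hp.2.trans_le (highr u hu)) (hp'.2.trans_le (highr' u hu))
    · exact iff_of_false ((lowl u hu).trans (hlr.le.trans (highr x hx))).not_gt
        ((lowl' u hu).trans (hlr'.le.trans (highr' x hx))).not_gt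
    · exact iff_of_false (hq.2.le.trans (highr x hx)).not_gt (hq'.2.le.trans (highr' x hx)).not_gt
    · rw [lt_same, lt_same]

end Recover

/-- A countable order whose theory has infinitely many types is elementarily equivalent to a
family of orders which can be told apart by the order between suitable finite subsets. -/
theorem exists_order_family (A : Type) [LinearOrder A] [Countable A]
    (hA : ¬ FinTh (univ : Set A)) :
    ∃ (N : Set ℕ → Type) (_ : ∀ S, LinearOrder (N S)), (∀ S, Countable (N S)) ∧
      (∀ S, Infinite (N S)) ∧ (∀ S, Th (univ : Set (N S)) = Th (univ : Set A)) ∧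
      ∀ k : ℕ, ∃ p q : ∀ S, Fin (k + 1) → N S, (∀ S, StrictMono (p S)) ∧ (∀ S, StrictMono (q S)) ∧
        (∀ S i j, p S i < q S j) ∧ ∀ S S' (f : N S → N S'),
          BijOn f (Ioo (p S (Fin.last k)) (q S 0)) (Ioo (p S' (Fin.last k)) (q S' 0)) →
          StrictMonoOn f (Ioo (p S (Fin.last k)) (q S 0)) → S = S' := by
  obtain ⟨L, X, R, _, _, _, _, _, _, ⟨τ, t, ht⟩, hX, hTh⟩ := exists_countable_homogeneous A hA
  obtain ⟨Z, _, hZc, hZTh, P, hne, hP⟩ := exists_marked ht.selfAdditive hX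
  have hZ : SelfAdditive Z := ht.selfAdditive.transfer hZTh.symm
  have hZi : Infinite Z := by
    by_contra h
    rw [not_infinite_iff_finite] at h
    exact hX ((FinTh.of_finite ((toFinite _).image _)).of_Th_eq hZTh.symm)
  let N : Set ℕ → Type := fun S => L ⊕ₗ ((blockSet S ×ₗ Z) ⊕ₗ R)
  let e : ∀ S, blockSet S ×ₗ Z → N S := fun S p => Sum.inrₗ (Sum.inlₗ p)
  have he : ∀ S, StrictMono (e S) := fun S => strictMono_inrₗ.comp strictMono_inlₗ
  have hconv : ∀ S a b, ∀ x ∈ Ioo (e S a) (e S b), x ∈ range (e S) := by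
    intro S a b x hx
    rcases sumLex_cases x with ⟨y, rfl⟩ | ⟨w, rfl⟩
    · exact (lt_asymm hx.1 (inlₗ_lt_inrₗ _ _)).elim
    · rcases sumLex_cases w with ⟨y, rfl⟩ | ⟨y, rfl⟩
      · exact ⟨y, rfl⟩
      · exact (lt_asymm hx.2 (strictMono_inrₗ (inlₗ_lt_inrₗ _ _))).elim
  let bot : ∀ S, blockSet S := fun S => ⟨toLex (0, 0), ⟨le_rfl, zero_le_one⟩, Or.inl rfl⟩
  let top : ∀ S, blockSet S := fun S => ⟨toLex (1, 0), ⟨zero_le_one, le_rfl⟩, Or.inl rfl⟩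
  have hbot : ∀ S k, bot S ≤ k := by
    intro S k
    change (bot S).1 ≤ k.1
    rw [Prod.Lex.le_iff]
    rcases k.2.1.1.lt_or_eq with h | h
    · exact Or.inl h
    · exact Or.inr ⟨h, Nat.zero_le _⟩
  have htop : ∀ S k, k ≤ top S := by
    intro S k
    change k.1 ≤ (top S).1
    rw [Prod.Lex.le_iff]
    rcases k.2.1.2.lt_or_eq with h | h
    · exact Or.inl h
    · refine Or.inr ⟨h, ?_⟩
      rcases k.2.2 with h0 | ⟨n, hn, h1, h2⟩
      · exact h0.le
      · rw [h, eq_div_iff (by positivity)] at h1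
        linarith [(Nat.cast_nonneg n : (0 : ℚ) ≤ n)]
  have hbt : ∀ S, bot S < top S := fun S =>
    show (bot S).1 < (top S).1 from Prod.Lex.lt_iff.2 (Or.inl zero_lt_one)
  have : ∀ S, Nonempty (blockSet S) := fun S => ⟨bot S⟩
  have hQ : Countable (ℚ ×ₗ ℕ) := inferInstanceAs (Countable (ℚ × ℕ))
  refine ⟨N, fun S => inferInstance, fun S => ?_, fun S => ?_, fun S => ?_, fun k => ?_⟩
  · have : Countable (blockSet S) := inferInstance
    exact inferInstanceAs (Countable (L ⊕ ((blockSet S × Z) ⊕ R)))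
  · exact Infinite.of_injective _ ((he S).injective.comp (strictMono_toLex (bot S)).injective)
  · rw [Th_univ_sumLex, Th_univ_sumLex, hZ.Th_lex, hZTh, hTh, add_assoc]
  · obtain ⟨s, hs⟩ := Infinite.exists_subset_card_eq Z (k + 1)
    let g := s.orderEmbOfFin hs
    refine ⟨fun S i => e S (toLex (bot S, g i)), fun S i => e S (toLex (top S, g i)),
      fun S => (he S).comp ((strictMono_toLex _).comp g.strictMono),
      fun S => (he S).comp ((strictMono_toLex _).comp g.strictMono),
      fun S i j => he S (Prod.Lex.toLex_lt_toLex.2 (Or.inl (hbt S))), fun S S' f h1 h2 => ?_⟩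
    obtain ⟨F⟩ := nonempty_lex_orderIso (he S) (he S') (hconv S) (hconv S') (hbot S) (htop S)
      (hbt S) (hbot S') (htop S') (hbt S') _ _ h1 h2
    obtain ⟨G⟩ := nonempty_orderIso_of_lex hZ hne hP F
    exact eq_of_blockSet_orderIso G

/-- The order pattern of a tuple. -/
def pat {m : ℕ} {A : Type*} [LT A] (v : Fin m → A) : Fin m → Fin m → Prop := fun i j => v i < v j

section Rigidity

variable {A B : Type*} [LinearOrder A] [LinearOrder B] {m k : ℕ}

theorem pat_comp_eq {c : Fin m → ℕ} (hc : ∀ j, c j < k) {x : ℕ → A} {y : ℕ → B}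
    (h : ∀ s < k, ∀ t < k, (x s < x t ↔ y s < y t)) : pat (x ∘ c) = pat (y ∘ c) :=
  funext fun i => funext fun j => propext (h _ (hc i) _ (hc j))

theorem pat_comp_eq_of_mono {c : Fin m → ℕ} (hc : ∀ j, c j < k) {x : ℕ → A}
    (h : ∀ s t, s < t → t < k → x s < x t) : pat (x ∘ c) = pat c := by
  refine pat_comp_eq (y := id) hc fun s hs t ht => ?_
  have hm : StrictMonoOn x (Iio k) := fun s _ t ht hst => h s t hst ht
  exact hm.lt_iff_lt hs ht

theorem swap_succ_apply (i t : ℕ) : Equiv.swap i (i + 1) t =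
    if t = i then i + 1 else if t = i + 1 then i else t := Equiv.swap_apply_def _ _ _

theorem pat_comp_eq_of_swap_mono {c : Fin m → ℕ} (hc : ∀ j, c j < k) {i : ℕ} (hi : i + 1 < k)
    {x : ℕ → A} (h : ∀ s t, s < t → t < k →
      x (Equiv.swap i (i + 1) s) < x (Equiv.swap i (i + 1) t)) :
    pat (x ∘ c) = pat (Equiv.swap i (i + 1) ∘ c) := by
  have hc' : ∀ j, (Equiv.swap i (i + 1) ∘ c) j < k := by
    intro j
    have := hc j
    simp only [Function.comp_apply, swap_succ_apply]
    split_ifs <;> omega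
  rw [← pat_comp_eq_of_mono hc' (x := x ∘ Equiv.swap i (i + 1)) h]
  congr 1
  funext j
  simp

variable {E : Set (Fin m → Fin m → Prop)} {f : A → B} {c : Fin m → ℕ} {i : ℕ}

/-- The coloring `c` witnesses that `E` distinguishes two tuples which differ by the transposition
of two adjacent values. -/
structure SwapWitness (E : Set (Fin m → Fin m → Prop)) (k : ℕ) (c : Fin m → ℕ) (i : ℕ) : Prop where
  lt : ∀ j, c j < k
  succ_lt : i + 1 < k
  ne : ¬ (pat c ∈ E ↔ pat (Equiv.swap i (i + 1) ∘ c) ∈ E)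

/-- Two long finite chains, one below the other. -/
structure Frame (K : ℕ) (p q : ℕ → A) : Prop where
  left : ∀ s t, s < t → t < K → p s < p t
  right : ∀ s t, s < t → t < K → q s < q t
  lt : ∀ s t, s < K → t < K → p s < q t

theorem SwapWitness.false_of_swap (hw : SwapWitness E k c i)
    (hE : ∀ v : Fin m → A, pat v ∈ E ↔ pat (f ∘ v) ∈ E) (x : ℕ → A)
    (h1 : ∀ s t, s < t → t < k → x s < x t)
    (h2 : ∀ s t, s < t → t < k →
      f (x (Equiv.swap i (i + 1) s)) < f (x (Equiv.swap i (i + 1) t))) : False := by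
  apply hw.ne
  have := hE (x ∘ c)
  rw [pat_comp_eq_of_mono hw.lt h1] at this
  rw [this, ← Function.comp_assoc, pat_comp_eq_of_swap_mono hw.lt hw.succ_lt (x := f ∘ x) h2]

theorem SwapWitness.false_of_merge (hw : SwapWitness E k c i)
    (hE : ∀ v : Fin m → A, pat v ∈ E ↔ pat (f ∘ v) ∈ E) (x y : ℕ → A)
    (h1 : ∀ s t, s < t → t < k → x s < x t)
    (h2 : ∀ s t, s < t → t < k → y (Equiv.swap i (i + 1) s) < y (Equiv.swap i (i + 1) t))
    (h3 : ∀ s < k, ∀ t < k, (f (x s) < f (x t) ↔ f (y s) < f (y t))) : False := by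
  apply hw.ne
  have hx := hE (x ∘ c)
  have hy := hE (y ∘ c)
  rw [pat_comp_eq_of_mono hw.lt h1] at hx
  rw [pat_comp_eq_of_swap_mono hw.lt hw.succ_lt h2] at hy
  rw [hx, hy, ← Function.comp_assoc, ← Function.comp_assoc,
    pat_comp_eq (x := f ∘ x) (y := f ∘ y) hw.lt h3]

/-- The tuple which consists of the first `i` values of `u`, of `a` and `b`, and of the remaining
values of `w`. -/
def tuple {A : Type*} (i : ℕ) (u : ℕ → A) (a b : A) (w : ℕ → A) (t : ℕ) : A :=
  if t < i then u t else if t = i then a else if t = i + 1 then b else w t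

theorem tuple_swap {A : Type*} (u : ℕ → A) (a b : A) (w : ℕ → A) (t : ℕ) :
    tuple i u a b w (Equiv.swap i (i + 1) t) = tuple i u b a w t := by
  rw [swap_succ_apply]
  split_ifs with h1 h2
  · subst h1
    simp [tuple]
  · subst h2
    simp [tuple]
  · simp [tuple, h1, h2]

theorem map_tuple {A B : Type*} (f : A → B) (u : ℕ → A) (a b : A) (w : ℕ → A) (t : ℕ) :
    f (tuple i u a b w t) = tuple i (f ∘ u) (f a) (f b) (f ∘ w) t := by
  simp only [tuple, apply_ite f, Function.comp_apply]

theorem tuple_lt {u w : ℕ → A} {a b : A} (hu : ∀ s t, s < t → t < i → u s < u t)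
    (hua : ∀ s < i, u s < a) (hab : a < b) (hbw : ∀ t, i + 1 < t → t < k → b < w t)
    (hw : ∀ s t, i + 1 < s → s < t → t < k → w s < w t) (s t : ℕ) (hst : s < t) (ht : t < k) :
    tuple i u a b w s < tuple i u a b w t := by
  have h1 : ∀ s < i, u s < b := fun s hs => (hua s hs).trans hab
  have h2 : ∀ t, i + 1 < t → t < k → a < w t := fun t h h' => hab.trans (hbw t h h')
  have h3 : ∀ s t, s < i → i + 1 < t → t < k → u s < w t := fun s t hs h h' =>
    (hua s hs).trans (h2 t h h')
  unfold tuple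
  split_ifs <;> first | omega | grind

theorem tuple_lt_iff_of_top {u w : ℕ → A} {a b : A} (hu : ∀ s t, s < t → t < i → u s < u t)
    (hub : ∀ s < i, u s < b) (hbw : ∀ t, i + 1 < t → t < k → b < w t)
    (hw : ∀ s t, i + 1 < s → s < t → t < k → w s < w t) (hba : b < a)
    (hwa : ∀ t, i + 1 < t → t < k → w t < a) (s : ℕ) (hs : s < k) (t : ℕ) (ht : t < k) :
    tuple i u a b w s < tuple i u a b w t ↔ s ≠ i ∧ (t = i ∨ s < t) := by
  have h1 : ∀ s < i, u s < a := fun s hs => (hub s hs).trans hba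
  have h3 : ∀ s t, s < i → i + 1 < t → t < k → u s < w t := fun s t hs h h' =>
    (hub s hs).trans (hbw t h h')
  have key : ∀ s t, s < k → t < k → s ≠ i → (t = i ∨ s < t) →
      tuple i u a b w s < tuple i u a b w t := by
    intro s t hs ht h4 h5
    unfold tuple
    split_ifs <;> first | omega | grind
  refine ⟨fun h => ?_, fun h => key s t hs ht h.1 h.2⟩
  by_contra hn
  rcases eq_or_ne s t with rfl | hst
  · exact lt_irrefl _ h
  · exact lt_asymm h (key t s ht hs (by omega) (by omega))

theorem tuple_lt_iff_of_bot {u w : ℕ → A} {a b : A} (hu : ∀ s t, s < t → t < i → u s < u t)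
    (hua : ∀ s < i, u s < a) (haw : ∀ t, i + 1 < t → t < k → a < w t)
    (hw : ∀ s t, i + 1 < s → s < t → t < k → w s < w t) (hba : b < a)
    (hbu : ∀ t < i, b < u t) (s : ℕ) (hs : s < k) (t : ℕ) (ht : t < k) :
    tuple i u a b w s < tuple i u a b w t ↔ t ≠ i + 1 ∧ (s = i + 1 ∨ s < t) := by
  have h1 : ∀ t, i + 1 < t → t < k → b < w t := fun s hs h => hba.trans (haw s hs h)
  have h3 : ∀ s t, s < i → i + 1 < t → t < k → u s < w t := fun s t hs h h' =>
    (hua s hs).trans (haw t h h')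
  have key : ∀ s t, s < k → t < k → t ≠ i + 1 → (s = i + 1 ∨ s < t) →
      tuple i u a b w s < tuple i u a b w t := by
    intro s t hs ht h4 h5
    unfold tuple
    split_ifs <;> first | omega | grind
  refine ⟨fun h => ?_, fun h => key s t hs ht h.1 h.2⟩
  by_contra hn
  rcases eq_or_ne s t with rfl | hst
  · exact lt_irrefl _ h
  · exact lt_asymm h (key t s ht hs (by omega) (by omega))

variable {p q : ℕ → A}

theorem SwapWitness.lt_of_lt (hw : SwapWitness E k c i) (hf : Function.Injective f)
    (hE : ∀ v : Fin m → A, pat v ∈ E ↔ pat (f ∘ v) ∈ E) (hA : Frame (2 * k + 1) p q)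
    (hB : Frame (2 * k + 1) (f ∘ p) (f ∘ q)) {a b : A} (ha : p (2 * k) < a) (hab : a < b)
    (hb : b < q 0) (hfb : f (p (2 * k)) < f b) (hfa : f a < f (q 0)) : f a < f b := by
  by_contra hn
  have hba : f b < f a := lt_of_le_of_ne (not_lt.1 hn) (hf.ne hab.ne')
  have hi := hw.succ_lt
  refine hw.false_of_swap hE (tuple i p a b q) (tuple_lt ?_ ?_ hab ?_ ?_) fun s t hst ht => ?_
  · exact fun s t hst ht => hA.left s t hst (by omega)
  · exact fun s hs => (hA.left s (2 * k) (by omega) (by omega)).trans ha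
  · exact fun t ht htk => hb.trans (hA.right 0 t (by omega) (by omega))
  · exact fun s t _ hst ht => hA.right s t hst (by omega)
  · rw [tuple_swap, tuple_swap, map_tuple f, map_tuple f]
    refine tuple_lt (k := k) ?_ ?_ hba ?_ ?_ s t hst ht
    · exact fun s t hst ht => hB.left s t hst (by omega)
    · exact fun s hs => (hB.left s (2 * k) (by omega) (by omega)).trans hfb
    · exact fun t ht htk => hfa.trans (hB.right 0 t (by omega) (by omega))
    · exact fun s t _ hst ht => hB.right s t hst (by omega)

theorem SwapWitness.map_lt_right (hw : SwapWitness E k c i) (hf : Function.Injective f)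
    (hE : ∀ v : Fin m → A, pat v ∈ E ↔ pat (f ∘ v) ∈ E) (hA : Frame (2 * k + 1) p q)
    (hB : Frame (2 * k + 1) (f ∘ p) (f ∘ q)) {a : A} (ha : p (2 * k) < a) (haq : a < q 0) :
    f a < f (q 0) := by
  have hi := hw.succ_lt
  have hap : ∀ s ≤ 2 * k, p s < a := fun s hs => by
    rcases hs.lt_or_eq with h | rfl
    · exact (hA.left s _ h (by omega)).trans ha
    · exact ha
  have haq' : ∀ s ≤ 2 * k, a < q s := fun s hs => by
    rcases s.eq_zero_or_pos with rfl | h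
    · exact haq
    · exact haq.trans (hA.right 0 s h (by omega))
  have hne : ∀ s ≤ 2 * k, f a ≠ f (q s) := fun s hs => hf.ne (haq' s hs).ne
  by_contra hn
  have h0 : f (q 0) < f a := lt_of_le_of_ne (not_lt.1 hn) (hne 0 (by omega)).symm
  by_cases hlast : f (q k) < f a
  · have hqa : ∀ t < k, f (q t) < f a := fun t ht => (hB.right t k ht (by omega)).trans hlast
    refine hw.false_of_merge hE (tuple i p a (q i) q) (tuple i p a (p i) q)
      (tuple_lt ?_ ?_ ?_ ?_ ?_) (fun s t hst ht => ?_) (fun s hs t ht => ?_)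
    · exact fun s t hst ht => hA.left s t hst (by omega)
    · exact fun s hs => hap s (by omega)
    · exact haq' i (by omega)
    · exact fun t ht htk => hA.right i t (by omega) (by omega)
    · exact fun s t _ hst ht => hA.right s t hst (by omega)
    · rw [tuple_swap, tuple_swap]
      refine tuple_lt (k := k) ?_ ?_ ?_ ?_ ?_ s t hst ht
      · exact fun s t hst ht => hA.left s t hst (by omega)
      · exact fun s hs => hA.left s i hs (by omega)
      · exact hap i (by omega)
      · exact fun t ht htk => haq' t (by omega)
      · exact fun s t _ hst ht => hA.right s t hst (by omega)
    · rw [map_tuple f, map_tuple f, map_tuple f, map_tuple f, tuple_lt_iff_of_top _ _ _ _ _ _ s hs t ht,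
        tuple_lt_iff_of_top _ _ _ _ _ _ s hs t ht]
      · exact fun s t hst ht => hB.left s t hst (by omega)
      · exact fun s hs => hB.left s i hs (by omega)
      · exact fun t ht htk => hB.lt i t (by omega) (by omega)
      · exact fun s t _ hst ht => hB.right s t hst (by omega)
      · exact (hB.lt i 0 (by omega) (by omega)).trans h0
      · exact fun t _ ht => hqa t ht
      · exact fun s t hst ht => hB.left s t hst (by omega)
      · exact fun s hs => hB.lt s i (by omega) (by omega)
      · exact fun t ht htk => hB.right i t (by omega) (by omega)
      · exact fun s t _ hst ht => hB.right s t hst (by omega)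
      · exact hqa i (by omega)
      · exact fun t _ ht => hqa t ht
  · have hex : ∃ s, ¬ f (q s) < f a := ⟨k, hlast⟩
    classical
    obtain ⟨r, hr⟩ : ∃ r, Nat.find hex = r + 1 :=
      Nat.exists_eq_succ_of_ne_zero fun h => (h ▸ Nat.find_spec hex) h0
    have hrk : r + 1 ≤ k := hr ▸ Nat.find_min' hex hlast
    have h1 : f (q r) < f a := not_not.1 (Nat.find_min hex (by omega))
    have h2 : f a < f (q (r + 1)) :=
      lt_of_le_of_ne (not_lt.1 (hr ▸ Nat.find_spec hex)) (hne _ (by omega))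
    have h3 : ∀ t, r + 1 ≤ t → t ≤ 2 * k → f a < f (q t) := fun t ht htk => by
      rcases ht.lt_or_eq with h | rfl
      · exact h2.trans (hB.right _ _ h (by omega))
      · exact h2
    refine hw.false_of_swap hE (tuple i p a (q r) fun t => q (r + t)) (tuple_lt ?_ ?_ ?_ ?_ ?_)
      fun s t hst ht => ?_
    · exact fun s t hst ht => hA.left s t hst (by omega)
    · exact fun s hs => hap s (by omega)
    · exact haq' r (by omega)
    · exact fun t ht htk => hA.right r _ (by omega) (by omega)
    · exact fun s t _ hst ht => hA.right _ _ (by omega) (by omega)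
    · rw [tuple_swap, tuple_swap, map_tuple f, map_tuple f]
      refine tuple_lt (k := k) ?_ ?_ h1 ?_ ?_ s t hst ht
      · exact fun s t hst ht => hB.left s t hst (by omega)
      · exact fun s hs => hB.lt s r (by omega) (by omega)
      · exact fun t ht htk => h3 (r + t) (by omega) (by omega)
      · exact fun s t _ hst ht => hB.right (r + s) (r + t) (by omega) (by omega)

theorem SwapWitness.left_lt_map (hw : SwapWitness E k c i) (hf : Function.Injective f)
    (hE : ∀ v : Fin m → A, pat v ∈ E ↔ pat (f ∘ v) ∈ E) (hA : Frame (2 * k + 1) p q)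
    (hB : Frame (2 * k + 1) (f ∘ p) (f ∘ q)) {a : A} (ha : p (2 * k) < a) (haq : a < q 0) :
    f (p (2 * k)) < f a := by
  have hi := hw.succ_lt
  have hap : ∀ s ≤ 2 * k, p s < a := fun s hs => by
    rcases hs.lt_or_eq with h | rfl
    · exact (hA.left s _ h (by omega)).trans ha
    · exact ha
  have haq' : ∀ s ≤ 2 * k, a < q s := fun s hs => by
    rcases s.eq_zero_or_pos with rfl | h
    · exact haq
    · exact haq.trans (hA.right 0 s h (by omega))
  have hne : ∀ s ≤ 2 * k, f a ≠ f (p s) := fun s hs => hf.ne (hap s hs).ne'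
  by_contra hn
  have h0 : f a < f (p (2 * k)) := lt_of_le_of_ne (not_lt.1 hn) (hne _ le_rfl)
  by_cases hfirst : f a < f (p k)
  · have hpa : ∀ t, k ≤ t → t ≤ 2 * k → f a < f (p t) := fun t ht htk => by
      rcases ht.lt_or_eq with h | rfl
      · exact hfirst.trans (hB.left k t h (by omega))
      · exact hfirst
    let u : ℕ → A := fun t => p (k + t)
    refine hw.false_of_merge hE (tuple i u (u i) a q) (tuple i u (q i) a q)
      (tuple_lt ?_ ?_ ?_ ?_ ?_) (fun s t hst ht => ?_) (fun s hs t ht => ?_)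
    · exact fun s t hst ht => hA.left _ _ (by omega) (by omega)
    · exact fun s hs => hA.left _ _ (by omega) (by omega)
    · exact hap _ (by omega)
    · exact fun t ht htk => haq' t (by omega)
    · exact fun s t _ hst ht => hA.right s t hst (by omega)
    · rw [tuple_swap, tuple_swap]
      refine tuple_lt (k := k) ?_ ?_ ?_ ?_ ?_ s t hst ht
      · exact fun s t hst ht => hA.left _ _ (by omega) (by omega)
      · exact fun s hs => hap _ (by omega)
      · exact haq' i (by omega)
      · exact fun t ht htk => hA.right i t (by omega) (by omega)
      · exact fun s t _ hst ht => hA.right s t hst (by omega)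
    · rw [map_tuple f, map_tuple f, map_tuple f, map_tuple f, tuple_lt_iff_of_bot _ _ _ _ _ _ s hs t ht,
        tuple_lt_iff_of_bot _ _ _ _ _ _ s hs t ht]
      · exact fun s t hst ht => hB.left (k + s) (k + t) (by omega) (by omega)
      · exact fun s hs => hB.lt (k + s) i (by omega) (by omega)
      · exact fun t ht htk => hB.right i t (by omega) (by omega)
      · exact fun s t _ hst ht => hB.right s t hst (by omega)
      · exact hfirst.trans (hB.lt k i (by omega) (by omega))
      · exact fun t ht => hpa (k + t) (by omega) (by omega)
      · exact fun s t hst ht => hB.left (k + s) (k + t) (by omega) (by omega)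
      · exact fun s hs => hB.left (k + s) (k + i) (by omega) (by omega)
      · exact fun t ht htk => hB.lt (k + i) t (by omega) (by omega)
      · exact fun s t _ hst ht => hB.right s t hst (by omega)
      · exact hpa (k + i) (by omega) (by omega)
      · exact fun t ht => hpa (k + t) (by omega) (by omega)
  · have hex : ∃ s, f a < f (p s) := ⟨2 * k, h0⟩
    classical
    have hkr : k < Nat.find hex := by
      by_contra h
      rcases (not_lt.1 h).lt_or_eq with h | h
      · exact hfirst ((Nat.find_spec hex).trans (hB.left _ _ h (by omega)))
      · exact hfirst (h ▸ Nat.find_spec hex)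
    obtain ⟨r, hr⟩ : ∃ r, Nat.find hex = r + 1 := Nat.exists_eq_succ_of_ne_zero (by omega)
    have hrk : r + 1 ≤ 2 * k := hr ▸ Nat.find_min' hex h0
    have h1 : f a < f (p (r + 1)) := hr ▸ Nat.find_spec hex
    have h2 : f (p r) < f a :=
      lt_of_le_of_ne (not_lt.1 (Nat.find_min hex (by omega))) (hne _ (by omega)).symm
    have h3 : ∀ t ≤ r, f (p t) < f a := fun t ht => by
      rcases ht.lt_or_eq with h | rfl
      · exact (hB.left _ _ h (by omega)).trans h2
      · exact h2
    refine hw.false_of_swap hE (tuple i p (p (r + 1)) a q) (tuple_lt ?_ ?_ ?_ ?_ ?_)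
      fun s t hst ht => ?_
    · exact fun s t hst ht => hA.left s t hst (by omega)
    · exact fun s hs => hA.left _ _ (by omega) (by omega)
    · exact hap _ (by omega)
    · exact fun t ht htk => haq' t (by omega)
    · exact fun s t _ hst ht => hA.right _ _ (by omega) (by omega)
    · rw [tuple_swap, tuple_swap, map_tuple f, map_tuple f]
      refine tuple_lt (k := k) ?_ ?_ h1 ?_ ?_ s t hst ht
      · exact fun s t hst ht => hB.left s t hst (by omega)
      · exact fun s hs => h3 s (by omega)
      · exact fun t ht htk => hB.lt (r + 1) t (by omega) (by omega)
      · exact fun s t _ hst ht => hB.right s t hst (by omega)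

theorem SwapWitness.rigid (hw : SwapWitness E k c i) (g : A ≃ B)
    (hE : ∀ v : Fin m → A, pat v ∈ E ↔ pat (g ∘ v) ∈ E) (hA : Frame (2 * k + 1) p q)
    (hB : Frame (2 * k + 1) (g ∘ p) (g ∘ q)) :
    BijOn g (Ioo (p (2 * k)) (q 0)) (Ioo (g (p (2 * k))) (g (q 0))) ∧
      StrictMonoOn g (Ioo (p (2 * k)) (q 0)) := by
  have hE' : ∀ v : Fin m → B, pat v ∈ E ↔ pat (g.symm ∘ v) ∈ E := fun v => by
    rw [hE, ← Function.comp_assoc, g.self_comp_symm, Function.id_comp]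
  have e : ∀ u : ℕ → A, g.symm ∘ g ∘ u = u := fun u => by
    rw [← Function.comp_assoc, g.symm_comp_self, Function.id_comp]
  have hA' : Frame (2 * k + 1) (g.symm ∘ g ∘ p) (g.symm ∘ g ∘ q) := by rwa [e, e]
  refine ⟨⟨fun a ha => ?_, g.injective.injOn, fun b hb => ⟨g.symm b, ?_, by simp⟩⟩, ?_⟩
  · exact ⟨hw.left_lt_map g.injective hE hA hB ha.1 ha.2,
      hw.map_lt_right g.injective hE hA hB ha.1 ha.2⟩
  · have h1 := hw.left_lt_map g.symm.injective hE' hB hA' hb.1 hb.2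
    have h2 := hw.map_lt_right g.symm.injective hE' hB hA' hb.1 hb.2
    simp only [Function.comp_apply, Equiv.symm_apply_apply] at h1 h2
    exact ⟨h1, h2⟩
  · intro a ha b hb hab
    exact hw.lt_of_lt g.injective hE hA hB ha.1 hab hb.2
      (hw.left_lt_map g.injective hE hA hB hb.1 hb.2)
      (hw.map_lt_right g.injective hE hA hB ha.1 ha.2)

end Rigidity

section Definable

variable {L : FirstOrder.Language.{u, v}}

/-- The interpretation of each relation symbol at a tuple is given by the order pattern of the
tuple. -/
def DefinedBy (D : ∀ m, L.Relations m → Set (Fin m → Fin m → Prop)) (A : Type*) [L.Structure A]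
    [LinearOrder A] : Prop :=
  ∀ (m : ℕ) (R : L.Relations m) (v : Fin m → A), Structure.RelMap R v ↔ pat v ∈ D m R

/-- The structure on a linear order in which relations are given by order patterns. -/
@[reducible]
def patStructure [L.IsRelational] (D : ∀ m, L.Relations m → Set (Fin m → Fin m → Prop)) (A : Type*)
    [LinearOrder A] : L.Structure A where
  funMap f := isEmptyElim f
  RelMap R v := pat v ∈ D _ R

theorem definedBy_patStructure [L.IsRelational]
    (D : ∀ m, L.Relations m → Set (Fin m → Fin m → Prop)) (A : Type*) [LinearOrder A] :
    @DefinedBy L D A (patStructure D A) _ :=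
  fun _ _ _ => Iff.rfl

/-- The quantifier rank of a formula. -/
def quantifierRank {α : Type*} : ∀ {n : ℕ}, L.BoundedFormula α n → ℕ
  | _, .falsum => 0
  | _, .equal _ _ => 0
  | _, .rel _ _ => 0
  | _, .imp f g => max (quantifierRank f) (quantifierRank g)
  | _, .all f => quantifierRank f + 1

theorem realize_mem_of_forall_mem [L.IsRelational] {A B : Type*} [L.Structure A] [L.Structure B]
    {α : Type*} {r : Set (A × B)} {v : α → A}
    {w : α → B} (h : ∀ i, (v i, w i) ∈ r) (t : L.Term α) :
    (t.realize v, t.realize w) ∈ r := by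
  cases t with
  | var i => exact h i
  | func f _ => exact isEmptyElim f

variable {D : ∀ m, L.Relations m → Set (Fin m → Fin m → Prop)} {A B : Type*} [LinearOrder A]
  [LinearOrder B] [L.Structure A] [L.Structure B]

theorem BackForth.realize_iff [L.IsRelational] [Nonempty A] (hA : DefinedBy D A)
    (hB : DefinedBy D B) {α : Type*} {n : ℕ} (φ : L.BoundedFormula α n) {r : Set (A × B)}
    (h : BackForth (quantifierRank φ) r) {v : α → A} {w : α → B} (hvw : ∀ i, (v i, w i) ∈ r)
    {x : Fin n → A} {y : Fin n → B} (hxy : ∀ i, (x i, y i) ∈ r) :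
    φ.Realize v x ↔ φ.Realize w y := by
  have hterm : ∀ {n : ℕ} {x : Fin n → A} {y : Fin n → B} {r : Set (A × B)}
      (_ : ∀ i, (v i, w i) ∈ r) (_ : ∀ i, (x i, y i) ∈ r) (t : L.Term (α ⊕ Fin n)),
      (t.realize (Sum.elim v x), t.realize (Sum.elim w y)) ∈ r := by
    intro n x y r hvw hxy t
    refine realize_mem_of_forall_mem (fun i => ?_) t
    cases i with
    | inl i => exact hvw i
    | inr i => exact hxy i
  induction φ generalizing r with
  | falsum => exact Iff.rfl
  | equal t₁ t₂ =>
    have h1 := hterm hvw hxy t₁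
    have h2 := hterm hvw hxy t₂
    have k1 := h.lt_iff h1 h2
    have k2 := h.lt_iff h2 h1
    simp only [BoundedFormula.Realize, eq_iff_le_not_lt, ← not_lt]
    rw [k1, k2]
  | rel R ts =>
    simp only [BoundedFormula.Realize]
    rw [hA, hB]
    have : pat (fun i => (ts i).realize (Sum.elim v x)) =
        pat (fun i => (ts i).realize (Sum.elim w y)) :=
      funext fun i => funext fun j =>
        propext (h.lt_iff (hterm hvw hxy (ts i)) (hterm hvw hxy (ts j)))
    rw [this]
  | imp f g hf hg =>
    exact imp_congr (hf (h.of_le (le_max_left _ _)) hvw hxy)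
      (hg (h.of_le (le_max_right _ _)) hvw hxy)
  | all f hf =>
    simp only [BoundedFormula.Realize]
    have key : ∀ a b, BackForth (quantifierRank f) (insert (a, b) r) →
        (f.Realize v (Fin.snoc x a) ↔ f.Realize w (Fin.snoc y b)) := by
      intro a b hab
      refine hf hab (fun i => Or.inr (hvw i)) fun i => ?_
      induction i using Fin.lastCases with
      | last => simp
      | cast i => simpa using Or.inr (hxy i)
    constructor
    · intro H b
      obtain ⟨a, ha⟩ := h.2 b
      exact (key a b ha).1 (H a)
    · intro H a
      obtain ⟨b, hb⟩ := h.1 a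
      exact (key a b hb).2 (H b)

theorem DefinedBy.model_of_Th_eq [L.IsRelational] [Nonempty A] (hA : DefinedBy D A)
    (hB : DefinedBy D B) (h : Th (univ : Set A) = Th (univ : Set B)) {T : L.Theory} (hT : A ⊨ T) :
    B ⊨ T := by
  refine ⟨fun φ hφ => ?_⟩
  have := hT.realize_of_mem φ hφ
  exact (BackForth.realize_iff hA hB φ (backForth_empty (congrFun h _)) (fun i => i.elim)
    (fun i => i.elim0)).1 this

end Definable

theorem exists_factor_of_pat_eq {m : ℕ} {α β : Type*} [LinearOrder α] [LinearOrder β]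
    {v : Fin m → α} {w : Fin m → β} (h : pat v = pat w) :
    ∃ (k : ℕ) (u : Fin m → Fin k) (e : Fin k → α) (e' : Fin k → β),
      Function.Surjective u ∧ StrictMono e ∧ StrictMono e' ∧ v = e ∘ u ∧ w = e' ∘ u := by
  classical
  have hlt : ∀ i j, v i < v j ↔ w i < w j := fun i j => iff_of_eq (congrFun (congrFun h i) j)
  have heq : ∀ i j, v i = v j → w i = w j := fun i j hij =>
    le_antisymm (not_lt.1 fun h => by simpa [hij] using (hlt j i).2 h)
      (not_lt.1 fun h => by simpa [hij] using (hlt i j).2 h)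
  let S : Finset α := Finset.univ.image v
  let e := S.orderIsoOfFin rfl
  have hv : ∀ i, v i ∈ S := fun i => Finset.mem_image_of_mem _ (Finset.mem_univ i)
  have hs : ∀ a : S, ∃ i, v i = a := fun a => by
    obtain ⟨i, -, hi⟩ := Finset.mem_image.1 a.2
    exact ⟨i, hi⟩
  choose g hg using hs
  refine ⟨S.card, fun i => e.symm ⟨v i, hv i⟩, fun j => e j, fun j => w (g (e j)),
    fun j => ⟨g (e j), ?_⟩, fun i j hij => ?_, fun i j hij => ?_, ?_, ?_⟩
  · rw [OrderIso.symm_apply_eq]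
    exact Subtype.ext (hg _)
  · exact e.strictMono hij
  · rw [← hlt, hg, hg]
    exact e.strictMono hij
  · funext i
    simp
  · funext i
    exact heq _ _ (by simp [hg])

section Iterate

variable {M : Type*}

/-- The iterated Fubini powers of an ultrafilter. -/
noncomputable def Ultrafilter.iter (U : Ultrafilter M) : ∀ n, Ultrafilter (Fin n → M)
  | 0 => pure Fin.elim0
  | n + 1 => U.bind fun x => (iter U n).map (Fin.cons x)

variable (U : Ultrafilter M)

theorem Ultrafilter.eventually_iter_zero {P : (Fin 0 → M) → Prop} :
    (∀ᶠ x in U.iter 0, P x) ↔ P Fin.elim0 := Iff.rfl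

theorem Ultrafilter.eventually_iter_succ {n : ℕ} {P : (Fin (n + 1) → M) → Prop} :
    (∀ᶠ x in U.iter (n + 1), P x) ↔ ∀ᶠ a in U, ∀ᶠ x in U.iter n, P (Fin.cons a x : Fin (n + 1) → M) :=
  Iff.rfl

theorem Ultrafilter.eventually_iter_comp {n k : ℕ} {e : Fin k → Fin n} (he : StrictMono e)
    {P : (Fin k → M) → Prop} :
    (∀ᶠ x in U.iter n, P (x ∘ e)) ↔ ∀ᶠ x in U.iter k, P x := by
  induction n generalizing k with
  | zero =>
    obtain rfl : k = 0 := by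
      rcases k with _ | k
      · rfl
      · exact (e 0).elim0
    rw [show e = id from Subsingleton.elim _ _]
    rfl
  | succ n ih =>
    rw [eventually_iter_succ]
    by_cases h0 : ∃ i, e i = 0
    · obtain ⟨i, hi⟩ := h0
      rcases k with _ | k
      · exact i.elim0
      have e0 : e 0 = 0 := le_antisymm (hi ▸ he.monotone (Fin.zero_le i)) (Fin.zero_le _)
      have hpos : ∀ j : Fin k, e j.succ ≠ 0 := fun j =>
        (e0 ▸ he (Fin.succ_pos j) : (0 : Fin (n + 1)) < e j.succ).ne'
      have he' : StrictMono fun j : Fin k => (e j.succ).pred (hpos j) := fun j j' h =>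
        Fin.pred_lt_pred_iff.2 (he (Fin.succ_lt_succ_iff.2 h))
      rw [eventually_iter_succ]
      refine eventually_congr (Eventually.of_forall fun a => ?_)
      rw [← ih he']
      refine eventually_congr (Eventually.of_forall fun x => ?_)
      rw [show (Fin.cons a x : Fin (n + 1) → M) ∘ e =
        Fin.cons a (x ∘ fun j : Fin k => (e j.succ).pred (hpos j)) from ?_]
      funext j
      refine Fin.cases ?_ (fun j => ?_) j
      · simp [e0]
      · simp only [Function.comp_apply, Fin.cons_succ]
        conv_lhs => rw [← Fin.succ_pred (e j.succ) (hpos j), Fin.cons_succ]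
    · push Not at h0
      have he' : StrictMono fun j => (e j).pred (h0 j) := fun j j' h =>
        Fin.pred_lt_pred_iff.2 (he h)
      have : ∀ (a : M) (x : Fin n → M), (Fin.cons a x : Fin (n + 1) → M) ∘ e =
          x ∘ fun j => (e j).pred (h0 j) := by
        intro a x
        funext j
        simp only [Function.comp_apply]
        conv_lhs => rw [← Fin.succ_pred (e j) (h0 j), Fin.cons_succ]
      simp only [this, ih he', eventually_const]

variable {U}

theorem Ultrafilter.eventually_injective (hU : ∀ a, ∀ᶠ x : M in U, x ≠ a) (n : ℕ) :
    ∀ᶠ x : Fin n → M in U.iter n, Function.Injective x := by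
  have h2 : ∀ᶠ x : Fin 2 → M in U.iter 2, x 0 ≠ x 1 := by
    rw [eventually_iter_succ]
    refine Eventually.of_forall fun a => ?_
    rw [eventually_iter_succ]
    filter_upwards [hU a] with b hb
    rw [eventually_iter_zero]
    exact hb.symm
  have h3 : ∀ i j : Fin n, i < j → ∀ᶠ x : Fin n → M in U.iter n, x i ≠ x j := by
    intro i j hij
    have he : StrictMono ![i, j] := by
      intro a b hab
      fin_cases a <;> fin_cases b <;> simp_all
    exact (U.eventually_iter_comp he (P := fun x => x 0 ≠ x 1)).2 h2
  have h4 : ∀ᶠ x : Fin n → M in U.iter n, ∀ i j : Fin n, i < j → x i ≠ x j := by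
    simp only [eventually_all]
    exact h3
  filter_upwards [h4] with x hx i j hij
  rcases lt_trichotomy i j with h | h | h
  · exact absurd hij (hx i j h)
  · exact h
  · exact absurd hij.symm (hx j i h)

end Iterate

section Indiscernible

variable {L : FirstOrder.Language.{u, v}}

/-- There is a sequence of `n` distinct points on which the relations from `F` are given by order
patterns. -/
def HasIndiscernible (D : ∀ m, L.Relations m → Set (Fin m → Fin m → Prop)) (n : ℕ)
    (F : Finset (Σ m, L.Relations m)) (M : Type*) [L.Structure M] : Prop :=
  ∃ x : Fin n → M, Function.Injective x ∧ ∀ R ∈ F, ∀ v : Fin R.1 → Fin n,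
    (Structure.RelMap R.2 (x ∘ v) ↔ pat v ∈ D _ R.2)

theorem exists_hasIndiscernible (M : Type*) [L.Structure M] [Infinite M] :
    ∃ D : ∀ m, L.Relations m → Set (Fin m → Fin m → Prop), ∀ n F, HasIndiscernible D n F M := by
  let U : Ultrafilter M := hyperfilter M
  have hU : ∀ a, ∀ᶠ x : M in U, x ≠ a := fun a =>
    (hyperfilter_le_cofinite : (U : Filter M) ≤ cofinite) (eventually_cofinite_ne a)
  refine ⟨fun m R => {p | ∃ (n : ℕ) (v : Fin m → Fin n), p = pat v ∧
    ∀ᶠ x : Fin n → M in U.iter n, Structure.RelMap R (x ∘ v)}, fun n F => ?_⟩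
  have key : ∀ R : Σ m, L.Relations m, ∀ v : Fin R.1 → Fin n, ∀ᶠ x : Fin n → M in U.iter n,
      (Structure.RelMap R.2 (x ∘ v) ↔ pat v ∈ {p | ∃ (n : ℕ) (v : Fin R.1 → Fin n), p = pat v ∧
        ∀ᶠ x : Fin n → M in U.iter n, Structure.RelMap R.2 (x ∘ v)}) := by
    intro R v
    by_cases hv : ∀ᶠ x : Fin n → M in U.iter n, Structure.RelMap R.2 (x ∘ v)
    · filter_upwards [hv] with x hx
      exact iff_of_true hx ⟨n, v, rfl, hv⟩
    · have hv' := Ultrafilter.eventually_not.2 hv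
      filter_upwards [hv'] with x hx
      refine iff_of_false hx ?_
      rintro ⟨n', w, hvw, hw⟩
      obtain ⟨k, t, e, e', -, he, he', rfl, rfl⟩ := exists_factor_of_pat_eq hvw
      apply hv
      exact (U.eventually_iter_comp he (P := fun x => Structure.RelMap R.2 (x ∘ t))).2
        ((U.eventually_iter_comp he' (P := fun x => Structure.RelMap R.2 (x ∘ t))).1 hw)
  have h1 := Ultrafilter.eventually_injective hU n
  have h2 := (F.eventually_all (l := (U.iter n : Filter (Fin n → M)))).2 fun R _ =>
    eventually_all.2 (key R)
  exact (h1.and h2).exists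

open Classical in
/-- A sentence expressing the existence of indiscernible sequences. -/
noncomputable def indiscernibleSentence (D : ∀ m, L.Relations m → Set (Fin m → Fin m → Prop))
    (n : ℕ) (F : Finset (Σ m, L.Relations m)) : L.Sentence :=
  Formula.iExs (Fin n) (BoundedFormula.iInf (fun p : Σ R : F, Fin R.1.1 → Fin n =>
    let ψ : L.Formula (Empty ⊕ Fin n) := p.1.1.2.formula fun i => Term.var (Sum.inr (p.2 i))
    if pat p.2 ∈ D _ p.1.1.2 then ψ else ψ.not) ⊓
    BoundedFormula.iInf fun p : {p : Fin n × Fin n // p.1 ≠ p.2} =>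
      (Term.equal (Term.var (Sum.inr p.1.1)) (Term.var (Sum.inr p.1.2))).not)

theorem realize_indiscernibleSentence {D : ∀ m, L.Relations m → Set (Fin m → Fin m → Prop)}
    {n : ℕ} {F : Finset (Σ m, L.Relations m)} {M : Type*} [L.Structure M] :
    M ⊨ indiscernibleSentence D n F ↔ HasIndiscernible D n F M := by
  classical
  have hlit : ∀ (R : Σ m, L.Relations m) (v : Fin R.1 → Fin n) (w : Empty → M) (x : Fin n → M),
      (if pat v ∈ D _ R.2 then (R.2.formula fun i => Term.var (Sum.inr (v i)) :
        L.Formula (Empty ⊕ Fin n)) else (R.2.formula fun i => Term.var (Sum.inr (v i)) :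
        L.Formula (Empty ⊕ Fin n)).not).Realize (Sum.elim w x) ↔
      (Structure.RelMap R.2 (x ∘ v) ↔ pat v ∈ D _ R.2) := by
    intro R v w x
    split_ifs with h <;> simp [h, Function.comp_def, Formula.realize_rel, Formula.realize_not]
  unfold indiscernibleSentence HasIndiscernible
  rw [Sentence.Realize, Formula.realize_iExs]
  refine exists_congr fun x => ?_
  rw [Formula.realize_inf, and_comm]
  refine and_congr ?_ ?_
  · rw [Formula.Realize, BoundedFormula.realize_iInf]
    refine ⟨fun h i j hij => ?_, fun h p => ?_⟩
    · by_contra hne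
      have := h ⟨(i, j), hne⟩
      exact this (Formula.realize_equal.2 hij)
    · exact fun hp => p.2 (h (Formula.realize_equal.1 hp))
  · rw [Formula.Realize, BoundedFormula.realize_iInf]
    refine ⟨fun h R hR v => (hlit R v _ x).1 (h ⟨⟨R, hR⟩, v⟩), fun h p => ?_⟩
    exact (hlit p.1.1 p.2 _ x).2 (h p.1.1 p.1.2 p.2)

end Indiscernible

section Chain

variable {L : FirstOrder.Language.{u, v}} {D : ∀ m, L.Relations m → Set (Fin m → Fin m → Prop)}

theorem IsMonomorphic.exists_enumeration [L.IsRelational] {N : Type w} [L.Structure N]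
    (hN : IsMonomorphic L N) {F : Finset (Σ m, L.Relations m)} (s : Finset N)
    (h : HasIndiscernible D s.card F N) :
    ∃ x : Fin s.card → N, Function.Injective x ∧ range x = s ∧
      ∀ R ∈ F, ∀ v : Fin R.1 → Fin s.card, (Structure.RelMap R.2 (x ∘ v) ↔ pat v ∈ D _ R.2) := by
  obtain ⟨x, hx, hxR⟩ := h
  have hcard : (range x).ncard = (s : Set N).ncard := by
    rw [← image_univ, ncard_image_of_injective _ hx, ncard_univ, Nat.card_fin, ncard_coe_finset]
  obtain ⟨f⟩ := hN (range x) s (finite_range x) s.finite_toSet hcard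
  let z : Fin s.card → range x := fun i => ⟨x i, mem_range_self i⟩
  have hz : Function.Injective z := fun i j h => hx (congrArg Subtype.val h)
  have hzs : Function.Surjective z := by
    rintro ⟨_, i, rfl⟩
    exact ⟨i, rfl⟩
  let := inducedStructure L (range x)
  let := inducedStructure L (s : Set N)
  refine ⟨fun i => f (z i), fun i j h => hz (f.injective (Subtype.val_injective h)), ?_, ?_⟩
  · ext a
    constructor
    · rintro ⟨i, rfl⟩
      exact (f (z i)).2
    · intro ha
      obtain ⟨i, hi⟩ := hzs (f.symm ⟨a, ha⟩)
      exact ⟨i, by simp [hi]⟩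
  · intro R hR v
    rw [← hxR R hR v]
    exact f.map_rel R.2 (z ∘ v)

theorem IsMonomorphic.exists_linearOrder [L.IsRelational] {N : Type w} [L.Structure N]
    (hN : IsMonomorphic L N) (h : ∀ n F, HasIndiscernible D n F N) :
    ∃ _ : LinearOrder N, DefinedBy D N := by
  classical
  choose x hinj hrange hpat using fun i : Finset N × Finset (Σ m, L.Relations m) =>
    hN.exists_enumeration i.1 (h i.1.card i.2)
  let lt : Finset N × Finset (Σ m, L.Relations m) → N → N → Prop := fun i a b =>
    ∃ j k, j < k ∧ x i j = a ∧ x i k = b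
  have hlt : ∀ i j k, lt i (x i j) (x i k) ↔ j < k := by
    intro i j k
    refine ⟨?_, fun h => ⟨j, k, h, rfl, rfl⟩⟩
    rintro ⟨j', k', hjk, h1, h2⟩
    rwa [hinj i h1, hinj i h2] at hjk
  let U : Ultrafilter (Finset N × Finset (Σ m, L.Relations m)) := Ultrafilter.of atTop
  have hU : (U : Filter (Finset N × Finset (Σ m, L.Relations m))) ≤ atTop := Ultrafilter.of_le atTop
  have hmem : ∀ a, ∀ᶠ i in (U : Filter _), a ∈ range (x i) := by
    intro a
    refine hU ((eventually_ge_atTop ({a}, ∅)).mono fun i hi => ?_)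
    rw [hrange]
    exact hi.1 (Finset.mem_singleton_self a)
  have hrel : ∀ R : Σ m, L.Relations m, ∀ᶠ i in (U : Filter (Finset N × Finset (Σ m, L.Relations m))), R ∈ i.2 := by
    intro R
    refine hU ((eventually_ge_atTop (∅, {R})).mono fun i hi => ?_)
    exact hi.2 (Finset.mem_singleton_self R)
  let r : N → N → Prop := fun a b => ∀ᶠ i in (U : Filter _), lt i a b
  have hr : ∀ a b, ∀ᶠ i in (U : Filter _), (lt i a b ↔ r a b) := by
    intro a b
    by_cases hab : r a b
    · exact hab.mono fun i hi => iff_of_true hi hab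
    · exact (Ultrafilter.eventually_not.2 hab).mono fun i hi => iff_of_false hi hab
  have hsto : IsStrictTotalOrder N r :=
    { irrefl := fun a ha => by
        obtain ⟨i, hi, ⟨j, rfl⟩⟩ := (ha.and (hmem a)).exists
        exact lt_irrefl _ ((hlt i j j).1 hi)
      trans := fun a b c hab hbc => by
        filter_upwards [hab, hbc, hmem a, hmem b, hmem c]
        rintro i h1 h2 ⟨j, rfl⟩ ⟨k, rfl⟩ ⟨l, rfl⟩
        rw [hlt] at *
        exact h1.trans h2
      trichotomous := fun a b hab hba => by
        obtain ⟨i, ⟨⟨j, rfl⟩, ⟨k, rfl⟩⟩, h1, h2⟩ := (((hmem a).and (hmem b)).and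
          ((Ultrafilter.eventually_not.2 hab).and (Ultrafilter.eventually_not.2 hba))).exists
        rw [hlt] at h1 h2
        rw [le_antisymm (not_lt.1 h2) (not_lt.1 h1)] }
  refine ⟨linearOrderOfSTO r, fun m R v => ?_⟩
  obtain ⟨i, h1, h2, h3⟩ := ((eventually_all.2 fun j => hmem (v j)).and
    ((hrel ⟨m, R⟩).and (eventually_all.2 fun j => eventually_all.2 fun k =>
      hr (v j) (v k)))).exists
  choose t ht using h1
  obtain rfl : x i ∘ t = v := funext ht
  rw [hpat i ⟨m, R⟩ h2 t]
  refine iff_of_eq (congrArg (· ∈ D m R) (funext fun j => funext fun k => propext ?_))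
  exact (hlt i _ _).symm.trans (h3 j k)

theorem IsMonomorphicTheory.exists_linearOrder [L.IsRelational] {T : L.Theory}
    (hT : IsMonomorphicTheory.{u, v, w} L T)
    (h : ∀ (N : Type w) [L.Structure N] [Nonempty N], N ⊨ T → ∀ n F, HasIndiscernible D n F N)
    (N : Type) [L.Structure N] [Nonempty N] (hN : N ⊨ T) : ∃ _ : LinearOrder N, DefinedBy D N := by
  let e : N ≃ ULift.{w} N := Equiv.ulift.symm
  let : L.Structure (ULift.{w} N) := e.inducedStructure
  let e' : N ≃[L] ULift.{w} N := e.inducedStructureEquiv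
  have hN' : ULift.{w} N ⊨ T := StrongHomClass.theory_model e'
  obtain ⟨lo, hlo⟩ := (hT _ hN').exists_linearOrder (h _ hN')
  refine ⟨LinearOrder.lift' e e.injective, fun m R v => ?_⟩
  rw [← e'.map_rel, hlo]
  rfl

end Chain

section FewTypes

variable {L : FirstOrder.Language.{u, v}}

/-- The complete type of a tuple. -/
def ltype (L : FirstOrder.Language.{u, v}) {A : Type*} [L.Structure A] {n : ℕ} (v : Fin n → A) :
    Set (L.Formula (Fin n)) :=
  {φ | φ.Realize v}

variable {A B : Type*} [L.Structure A] [L.Structure B]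

theorem ltype_comp {n k : ℕ} {v : Fin n → A} {w : Fin n → B} (h : ltype L v = ltype L w)
    (g : Fin k → Fin n) : ltype L (v ∘ g) = ltype L (w ∘ g) := by
  ext φ
  have := Set.ext_iff.1 h (φ.relabel g)
  simpa only [ltype, mem_ofPred_eq, Formula.realize_relabel] using this

theorem eq_iff_of_ltype_eq {n : ℕ} {v : Fin n → A} {w : Fin n → B} (h : ltype L v = ltype L w)
    (i j : Fin n) : v i = v j ↔ w i = w j := by
  have := Set.ext_iff.1 h (Term.equal (Term.var i) (Term.var j))
  simpa [ltype, Formula.realize_equal] using this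

theorem relMap_iff_of_ltype_eq {n : ℕ} {v : Fin n → A} {w : Fin n → B} (h : ltype L v = ltype L w)
    (R : L.Relations n) : Structure.RelMap R v ↔ Structure.RelMap R w := by
  have := Set.ext_iff.1 h (R.formula fun i => Term.var i)
  simpa [ltype, Formula.realize_rel] using this

/-- Existential quantification over the last variable. -/
noncomputable def exLast {n : ℕ} (χ : L.Formula (Fin (n + 1))) : L.Formula (Fin n) :=
  Formula.iExs (Fin 1) (χ.relabel (Fin.lastCases (Sum.inr 0) Sum.inl : Fin (n + 1) → Fin n ⊕ Fin 1))

theorem realize_exLast {n : ℕ} {χ : L.Formula (Fin (n + 1))} {v : Fin n → A} :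
    (exLast χ).Realize v ↔ ∃ a, χ.Realize (Fin.snoc v a : Fin (n + 1) → A) := by
  have hg : ∀ y : Fin 1 → A, Sum.elim v y ∘
      (Fin.lastCases (Sum.inr 0) Sum.inl : Fin (n + 1) → Fin n ⊕ Fin 1) =
        (Fin.snoc v (y 0) : Fin (n + 1) → A) := by
    intro y
    funext i
    induction i using Fin.lastCases with
    | last => simp
    | cast i => simp
  simp only [exLast, Formula.realize_iExs, Formula.realize_relabel, hg]
  exact ⟨fun ⟨y, hy⟩ => ⟨y 0, hy⟩, fun ⟨a, ha⟩ => ⟨fun _ => a, ha⟩⟩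

theorem exists_snoc_ltype_eq {n : ℕ} (hB : (range (ltype L : (Fin (n + 1) → B) → _)).Finite)
    {v : Fin n → A} {w : Fin n → B} (h : ltype L v = ltype L w) (a : A) :
    ∃ b, ltype L (Fin.snoc v a : Fin (n + 1) → A) = ltype L (Fin.snoc w b : Fin (n + 1) → B) := by
  classical
  by_contra hne
  push Not at hne
  have hsep : ∀ q : range (ltype L : (Fin (n + 1) → B) → _), ∃ φ : L.Formula (Fin (n + 1)),
      φ.Realize (Fin.snoc v a : Fin (n + 1) → A) ∧
        (q.1 ≠ ltype L (Fin.snoc v a : Fin (n + 1) → A) → φ ∉ q.1) := by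
    rintro ⟨_, x, rfl⟩
    by_cases hx : ltype L x = ltype L (Fin.snoc v a : Fin (n + 1) → A)
    · exact ⟨⊤, by simp, fun h => absurd hx h⟩
    · obtain ⟨φ, hφ⟩ := not_forall.1 (mt Set.ext hx)
      by_cases h1 : φ ∈ ltype L x
      · have h2 : φ ∉ ltype L (Fin.snoc v a : Fin (n + 1) → A) := fun h2 => hφ (iff_of_true h1 h2)
        exact ⟨φ.not, h2, fun _ h3 => h3 h1⟩
      · have h2 : φ ∈ ltype L (Fin.snoc v a : Fin (n + 1) → A) := by
          by_contra h2
          exact hφ (iff_of_false h1 h2)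
        exact ⟨φ, h2, fun _ => h1⟩
  choose φ hφ1 hφ2 using hsep
  have : Finite (range (ltype L : (Fin (n + 1) → B) → _)) := hB
  let χ : L.Formula (Fin (n + 1)) := BoundedFormula.iInf φ
  have hψ : exLast χ ∈ ltype L v :=
    realize_exLast.2 ⟨a, BoundedFormula.realize_iInf.2 hφ1⟩
  rw [h] at hψ
  obtain ⟨b, hb⟩ := realize_exLast.1 hψ
  exact hφ2 ⟨_, _, rfl⟩ (hne b).symm (BoundedFormula.realize_iInf.1 hb ⟨_, _, rfl⟩)

/-- A relation between two structures which preserves complete types. -/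
def TypePreserving (L : FirstOrder.Language.{u, v}) [L.Structure A] [L.Structure B]
    (r : Set (A × B)) : Prop :=
  ∀ (n : ℕ) (v : Fin n → A) (w : Fin n → B), (∀ i, (v i, w i) ∈ r) → ltype L v = ltype L w

theorem TypePreserving.swap {r : Set (A × B)} (h : TypePreserving L r) :
    TypePreserving L (Prod.swap ⁻¹' r) :=
  fun n v w hvw => (h n w v hvw).symm

theorem TypePreserving.exists_insert {r : Set (A × B)} (h : TypePreserving L r) (hr : r.Finite)
    (hB : ∀ n, (range (ltype L : (Fin n → B) → _)).Finite) (a : A) :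
    ∃ b, TypePreserving L (insert (a, b) r) := by
  obtain ⟨n, f, hf⟩ := hr.fin_embedding
  obtain ⟨b, hb⟩ := exists_snoc_ltype_eq (hB (n + 1))
    (h n (fun i => (f i).1) (fun i => (f i).2) fun i => hf ▸ mem_range_self i) a
  refine ⟨b, fun k v w hvw => ?_⟩
  have hex : ∀ j, ∃ i : Fin (n + 1), (Fin.snoc (fun i => (f i).1) a : Fin (n + 1) → A) i = v j ∧
      (Fin.snoc (fun i => (f i).2) b : Fin (n + 1) → B) i = w j := by
    intro j
    rcases hvw j with hj | hj
    · rw [Prod.mk_inj] at hj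
      exact ⟨Fin.last n, by simp [hj.1], by simp [hj.2]⟩
    · rw [← hf] at hj
      obtain ⟨i, hi⟩ := hj
      exact ⟨i.castSucc, by simp [hi], by simp [hi]⟩
  choose g hg1 hg2 using hex
  rw [← funext hg1, ← funext hg2]
  exact ltype_comp hb g

theorem nonempty_equiv_of_finite_ltype [L.IsRelational] [Countable A] [Countable B] [Nonempty A]
    [Nonempty B]
    (hA : ∀ n, (range (ltype L : (Fin n → A) → _)).Finite)
    (hB : ∀ n, (range (ltype L : (Fin n → B) → _)).Finite)
    (h : TypePreserving L (∅ : Set (A × B))) : Nonempty (A ≃[L] B) := by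
  obtain ⟨f, hf⟩ := exists_surjective_nat A
  obtain ⟨g, hg⟩ := exists_surjective_nat B
  have step : ∀ (s : {r : Set (A × B) // r.Finite ∧ TypePreserving L r}) (k : ℕ),
      ∃ s' : {r : Set (A × B) // r.Finite ∧ TypePreserving L r}, s.1 ⊆ s'.1 ∧
        (∃ b, (f k, b) ∈ s'.1) ∧ ∃ a, (a, g k) ∈ s'.1 := by
    rintro ⟨r, hr, hr'⟩ k
    obtain ⟨b, hb⟩ := hr'.exists_insert hr hB (f k)
    have hfin := hr.insert (f k, b)
    obtain ⟨a, ha⟩ := hb.swap.exists_insert (hfin.preimage Prod.swap_injective.injOn) hA (g k)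
    have e : Prod.swap ⁻¹' insert (g k, a) (Prod.swap ⁻¹' insert (f k, b) r) =
        insert (a, g k) (insert (f k, b) r) := by
      ext ⟨x, y⟩
      simp [and_comm]
    have h3 := ha.swap
    rw [e] at h3
    exact ⟨⟨_, hfin.insert _, h3⟩, fun p hp => Or.inr (Or.inr hp), ⟨b, Or.inr (Or.inl rfl)⟩,
      ⟨a, Or.inl rfl⟩⟩
  choose next hnext1 hnext2 hnext3 using step
  let s : ℕ → {r : Set (A × B) // r.Finite ∧ TypePreserving L r} := fun k =>
    Nat.rec ⟨∅, finite_empty, h⟩ (fun k t => next t k) k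
  have hmono : Monotone fun k => (s k).1 := monotone_nat_of_le_succ fun k => hnext1 (s k) k
  have hF : TypePreserving L (⋃ k, (s k).1) := by
    intro n v w hvw
    choose k hk using fun i => mem_iUnion.1 (hvw i)
    refine (s (Finset.univ.sup k)).2.2 n v w fun i => ?_
    exact hmono (Finset.le_sup (Finset.mem_univ i)) (hk i)
  have h1 : ∀ a, ∃ b, (a, b) ∈ ⋃ k, (s k).1 := by
    intro a
    obtain ⟨k, rfl⟩ := hf a
    obtain ⟨b, hb⟩ := hnext2 (s k) k
    exact ⟨b, mem_iUnion.2 ⟨k + 1, hb⟩⟩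
  have h2 : ∀ b, ∃ a, (a, b) ∈ ⋃ k, (s k).1 := by
    intro b
    obtain ⟨k, rfl⟩ := hg b
    obtain ⟨a, ha⟩ := hnext3 (s k) k
    exact ⟨a, mem_iUnion.2 ⟨k + 1, ha⟩⟩
  have heq : ∀ a b a' b', (a, b) ∈ ⋃ k, (s k).1 → (a', b') ∈ ⋃ k, (s k).1 →
      (a = a' ↔ b = b') := by
    intro a b a' b' hab hab'
    refine eq_iff_of_ltype_eq (hF 2 ![a, a'] ![b, b'] fun i => ?_) 0 1
    fin_cases i
    · exact hab
    · exact hab'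
  choose F hFmem using h1
  have hbij : Function.Bijective F := by
    refine ⟨fun a a' haa => (heq _ _ _ _ (hFmem a) (hFmem a')).2 haa, fun b => ?_⟩
    obtain ⟨a, ha⟩ := h2 b
    exact ⟨a, (heq _ _ _ _ (hFmem a) ha).1 rfl⟩
  exact ⟨{ Equiv.ofBijective F hbij with
    map_fun' := fun f _ => isEmptyElim f
    map_rel' := fun R v => (relMap_iff_of_ltype_eq (hF _ v (F ∘ v) fun i => hFmem (v i)) R).symm }⟩

end FewTypes

theorem Piece.ordConnected_of_univ {α : Type*} [LinearOrder α] {p : Set α}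
    (h : Piece univ p) : p.OrdConnected := by
  induction h with
  | self => exact ordConnected_univ
  | inter_Iio _ _ ih => exact ih.inter ordConnected_Iio
  | inter_Ioi _ _ ih => exact ih.inter ordConnected_Ioi

theorem Piece.inter_Iio_or {α : Type*} [LinearOrder α] {p : Set α} (h : Piece univ p) (a : α) :
    p ∩ Iio a = ∅ ∨ Piece univ (p ∩ Iio a) := by
  by_cases ha : a ∈ p
  · exact Or.inr (h.inter_Iio ha)
  rcases (p ∩ Iio a).eq_empty_or_nonempty with h0 | ⟨z, hz, hza⟩
  · exact Or.inl h0
  · refine Or.inr ?_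
    rw [inter_eq_left.2]
    · exact h
    · intro y hy
      by_contra hya
      exact ha (h.ordConnected_of_univ.out hz hy ⟨le_of_lt hza, not_lt.1 hya⟩)

theorem Piece.inter_Ioi_or {α : Type*} [LinearOrder α] {p : Set α} (h : Piece univ p) (a : α) :
    p ∩ Ioi a = ∅ ∨ Piece univ (p ∩ Ioi a) := by
  by_cases ha : a ∈ p
  · exact Or.inr (h.inter_Ioi ha)
  rcases (p ∩ Ioi a).eq_empty_or_nonempty with h0 | ⟨z, hz, hza⟩
  · exact Or.inl h0
  · refine Or.inr ?_
    rw [inter_eq_left.2]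
    · exact h
    · intro y hy
      by_contra hya
      exact ha (h.ordConnected_of_univ.out hy hz ⟨not_lt.1 hya, le_of_lt hza⟩)

theorem cell_empty_or_piece {α δ : Type*} [LinearOrder α] (f : δ → α) {r : Set δ}
    (hr : r.Finite) (S : Set δ) : cell f r S = ∅ ∨ Piece univ (cell f r S) := by
  induction r, hr using Set.Finite.induction_on with
  | empty =>
    right
    have : cell f ∅ S = univ := by simp [cell]
    rw [this]
    exact Piece.self
  | @insert a t _ _ ih =>
    by_cases ha : a ∈ S
    · rw [cell_insert_of_mem _ _ ha]
      rcases ih with h | h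
      · simp [h]
      · exact h.inter_Ioi_or _
    · rw [cell_insert_of_notMem _ _ ha]
      rcases ih with h | h
      · simp [h]
      · exact h.inter_Iio_or _

section

variable {L : FirstOrder.Language.{u, v}} {D : ∀ m, L.Relations m → Set (Fin m → Fin m → Prop)}
  {A B : Type*} [LinearOrder A] [LinearOrder B] [L.Structure A] [L.Structure B]

theorem DefinedBy.ltype_eq [L.IsRelational] [Nonempty A] (hA : DefinedBy D A) (hB : DefinedBy D B)
    {n : ℕ} {v : Fin n → A} {w : Fin n → B} (hp : pat v = pat w)
    (hc : ∀ S, Th (cell v univ S) = Th (cell w univ S)) : ltype L v = ltype L w := by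
  have hr : ∀ k, CellEquiv k (range fun i => (v i, w i)) := by
    refine fun k => ⟨?_, fun S => ?_⟩
    · rintro _ ⟨i, rfl⟩ _ ⟨j, rfl⟩
      exact iff_of_eq (congrFun (congrFun hp i) j)
    · have e1 : cell Prod.fst (range fun i => (v i, w i)) S =
          cell v univ ((fun i => (v i, w i)) ⁻¹' S) := by
        ext z
        simp [cell]
      have e2 : cell Prod.snd (range fun i => (v i, w i)) S =
          cell w univ ((fun i => (v i, w i)) ⁻¹' S) := by
        ext z
        simp [cell]
      rw [e1, e2]
      exact congrFun (hc _) k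
  ext φ
  exact BackForth.realize_iff hA hB φ (hr _).backForth (fun i => mem_range_self i)
    fun i => i.elim0

theorem DefinedBy.finite_ltype [L.IsRelational] [Nonempty A] (hA : DefinedBy D A)
    (hfin : FinTh (univ : Set A)) (n : ℕ) : (range (ltype L : (Fin n → A) → _)).Finite := by
  let inv : (Fin n → A) → (Fin n → Fin n → Prop) × (Set (Fin n) → ∀ n, OrdTyp n) := fun v =>
    (pat v, fun S => Th (cell v univ S))
  have hinv : (range inv).Finite := by
    refine (finite_univ.prod (Set.Finite.pi' fun _ : Set (Fin n) =>
      hfin.finite.insert (Th (∅ : Set A)))).subset ?_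
    rintro _ ⟨v, rfl⟩
    refine ⟨trivial, fun S => ?_⟩
    rcases cell_empty_or_piece v finite_univ S with h | h
    · exact Or.inl (congrArg Th h)
    · exact Or.inr ⟨_, h, rfl⟩
  have hfac : Function.FactorsThrough (ltype L : (Fin n → A) → _) inv := fun v w h =>
    hA.ltype_eq hA (congrArg Prod.fst h) (congrFun (congrArg Prod.snd h))
  obtain ⟨e, he⟩ := (Function.factorsThrough_iff _).1 hfac
  rw [he, range_comp]
  exact hinv.image e

theorem typePreserving_empty {A B : Type*} [L.Structure A] [L.Structure B]
    (h : ∀ φ : L.Sentence, A ⊨ φ ↔ B ⊨ φ) : TypePreserving L (∅ : Set (A × B)) := by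
  intro n v w hvw
  obtain rfl : n = 0 := by
    rcases n with _ | n
    · rfl
    · exact (hvw 0).elim
  ext φ
  have := h (φ.relabel (Fin.elim0 : Fin 0 → Empty))
  simp only [Sentence.Realize, Formula.realize_relabel] at this
  rwa [Subsingleton.elim (default ∘ Fin.elim0) v, Subsingleton.elim (default ∘ Fin.elim0) w] at this

end

section Nontrivial

variable {m : ℕ} {E : Set (Fin m → Fin m → Prop)}

theorem exists_surjective_fin_pat_eq {α : Type*} [LinearOrder α] (v : Fin m → α) :
    ∃ (k : ℕ) (u : Fin m → Fin k), Function.Surjective u ∧ pat v = pat u ∧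
      ∀ i j, v i = v j ↔ u i = u j := by
  obtain ⟨k, u, e, -, hu, he, -, rfl, -⟩ := exists_factor_of_pat_eq (rfl : pat v = pat v)
  refine ⟨k, u, hu, ?_, fun i j => he.injective.eq_iff⟩
  exact funext fun i => funext fun j => propext he.lt_iff_lt

theorem pat_perm_comp_mem_iff
    (h : ∀ (c : Fin m → ℕ) (i : ℕ), pat c ∈ E ↔ pat (Equiv.swap i (i + 1) ∘ c) ∈ E) {k : ℕ}
    (σ : Equiv.Perm (Fin k)) (u : Fin m → Fin k) : pat u ∈ E ↔ pat (σ ∘ u) ∈ E := by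
  rcases k with _ | k
  · rw [show σ ∘ u = u from funext fun i => (u i).elim0]
  have hσ : σ ∈ Submonoid.closure (range fun i : Fin k => Equiv.swap i.castSucc i.succ) := by
    rw [Equiv.Perm.mclosure_swap_castSucc_succ]
    trivial
  have hval : ∀ u : Fin m → Fin (k + 1), pat (Fin.val ∘ u) = pat u := fun u => rfl
  induction hσ using Submonoid.closure_induction generalizing u with
  | mem σ hσ =>
    obtain ⟨i, rfl⟩ := hσ
    rw [← hval, h _ i, ← hval]
    rw [show Equiv.swap (i : ℕ) (i + 1) ∘ Fin.val ∘ u =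
      Fin.val ∘ Equiv.swap i.castSucc i.succ ∘ u from ?_]
    funext j
    simp only [Function.comp_apply, Equiv.swap_apply_def, Fin.ext_iff, Fin.val_castSucc,
      Fin.val_succ]
    split_ifs <;> simp
  | one => rfl
  | mul σ τ _ _ hσ hτ => exact (hτ u).trans (hσ (τ ∘ u))

theorem pat_mem_iff_of_ker_eq
    (h : ∀ (c : Fin m → ℕ) (i : ℕ), pat c ∈ E ↔ pat (Equiv.swap i (i + 1) ∘ c) ∈ E)
    {α β : Type*} [LinearOrder α] [LinearOrder β] {v : Fin m → α} {w : Fin m → β}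
    (hvw : ∀ i j, v i = v j ↔ w i = w j) : pat v ∈ E ↔ pat w ∈ E := by
  obtain ⟨k, s, hs, hs1, hs2⟩ := exists_surjective_fin_pat_eq v
  obtain ⟨l, t, ht, ht1, ht2⟩ := exists_surjective_fin_pat_eq w
  have hst : ∀ i j, s i = s j ↔ t i = t j := fun i j => by rw [← hs2, hvw, ht2]
  choose g hg using hs
  have hgt : ∀ i, t (g (s i)) = t i := fun i => (hst _ _).1 (hg _)
  have hbij : Function.Bijective fun j => t (g j) := by
    refine ⟨fun j j' hjj => ?_, fun y => ?_⟩
    · have := (hst _ _).2 hjj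
      rwa [hg, hg] at this
    · obtain ⟨i, rfl⟩ := ht y
      exact ⟨s i, hgt i⟩
  obtain rfl : k = l := by simpa using Fintype.card_of_bijective hbij
  rw [hs1, ht1, pat_perm_comp_mem_iff h (Equiv.ofBijective _ hbij) s]
  rw [show Equiv.ofBijective _ hbij ∘ s = t from funext hgt]

theorem exists_swapWitness {c : Fin m → ℕ} {i : ℕ}
    (h : ¬ (pat c ∈ E ↔ pat (Equiv.swap i (i + 1) ∘ c) ∈ E)) : ∃ k, SwapWitness E k c i := by
  refine ⟨Finset.univ.sup c + i + 2, fun j => ?_, by omega, h⟩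
  have := Finset.le_sup (f := c) (Finset.mem_univ j)
  omega

end Nontrivial

section

variable {L : FirstOrder.Language.{u, v}} {D : ∀ m, L.Relations m → Set (Fin m → Fin m → Prop)}

theorem DefinedBy.equiv_of_swap_invariant [L.IsRelational] {A B : Type*} [LinearOrder A]
    [LinearOrder B] [L.Structure A] [L.Structure B] (hA : DefinedBy D A) (hB : DefinedBy D B)
    (h : ∀ m (R : L.Relations m) (c : Fin m → ℕ) (i : ℕ),
      pat c ∈ D m R ↔ pat (Equiv.swap i (i + 1) ∘ c) ∈ D m R) (e : A ≃ B) : Nonempty (A ≃[L] B) :=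
  ⟨{ e with
    map_fun' := fun f _ => isEmptyElim f
    map_rel' := fun {m} R v => by
      rw [hA, hB]
      exact pat_mem_iff_of_ker_eq (h m R) fun i j => e.injective.eq_iff }⟩

end

theorem exists_countable_Th_eq (M : Type*) [LinearOrder M] [Infinite M] :
    ∃ (A : Type) (_ : LinearOrder A), Countable A ∧ Infinite A ∧
      Th (univ : Set A) = Th (univ : Set M) := by
  let ι := Infinite.natEmbedding M
  obtain ⟨K, hK, hιK, -, htp⟩ := exists_countable_tp_eq {(univ : Set M)} (countable_singleton _)
    (fun _ => ∅) (fun _ => countable_empty) (countable_range ι)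
  have : Countable K := hK
  have : Infinite K := ((infinite_range_of_injective ι.injective).mono hιK).to_subtype
  obtain ⟨e⟩ : Nonempty (ℕ ≃ K) := nonempty_equiv_of_countable
  let lo : LinearOrder ℕ := LinearOrder.lift' e e.injective
  have hK' : Th K = Th (univ : Set M) := funext fun n => by
    show tp n K = tp n univ
    simpa [cut] using htp n univ rfl [] (by simp)
  refine ⟨ℕ, lo, inferInstance, inferInstance, ?_⟩
  have himage : (e : ℕ → K) '' univ = univ := by rw [image_univ, e.range_eq_univ]
  refine ((@Th_image ℕ K lo _ e univ fun _ _ _ _ h => h).symm.trans ?_).trans hK'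
  rw [himage, Th_univ_subtype]

section Count

open scoped Cardinal

variable {L : FirstOrder.Language.{u, v}} {T : L.Theory}
  {D : ∀ m, L.Relations m → Set (Fin m → Fin m → Prop)}

/-- The bijection `g` transports the structure given by order patterns to `S`. -/
def IsCoordinate (D : ∀ m, L.Relations m → Set (Fin m → Fin m → Prop)) {A : Type*} [LinearOrder A]
    (S : L.Structure ℕ) (g : A ≃ ℕ) : Prop :=
  ∀ m (R : L.Relations m) (v : Fin m → A), pat v ∈ D m R ↔ S.RelMap R (g ∘ v)

theorem exists_class_isCoordinate [L.IsRelational] (A : Type) [LinearOrder A] [Countable A]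
    [Infinite A] (hA : @Theory.Model L A (patStructure D A) T) :
    ∃ (c : CountableModelClasses L T) (g : A ≃ ℕ), IsCoordinate D (Quot.out c).1 g := by
  obtain ⟨e⟩ : Nonempty (A ≃ ℕ) := nonempty_equiv_of_countable
  let SA : L.Structure A := patStructure D A
  let SN : L.Structure ℕ := e.inducedStructure
  have hN : ℕ ⊨ T := StrongHomClass.theory_model (e.inducedStructureEquiv : A ≃[L] ℕ)
  let c : CountableModelClasses L T := Quot.mk _ ⟨SN, hN⟩
  have hc := Quot.eqvGen_exact (Quot.out_eq c)
  have hiso : Nonempty (@Language.Equiv L ℕ ℕ (Quot.out c).1 SN) := by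
    refine (Equivalence.eqvGen_iff (r := fun S₁ S₂ : {S : L.Structure ℕ // @Theory.Model L ℕ S T} =>
      Nonempty (@Language.Equiv L ℕ ℕ S₁.1 S₂.1)) ?_).1 hc
    refine ⟨fun S => ⟨@Language.Equiv.refl L ℕ S.1⟩, ?_, ?_⟩
    · rintro S₁ S₂ ⟨f⟩
      exact ⟨@Language.Equiv.symm L ℕ ℕ S₁.1 S₂.1 f⟩
    · rintro S₁ S₂ S₃ ⟨f⟩ ⟨g⟩
      exact ⟨@Language.Equiv.comp L ℕ ℕ S₁.1 S₂.1 ℕ S₃.1 g f⟩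
  obtain ⟨f⟩ := hiso
  refine ⟨c, e.trans (@Language.Equiv.toEquiv L ℕ ℕ (Quot.out c).1 SN f).symm, fun m R v => ?_⟩
  have h1 := @Language.Equiv.map_rel L ℕ ℕ (Quot.out c).1 SN f m R
    ((@Language.Equiv.toEquiv L ℕ ℕ (Quot.out c).1 SN f).symm ∘ e ∘ v)
  have h2 := (e.inducedStructureEquiv : A ≃[L] ℕ).map_rel R v
  refine h2.symm.trans (Iff.trans (iff_of_eq (congrArg (SN.RelMap R) ?_)) h1)
  funext i
  exact ((@Language.Equiv.toEquiv L ℕ ℕ (Quot.out c).1 SN f).apply_symm_apply _).symm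

theorem continuum_le_of_injective {C : Type w} {X : Type} [Countable X]
    {F : Set ℕ → C × X} (hF : Function.Injective F) : 𝔠 ≤ #C := by
  have h1 := Cardinal.lift_mk_le_lift_mk_of_injective hF
  rw [Cardinal.mk_prod] at h1
  simp only [Cardinal.mk_set, Cardinal.mk_nat, Cardinal.lift_uzero, Cardinal.two_power_aleph0,
    Cardinal.lift_continuum] at h1
  by_contra h2
  have h3 : #C * Cardinal.lift.{w} #X < 𝔠 := Cardinal.mul_lt_of_lt Cardinal.aleph0_le_continuum
    (not_le.1 h2) ((Cardinal.lift_le_aleph0.2 Cardinal.mk_le_aleph0).trans_lt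
      Cardinal.aleph0_lt_continuum)
  exact absurd h3 (not_lt.2 (by simpa using h1))

theorem numCountableModels_eq_one (S : {S : L.Structure ℕ // @Theory.Model L ℕ S T})
    (h : ∀ S₁ S₂ : {S : L.Structure ℕ // @Theory.Model L ℕ S T},
      Nonempty (@Language.Equiv L ℕ ℕ S₁.1 S₂.1)) : numCountableModels L T = 1 := by
  refine Cardinal.eq_one_iff_unique.2 ⟨⟨?_⟩, ⟨Quot.mk _ S⟩⟩
  rintro ⟨S₁⟩ ⟨S₂⟩
  exact Quot.sound (h S₁ S₂)

theorem numCountableModels_le_continuum [L.IsRelational]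
    (h : ∀ S : {S : L.Structure ℕ // @Theory.Model L ℕ S T},
      ∃ lo : LinearOrder ℕ, @DefinedBy L D ℕ S.1 lo) : numCountableModels L T ≤ 𝔠 := by
  choose lo hlo using h
  let F : CountableModelClasses L T → ℕ → ℕ → Prop := fun c => (lo (Quot.out c)).lt
  have hF : Function.Injective F := by
    intro c d hcd
    have hout : Quot.out c = Quot.out d := by
      refine Subtype.ext (Structure.ext ?_ ?_)
      · funext n f
        exact isEmptyElim f
      · funext n R v
        refine propext ((hlo _ n R v).trans (Iff.trans ?_ (hlo _ n R v).symm))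
        refine iff_of_eq (congrArg (· ∈ D n R) (funext fun i => funext fun j => ?_))
        exact congrFun (congrFun hcd (v i)) (v j)
    exact (Quot.out_eq c).symm.trans ((congrArg (Quot.mk _) hout).trans (Quot.out_eq d))
  have h1 := Cardinal.lift_mk_le_lift_mk_of_injective hF
  simpa [numCountableModels] using h1

theorem DefinedBy.nonempty_equiv_of_finTh [L.IsRelational] {A B : Type} {_ : LinearOrder A}
    {_ : LinearOrder B} {_ : L.Structure A} {_ : L.Structure B} [Countable A] [Countable B]
    [Nonempty A] [Nonempty B] (hA : DefinedBy D A) (hB : DefinedBy D B)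
    (hfA : FinTh (univ : Set A)) (hfB : FinTh (univ : Set B))
    (h : ∀ φ : L.Sentence, A ⊨ φ ↔ B ⊨ φ) : Nonempty (A ≃[L] B) :=
  nonempty_equiv_of_finite_ltype (hA.finite_ltype hfA) (hB.finite_ltype hfB)
    (typePreserving_empty h)

theorem frame_of_strictMono {A : Type*} [LinearOrder A] {k : ℕ} {p q : Fin (k + 1) → A}
    (hp : StrictMono p) (hq : StrictMono q) (h : ∀ i j, p i < q j) :
    Frame (k + 1) (fun t => p (Fin.ofNat (k + 1) t)) (fun t => q (Fin.ofNat (k + 1) t)) := by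
  have hlt : ∀ s t, s < t → t < k + 1 → Fin.ofNat (k + 1) s < Fin.ofNat (k + 1) t := by
    intro s t hst ht
    rw [Fin.lt_def, Fin.val_ofNat, Fin.val_ofNat, Nat.mod_eq_of_lt ht,
      Nat.mod_eq_of_lt (hst.trans ht)]
    exact hst
  exact ⟨fun s t hst ht => hp (hlt s t hst ht), fun s t hst ht => hq (hlt s t hst ht),
    fun s t _ _ => h _ _⟩

theorem continuum_le_numCountableModels [L.IsRelational] {m k i : ℕ} {R : L.Relations m}
    {c : Fin m → ℕ} (hw : SwapWitness (D m R) k c i) {A : Type} {_ : LinearOrder A}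
    {_ : L.Structure A} [Countable A] [Nonempty A] (hA : DefinedBy D A)
    (hinf : ¬ FinTh (univ : Set A)) (hT : A ⊨ T) : 𝔠 ≤ numCountableModels L T := by
  obtain ⟨N, lo, hcount, hinfN, hTh, hrigid⟩ := exists_order_family A hinf
  obtain ⟨p, q, hp, hq, hpq, hrig⟩ := hrigid (2 * k)
  have hmodel : ∀ S, @Theory.Model L (N S) (patStructure D (N S)) T := fun S =>
    @DefinedBy.model_of_Th_eq _ _ _ _ _ _ _ (patStructure D (N S)) _ _ hA
      (definedBy_patStructure D (N S)) (hTh S).symm T hT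
  choose C g hg using fun S => exists_class_isCoordinate (N S) (hmodel S)
  refine continuum_le_of_injective (F := fun S => (C S, (g S ∘ p S, g S ∘ q S))) fun S S' h => ?_
  obtain ⟨hC, hP, hQ⟩ : C S = C S' ∧ g S ∘ p S = g S' ∘ p S' ∧ g S ∘ q S = g S' ∘ q S' := by
    simpa [Prod.mk_inj] using h
  let f : N S ≃ N S' := (g S).trans (g S').symm
  have hfp : ∀ t, f (p S t) = p S' t := fun t => by
    simpa [f, Equiv.symm_apply_eq] using congrFun hP t
  have hfq : ∀ t, f (q S t) = q S' t := fun t => by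
    simpa [f, Equiv.symm_apply_eq] using congrFun hQ t
  have hE : ∀ v : Fin m → N S, pat v ∈ D m R ↔ pat (f ∘ v) ∈ D m R := fun v => by
    rw [hg S m R v, hg S' m R (f ∘ v), hC]
    have : g S' ∘ f ∘ v = g S ∘ v := funext fun j => by simp [f]
    rw [this]
  have hB := frame_of_strictMono (hp S') (hq S') (hpq S')
  simp only [← hfp, ← hfq] at hB
  have hlast : Fin.ofNat (2 * k + 1) (2 * k) = Fin.last (2 * k) := by
    ext
    simp
  have hzero : Fin.ofNat (2 * k + 1) 0 = 0 := rfl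
  have := hw.rigid f hE (frame_of_strictMono (hp S) (hq S) (hpq S)) hB
  simp only [hlast, hzero, hfp, hfq] at this
  exact hrig S S' f this.1 this.2

end Count

/-- **Vaught's Conjecture for monomorphic theories.**
If `T` is a complete monomorphic theory in a relational language having infinite models,
then the number `I(T,ω)` of isomorphism classes of countably infinite models of `T`
is either `1` or `2^ℵ₀ = 𝔠`. -/
theorem vaught_conjecture_for_monomorphic_theories
    (L : FirstOrder.Language.{u, v}) [L.IsRelational] (T : L.Theory)
    (hcomplete : T.IsComplete)
    (hmono : IsMonomorphicTheory.{u, v, w} L T)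
    (hinf : ∃ (M : Type w) (_ : L.Structure M), Infinite M ∧ M ⊨ T) :
    numCountableModels L T = 1 ∨ numCountableModels L T = Cardinal.continuum := by
  obtain ⟨M, _, _, hM⟩ := hinf
  obtain ⟨D, hD⟩ := exists_hasIndiscernible (L := L) M
  have hind : ∀ (N : Type w) [L.Structure N] [Nonempty N], N ⊨ T →
      ∀ n F, HasIndiscernible D n F N := fun N _ _ hN n F => by
    rw [← realize_indiscernibleSentence, hcomplete.realize_sentence_iff _ N,
      ← hcomplete.realize_sentence_iff _ M, realize_indiscernibleSentence]
    exact hD n F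
  obtain ⟨_, hMD⟩ := (hmono M hM).exists_linearOrder hD
  obtain ⟨A, _, _, _, hA⟩ := exists_countable_Th_eq M
  have hAT : @Theory.Model L A (patStructure D A) T :=
    @DefinedBy.model_of_Th_eq _ _ _ _ _ _ _ (patStructure D A) _ _ hMD
      (definedBy_patStructure D A) hA.symm T hM
  obtain ⟨c, -, -⟩ := exists_class_isCoordinate A hAT
  have horder : ∀ S : {S : L.Structure ℕ // @Theory.Model L ℕ S T},
      ∃ lo : LinearOrder ℕ, @DefinedBy L D ℕ S.1 lo := fun S =>
    @IsMonomorphicTheory.exists_linearOrder _ _ _ _ hmono hind ℕ S.1 _ S.2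
  by_cases hswap : ∀ m (R : L.Relations m) (c : Fin m → ℕ) (i : ℕ),
      pat c ∈ D m R ↔ pat (Equiv.swap i (i + 1) ∘ c) ∈ D m R
  · refine Or.inl (numCountableModels_eq_one (Quot.out c) fun S₁ S₂ => ?_)
    obtain ⟨lo₁, h₁⟩ := horder S₁
    obtain ⟨lo₂, h₂⟩ := horder S₂
    exact @DefinedBy.equiv_of_swap_invariant L D _ ℕ ℕ lo₁ lo₂ S₁.1 S₂.1 h₁ h₂ hswap (Equiv.refl ℕ)
  by_cases hfin : ∀ (S : {S : L.Structure ℕ // @Theory.Model L ℕ S T}) (lo : LinearOrder ℕ),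
      @DefinedBy L D ℕ S.1 lo → @FinTh ℕ lo univ
  · refine Or.inl (numCountableModels_eq_one (Quot.out c) fun S₁ S₂ => ?_)
    obtain ⟨lo₁, h₁⟩ := horder S₁
    obtain ⟨lo₂, h₂⟩ := horder S₂
    refine h₁.nonempty_equiv_of_finTh h₂ (hfin S₁ lo₁ h₁) (hfin S₂ lo₂ h₂) fun φ => ?_
    exact (@Theory.IsComplete.realize_sentence_iff L T hcomplete φ ℕ S₁.1 S₁.2 _).trans
      (@Theory.IsComplete.realize_sentence_iff L T hcomplete φ ℕ S₂.1 S₂.2 _).symm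
  · push Not at hswap hfin
    obtain ⟨m, R, c, i, hci⟩ := hswap
    obtain ⟨k, hw⟩ := exists_swapWitness (E := D m R) (c := c) (i := i) (by tauto)
    obtain ⟨S, lo, hS, hfinS⟩ := hfin
    exact Or.inr ((numCountableModels_le_continuum horder).antisymm
      (continuum_le_numCountableModels hw hS hfinS S.2))
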